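/- For all integers s ≥ 3 and t with s+2 ≤ t ≤ 2s-1, there exists a constant c = c(s,t) > 0 such that for all sufficiently large n, f_{s,t}(n) ≤ n^{α_{s,t}} · (log n)^c. -/

import Mathlib

/-- The pair `(s,t)` is regular if `s ≥ 11` and `s+3 ≤ t ≤ 2s-4`, or if
`(s,t) ∈ {(10,14),(10,15)}`. -/
def IsRegularPair (s t : ℕ) : Prop :=
  (11 ≤ s ∧ s + 3 ≤ t ∧ t ≤ 2 * s - 4) ∨ (s = 10 ∧ t = 14) ∨ (s = 10 ∧ t = 15)

open Classical in
/-- The exponent `α = α_{s,t}`. -/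
noncomputable def ERalpha (s t : ℕ) : ℝ :=
  if IsRegularPair s t then
    (((s : ℝ) - 2) * ((t : ℝ) - (s : ℝ)) * ((t : ℝ) + (s : ℝ) - 1) + 2 * (t : ℝ) - 2 * (s : ℝ)) /
      ((2 * (s : ℝ) - 3) * ((t : ℝ) - (s : ℝ)) * ((t : ℝ) + (s : ℝ) - 1) - 2 * (s : ℝ) + 4)
  else
    (((s : ℝ) - 2) * ((t : ℝ) - (s : ℝ)) * ((s : ℝ) - 1) + (s : ℝ) - 1) /
      ((2 * (s : ℝ) - 3) * ((t : ℝ) - (s : ℝ)) * ((s : ℝ) - 1) + 2 * (s : ℝ) - (t : ℝ))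

/-- `δ = s - (2s-1)α`. -/
noncomputable def ERdelta (s t : ℕ) : ℝ := (s : ℝ) - (2 * (s : ℝ) - 1) * ERalpha s t

/-- `η = 2(1-α) - δ`. -/
noncomputable def EReta (s t : ℕ) : ℝ := 2 * (1 - ERalpha s t) - ERdelta s t

/-- The Erdős–Rogers function `f_{s,t}(n)`: the minimum over all `K_t`-free graphs `G`
on `n` vertices of the maximum size of a vertex subset inducing a `K_s`-free subgraph. -/
noncomputable def erdosRogers (s t n : ℕ) : ℕ :=
  sInf { k : ℕ | ∃ G : SimpleGraph (Fin n), G.CliqueFree t ∧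
    k = sSup { m : ℕ | ∃ A : Finset (Fin n), A.card = m ∧
      (G.induce (A : Set (Fin n))).CliqueFree s } }

section
/-- existence of the parameter `ε = 1 - 2α` with all properties used -/
theorem ER_eps (s d : ℕ) (hs : 3 ≤ s) (hd : 2 ≤ d) (hds : d + 1 ≤ s) :
    ∃ ε : ℝ, 0 < ε ∧ ERalpha s (s + d) = (1 - ε) / 2 ∧
      ε * ((2 * s - 3) * d * (s - 1) + s - d) ≤ ((s : ℝ) - 2) * (d - 1) ∧
      ε * ((2 * s - 3) * d * (2 * s + d - 1) - 2 * (s - 2)) ≤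
        (d : ℝ) * (2 * s + d - 5) - 2 * (s - 2) := by
  have hs' : (3 : ℝ) ≤ s := by exact_mod_cast hs
  have hd' : (2 : ℝ) ≤ d := by exact_mod_cast hd
  have hds' : (d : ℝ) + 1 ≤ s := by exact_mod_cast hds
  have hE : 0 < (2 * (s : ℝ) - 3) * d * (s - 1) + s - d := by
    have : 0 < (2 * (s : ℝ) - 3) * d * (s - 1) := by
      apply mul_pos (mul_pos _ _) <;> linarith
    linarith
  have hR : 0 < (2 * (s : ℝ) - 3) * d * (2 * s + d - 1) - 2 * (s - 2) := by
    have h1 : 2 * (s - 2) ≤ (2 * (s : ℝ) - 3) * d := by nlinarith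
    have h2 : (0:ℝ) < (2 * (s : ℝ) - 3) * d := by apply mul_pos <;> linarith
    nlinarith
  have hEn : 0 < ((s : ℝ) - 2) * (d - 1) := by apply mul_pos <;> linarith
  have hRn : 0 < (d : ℝ) * (2 * s + d - 5) - 2 * (s - 2) := by nlinarith
  set E := (2 * (s : ℝ) - 3) * d * (s - 1) + s - d with hEdef
  set R := (2 * (s : ℝ) - 3) * d * (2 * s + d - 1) - 2 * (s - 2) with hRdef
  by_cases hreg : IsRegularPair s (s + d)
  · have hcmp : 0 ≤ ((s : ℝ) - 2) * (d - 1) * R - ((d : ℝ) * (2 * s + d - 5) - 2 * (s - 2)) * E := by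
      rw [hEdef, hRdef]
      unfold IsRegularPair at hreg
      rcases hreg with ⟨h1, h2, h3⟩ | ⟨rfl, h⟩ | ⟨rfl, h⟩
      · have h4 : d + 4 ≤ s := by omega
        have h5 : 3 ≤ d := by omega
        rcases Nat.lt_or_ge d 7 with h7 | h7
        · obtain ⟨x, rfl⟩ := Nat.exists_eq_add_of_le h1
          interval_cases d <;> push_cast <;> ring_nf <;> positivity
        · obtain ⟨D, rfl⟩ := Nat.exists_eq_add_of_le h7
          obtain ⟨x, rfl⟩ := Nat.exists_eq_add_of_le h4
          push_cast; ring_nf; positivity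
      · obtain rfl : d = 4 := by omega
        norm_num
      · obtain rfl : d = 5 := by omega
        norm_num
    refine ⟨((d : ℝ) * (2 * s + d - 5) - 2 * (s - 2)) / R, div_pos hRn hR, ?_, ?_, ?_⟩
    · have h0 : (2 * (s : ℝ) - 3) * ((s + d : ℕ) - (s : ℝ)) * ((s + d : ℕ) + (s : ℝ) - 1) - 2 * (s : ℝ) + 4 = R := by
        push_cast; rw [hRdef]; ring
      rw [ERalpha, if_pos hreg, h0, eq_div_iff (by norm_num), div_mul_eq_mul_div, eq_sub_iff_add_eq,
        ← add_div, div_eq_one_iff_eq hR.ne', hRdef]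
      push_cast; ring
    · rw [div_mul_eq_mul_div, div_le_iff₀ hR]; linarith
    · rw [div_mul_cancel₀ _ hR.ne']
  · have hcmp : 0 ≤ -(((s : ℝ) - 2) * (d - 1) * R - ((d : ℝ) * (2 * s + d - 5) - 2 * (s - 2)) * E) := by
      rw [hEdef, hRdef]
      unfold IsRegularPair at hreg
      push Not at hreg
      by_cases h1 : 11 ≤ s
      · have h2 : d = 2 ∨ s = d + 1 ∨ s = d + 2 ∨ s = d + 3 := by
          have := hreg.1 h1; omega
        rcases h2 with rfl | rfl | rfl | rfl
        · push_cast; ring_nf; linarith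
        all_goals
          obtain ⟨D, rfl⟩ := Nat.exists_eq_add_of_le hd
          push_cast; ring_nf; positivity
      · have h2 : s ≤ 10 := by omega
        have h3 : d ≤ 9 := by omega
        clear hE hR hEn hRn hEdef hRdef E R hs' hd' hds'
        interval_cases d <;> interval_cases s <;> first | (exfalso; omega) | norm_num
    refine ⟨(((s : ℝ) - 2) * (d - 1)) / E, div_pos hEn hE, ?_, ?_, ?_⟩
    · have h0 : (2 * (s : ℝ) - 3) * ((s + d : ℕ) - (s : ℝ)) * ((s : ℝ) - 1) + 2 * (s : ℝ) - (s + d : ℕ) = E := by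
        push_cast; rw [hEdef]; ring
      rw [ERalpha, if_neg hreg, h0, eq_div_iff (by norm_num), div_mul_eq_mul_div, eq_sub_iff_add_eq,
        ← add_div, div_eq_one_iff_eq hE.ne', hEdef]
      push_cast; ring
    · rw [div_mul_cancel₀ _ hE.ne']
    · rw [div_mul_eq_mul_div, div_le_iff₀ hE]; linarith

end

section
theorem ER_h_aux (s d u r ε : ℝ) (hd : 2 ≤ d) (hds : d + 1 ≤ s) (hu : u = 1 ∨ 2 ≤ u)
    (hr : u + r + 1 = s + d) (hur : u ≤ r) (hε : 0 < ε)
    (hE : ε * ((2 * s - 3) * d * (s - 1) + s - d) ≤ (s - 2) * (d - 1)) :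
    ε * ((2 * s - 3) * (u + 1) * r * u - 2 * (s - 1) * r * (r - 1) - (u - 1) * u) ≤
      (u - 1) * (r - 1) * u := by
  have hDEN : 0 < (2 * s - 3) * d * (s - 1) + s - d := by
    have : 0 < (2 * (s : ℝ) - 3) * d * (s - 1) := by
      apply mul_pos (mul_pos _ _) <;> linarith
    linarith
  have hN : (s - 2) * (d - 1) * ((2 * s - 3) * (u + 1) * r * u - 2 * (s - 1) * r * (r - 1) - (u - 1) * u)
      ≤ (u - 1) * (r - 1) * u * ((2 * s - 3) * d * (s - 1) + s - d) := by
    rw [← sub_nonneg]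
    clear hE hDEN
    obtain rfl : r = s + d - u - 1 := by linarith
    obtain ⟨e, he, rfl⟩ : ∃ e : ℝ, 0 ≤ e ∧ s = d + 1 + e := ⟨s - d - 1, by linarith, by ring⟩
    rcases le_total u d with h | h
    · rcases hu with rfl | hu
      · obtain ⟨x, hx, rfl⟩ : ∃ x : ℝ, 0 ≤ x ∧ d = 2 + x := ⟨d - 2, by linarith, by ring⟩
        ring_nf; positivity
      · obtain ⟨U, hU, rfl⟩ : ∃ x : ℝ, 0 ≤ x ∧ u = x + 2 := ⟨u - 2, by linarith, by ring⟩
        obtain ⟨x, hx, rfl⟩ : ∃ x : ℝ, 0 ≤ x ∧ d = U + 2 + x := ⟨d - (U + 2), by linarith, by ring⟩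
        ring_nf; positivity
    · obtain ⟨D, hD, rfl⟩ : ∃ x : ℝ, 0 ≤ x ∧ d = x + 1 := ⟨d - 1, by linarith, by ring⟩
      obtain ⟨y, hy, rfl⟩ : ∃ x : ℝ, 0 ≤ x ∧ u = D + 1 + x := ⟨u - (D + 1), by linarith, by ring⟩
      obtain ⟨z, hz, rfl⟩ : ∃ x : ℝ, 0 ≤ x ∧ e = 2 * y + x := ⟨e - 2 * y, by linarith, by ring⟩
      ring_nf; positivity
  have hu1 : 1 ≤ u := by rcases hu with h | h <;> linarith
  have hpos : 0 ≤ (u - 1) * (r - 1) * u := by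
    apply mul_nonneg (mul_nonneg _ _) <;> linarith
  set BR := (2 * s - 3) * (u + 1) * r * u - 2 * (s - 1) * r * (r - 1) - (u - 1) * u
  rcases le_total BR 0 with h | h
  · exact le_trans (mul_nonpos_of_nonneg_of_nonpos hε.le h) hpos
  · have := mul_le_mul_of_nonneg_right hE h
    by_contra hc
    push Not at hc
    nlinarith [mul_lt_mul_of_pos_right hc hDEN]

theorem ER_key_f (s d l r ε : ℝ) (hd : 2 ≤ d) (hds : d + 1 ≤ s) (hl : 2 ≤ l) (hls : l ≤ s)
    (hr : l + r = s + d) (hε : 0 < ε)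
    (hE : ε * ((2 * s - 3) * d * (s - 1) + s - d) ≤ (s - 2) * (d - 1))
    (hR : ε * ((2 * s - 3) * d * (2 * s + d - 1) - 2 * (s - 2)) ≤ d * (2 * s + d - 5) - 2 * (s - 2)) :
    r + (1 - ε) / 2 * (l - 2) ≤
      l * r * ((1 - (2 * s - 3) * ε) / 2) + r * (r - 1) / 2 * ((1 - (2 * s - 3) * ε) / 2) := by
  -- η (t+1) ≥ 2
  have hη : (2 * s - 3) * ε * (s + d + 1) ≤ s + d - 3 := by
    have h1 : ε * (2 * s - 3) * (d * (s - 1)) ≤ (s - 2) * (d - 1) := by nlinarith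
    have h2 : (s - 2) * (d - 1) * (s + d + 1) ≤ d * (s - 1) * (s + d - 3) := by
      obtain ⟨e, he, rfl⟩ : ∃ e : ℝ, 0 ≤ e ∧ s = d + 1 + e := ⟨s - d - 1, by linarith, by ring⟩
      nlinarith
    have h3 : 0 < d * (s - 1) := by apply mul_pos <;> linarith
    by_contra hc
    push Not at hc
    have h4 := mul_lt_mul_of_pos_right hc h3
    have h5 := mul_le_mul_of_nonneg_right h1 (by linarith : 0 ≤ s + d + 1)
    nlinarith
  have hηp : 0 ≤ 1 - (2 * s - 3) * ε := by
    have h1 : (2 * s - 3) * ε * (s + d + 1) ≤ 1 * (s + d + 1) := by linarith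
    have := le_of_mul_le_mul_right h1 (by linarith)
    linarith
  obtain rfl : r = s + d - l := by linarith
  have hs2 : 0 < s - 2 := by linarith
  rw [← sub_nonneg]
  refine nonneg_of_mul_nonneg_right (a := s - 2) ?_ hs2
  have hf2 : 0 ≤ (s + d - 2) * (s + d - 3 - (2 * s - 3) * ε * (s + d + 1)) / 4 := by
    have : 0 ≤ (s + d - 2) * (s + d - 3 - (2 * s - 3) * ε * (s + d + 1)) :=
      mul_nonneg (by linarith) (by linarith)
    linarith
  have hfs : 0 ≤ (d * (2 * s + d - 5) - 2 * (s - 2) -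
      ε * ((2 * s - 3) * d * (2 * s + d - 1) - 2 * (s - 2))) / 4 := by linarith
  have a1 := mul_nonneg (by linarith : 0 ≤ s - l) hf2
  have a2 := mul_nonneg (by linarith : 0 ≤ l - 2) hfs
  have a3 : 0 ≤ (1 - (2 * s - 3) * ε) * ((l - 2) * (s - l) * (s - 2)) :=
    mul_nonneg hηp (mul_nonneg (mul_nonneg (by linarith) (by linarith)) hs2.le)
  linarith

theorem ER_key_g (s d l r ε : ℝ) (hd : 2 ≤ d) (hds : d + 1 ≤ s) (hls : l ≤ s)
    (hr : l + r = s + d) (hrl : r ≤ l - 1) (hε : 0 < ε)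
    (hE : ε * ((2 * s - 3) * d * (s - 1) + s - d) ≤ (s - 2) * (d - 1)) :
    r + (1 - ε) / 2 * (l - 2) ≤
      l * r * ((1 - (2 * s - 3) * ε) / 2) + (r - 1) * ((s - 1) * ε) := by
  have hηp : 0 ≤ 1 - (2 * s - 3) * ε := by
    have h1 : ε * (2 * s - 3) * (d * (s - 1)) ≤ (s - 2) * (d - 1) := by nlinarith
    have h3 : 0 < d * (s - 1) := by apply mul_pos <;> linarith
    have h2 : ε * (2 * s - 3) * (d * (s - 1)) ≤ 1 * (d * (s - 1)) := by nlinarith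
    have := le_of_mul_le_mul_right h2 h3
    linarith
  have hgs : 0 ≤ ((s - 2) * (d - 1) - ε * ((2 * s - 3) * d * (s - 1) + s - d)) / 2 := by linarith
  obtain rfl : r = s + d - l := by linarith
  have h0 := ER_h_aux s d ((s + d - 1) / 2) ((s + d - 1) / 2) ε hd hds (Or.inr (by linarith))
    (by ring) le_rfl hε hE
  have hu : 0 < (s + d - 1) / 2 := by linarith
  have hg0 : 0 ≤ ((s + d - 1) / 2 - 1) * ((s + d - 1) / 2 - 1) - ε * ((2 * s - 3) * ((s + d - 1) / 2 + 1) *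
     ((s + d - 1) / 2) - 2 * (s - 1) * ((s + d - 1) / 2 - 1) - ((s + d - 1) / 2 - 1)) := by
    refine nonneg_of_mul_nonneg_right (a := (s + d - 1) / 2) ?_ hu
    linarith
  rcases eq_or_lt_of_le hds with h | h
  · obtain rfl : l = s := by linarith
    linarith
  · have hs2 : 0 < s - (s + d + 1) / 2 := by linarith
    rw [← sub_nonneg]
    refine nonneg_of_mul_nonneg_right (a := s - (s + d + 1) / 2) ?_ hs2
    have a1 := mul_nonneg (by linarith : 0 ≤ s - l) hg0
    have a2 := mul_nonneg (by linarith : 0 ≤ l - (s + d + 1) / 2) hgs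
    have a3 : 0 ≤ (1 - (2 * s - 3) * ε) * ((l - (s + d + 1) / 2) * (s - l) * (s - (s + d + 1) / 2)) :=
      mul_nonneg hηp (mul_nonneg (mul_nonneg (by linarith) (by linarith)) hs2.le)
    linarith

theorem ER_key_h (s d l r ε : ℝ) (hd : 2 ≤ d) (hds : d + 1 ≤ s) (hl : l = 2 ∨ 3 ≤ l)
    (hr : l + r = s + d) (hrl : l - 1 ≤ r) (hε : 0 < ε)
    (hE : ε * ((2 * s - 3) * d * (s - 1) + s - d) ≤ (s - 2) * (d - 1)) :
    r + (1 - ε) / 2 * (l - 2) ≤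
      l * r * ((1 - (2 * s - 3) * ε) / 2) + r * (r - 1) / 2 * (2 * ((s - 1) * ε) / (l - 1)) := by
  have hl1 : 0 < l - 1 := by rcases hl with h | h <;> linarith
  have h0 := ER_h_aux s d (l - 1) r ε hd hds
    (by rcases hl with h | h; left; linarith; right; linarith)
    (by linarith) hrl hε hE
  have : r * (r - 1) / 2 * (2 * ((s - 1) * ε) / (l - 1)) = r * (r - 1) * ((s - 1) * ε) / (l - 1) := by
    field_simp
  rw [this, ← sub_nonneg]
  refine nonneg_of_mul_nonneg_right (a := l - 1) ?_ hl1
  have e : (l - 1) * (r * (r - 1) * ((s - 1) * ε) / (l - 1)) = r * (r - 1) * ((s - 1) * ε) :=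
    mul_div_cancel₀ _ hl1.ne'
  rw [mul_sub, mul_add, e]
  linarith

end

section
theorem ER_key (s d l r : ℕ) (ε : ℝ) (hd : 2 ≤ d) (hds : d + 1 ≤ s) (hl : 2 ≤ l) (hls : l ≤ s)
    (hr : l + r = s + d) (hε : 0 < ε)
    (hE : ε * ((2 * s - 3) * d * (s - 1) + s - d) ≤ ((s : ℝ) - 2) * (d - 1))
    (hR : ε * ((2 * s - 3) * d * (2 * s + d - 1) - 2 * (s - 2)) ≤
      (d : ℝ) * (2 * s + d - 5) - 2 * (s - 2)) :
    (r : ℝ) + (1 - ε) / 2 * (l - 2) ≤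
      l * r * ((1 - (2 * s - 3) * ε) / 2) + r * (r - 1) / 2 *
        min ((1 - (2 * s - 3) * ε) / 2) (2 * ((s - 1) * ε) / min (r : ℝ) (l - 1)) := by
  have hd' : (2 : ℝ) ≤ d := by exact_mod_cast hd
  have hds' : (d : ℝ) + 1 ≤ s := by exact_mod_cast hds
  have hl' : (2 : ℝ) ≤ l := by exact_mod_cast hl
  have hls' : (l : ℝ) ≤ s := by exact_mod_cast hls
  have hr' : (l : ℝ) + r = s + d := by exact_mod_cast hr
  rcases min_cases ((1 - (2 * s - 3) * ε) / 2) (2 * ((s - 1) * ε) / min (r : ℝ) (l - 1)) with h | h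
  · rw [h.1]
    exact ER_key_f s d l r ε hd' hds' hl' hls' hr' hε hE hR
  · rw [h.1]
    rcases le_total (r : ℝ) (l - 1) with h1 | h1
    · rw [min_eq_left h1]
      have := ER_key_g s d l r ε hd' hds' hls' hr' h1 hε hE
      have hr0 : (0 : ℝ) < r := by linarith
      convert this using 2
      field_simp
    · rw [min_eq_right h1]
      refine ER_key_h s d l r ε hd' hds' ?_ hr' h1 hε hE
      rcases eq_or_lt_of_le hl with h2 | h2
      · left; rw [← h2]; norm_num
      · right; exact_mod_cast h2

theorem line_cost (x m l r : ℕ) (al η κ : ℝ) (hx : x ≤ 1) (hxm : 2 ≤ x + m) (hml : x + m ≤ l)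
    (hmr : m ≤ r) (hal : al < 1) (hη : 0 < η) (hγ : 0 < 1 - al - η) (hr1 : 1 ≤ r)
    (hκ : κ = min η (2 * (1 - al - η) / min (r : ℝ) (l - 1))) :
    (x : ℝ) * m * η + m * (m - 1) / 2 * κ ≤ (1 - al) * (x + m) - (2 * (1 - al) - η) := by
  have hl2 : (2 : ℝ) ≤ l := by exact_mod_cast hxm.trans hml
  have hr1' : (1 : ℝ) ≤ r := by exact_mod_cast hr1
  have hmm : 0 < min (r : ℝ) (l - 1) := lt_min (by linarith) (by linarith)
  have hκη : κ ≤ η := hκ ▸ min_le_left _ _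
  have hκγ : κ * min (r : ℝ) (l - 1) ≤ 2 * (1 - al - η) := by
    rw [← le_div_iff₀ hmm]; exact hκ ▸ min_le_right _ _
  have hκ0 : 0 ≤ κ := by rw [hκ]; apply le_min hη.le; positivity
  have hmr' : (m : ℝ) ≤ r := by exact_mod_cast hmr
  interval_cases x
  · -- line not meeting
    have hm2 : (2 : ℝ) ≤ m := by exact_mod_cast (by omega : 2 ≤ m)
    have hml' : (m : ℝ) ≤ l := by exact_mod_cast (by omega : m ≤ l)
    rcases le_total ((m + 1) * η) (2 * (1 - al)) with h | h
    · have h1 : (m : ℝ) * (m - 1) / 2 * κ ≤ m * (m - 1) / 2 * η := by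
        apply mul_le_mul_of_nonneg_left hκη; nlinarith
      push_cast
      nlinarith
    · have h2 : (m - 1 : ℝ) * κ ≤ 2 * (1 - al - η) := by
        refine le_trans ?_ hκγ
        rw [mul_comm]
        apply mul_le_mul_of_nonneg_left _ hκ0
        apply le_min <;> linarith
      by_cases hml2 : m + 1 ≤ l
      · have hml3 : (m : ℝ) + 1 ≤ l := by exact_mod_cast hml2
        have h3 : (m : ℝ) * κ ≤ 2 * (1 - al - η) := by
          refine le_trans ?_ hκγ
          rw [mul_comm]
          apply mul_le_mul_of_nonneg_left _ hκ0
          apply le_min <;> linarith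
        have h4 : (m : ℝ) * (m - 1) / 2 * κ ≤ (m - 1) * (1 - al - η) := by nlinarith
        push_cast
        nlinarith
      · have h4 : (m : ℝ) * (m - 1) / 2 * κ ≤ m * (1 - al - η) := by nlinarith
        push_cast
        nlinarith
  · have hm1 : (1 : ℝ) ≤ m := by exact_mod_cast (by omega : 1 ≤ m)
    have hml' : (m : ℝ) + 1 ≤ l := by exact_mod_cast (by omega : m + 1 ≤ l)
    have h3 : (m : ℝ) * κ ≤ 2 * (1 - al - η) := by
      refine le_trans ?_ hκγ
      rw [mul_comm]
      apply mul_le_mul_of_nonneg_left _ hκ0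
      apply le_min <;> linarith
    push_cast
    nlinarith

open Finset in
theorem linear_space {V I : Type*} [DecidableEq V] [DecidableEq I] (s d : ℕ) (ε : ℝ) (hd : 2 ≤ d)
    (hds : d + 1 ≤ s) (hε : 0 < ε)
    (hE : ε * ((2 * s - 3) * d * (s - 1) + s - d) ≤ ((s : ℝ) - 2) * (d - 1))
    (hR : ε * ((2 * s - 3) * d * (2 * s + d - 1) - 2 * (s - 2)) ≤
      (d : ℝ) * (2 * s + d - 5) - 2 * (s - 2))
    (T : Finset V) (L : Finset I) (b : I → Finset V) (hT : T.card = s + d)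
    (hbT : ∀ i ∈ L, b i ⊆ T)
    (hex : ∀ u ∈ T, ∀ v ∈ T, u ≠ v → ∃ i ∈ L, u ∈ b i ∧ v ∈ b i)
    (huniq : ∀ u ∈ T, ∀ v ∈ T, u ≠ v → ∀ i ∈ L, ∀ j ∈ L, u ∈ b i → v ∈ b i → u ∈ b j →
      v ∈ b j → i = j)
    (h2 : ∀ i ∈ L, 2 ≤ (b i).card) (hle : ∀ i ∈ L, (b i).card ≤ s) :
    ((s + d : ℕ) : ℝ) - 2 * ((1 - ε) / 2) - (1 / 2 + (2 * s - 1) * ε / 2) ≤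
      ∑ i ∈ L, ((1 - (1 - ε) / 2) * ((b i).card : ℝ) - (1 / 2 + (2 * s - 1) * ε / 2)) := by
  have hd' : (2 : ℝ) ≤ d := by exact_mod_cast hd
  have hds' : (d : ℝ) + 1 ≤ s := by exact_mod_cast hds
  have hηp : 0 < 1 - (2 * s - 3) * ε := by
    have h1 : ε * (2 * s - 3) * (d * (s - 1)) ≤ ((s : ℝ) - 2) * (d - 1) := by nlinarith
    have h3 : 0 < (d : ℝ) * (s - 1) := by apply mul_pos <;> linarith
    have h2 : ε * (2 * s - 3) * (d * (s - 1)) < 1 * (d * ((s : ℝ) - 1)) := by nlinarith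
    have := lt_of_mul_lt_mul_right h2 h3.le
    linarith
  -- a maximal line
  have hLne : L.Nonempty := by
    obtain ⟨u, hu, v, hv, huv⟩ := one_lt_card.1 (by omega : 1 < T.card)
    obtain ⟨i, hi, -⟩ := hex u hu v hv huv
    exact ⟨i, hi⟩
  obtain ⟨i0, hi0, hmax⟩ := exists_max_image L (fun i => (b i).card) hLne
  set A := b i0 with hA
  set l := A.card with hl
  have hAT : A ⊆ T := hbT i0 hi0
  set O := T \ A with hO
  set r := O.card with hr
  have hlr : l + r = s + d := by
    rw [hr, hO, card_sdiff_of_subset hAT, hT]; have := card_le_card hAT; omega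
  have hl2 : 2 ≤ l := h2 i0 hi0
  have hls : l ≤ s := hle i0 hi0
  set κ := min ((1 - (2 * s - 3) * ε) / 2) (2 * ((s - 1) * ε) / min (r : ℝ) (l - 1)) with hκ
  have key := ER_key s d l r ε hd hds hl2 hls hlr hε hE hR
  rw [← hκ] at key
  set L' := L.erase i0 with hL'
  have hcost : ∀ i ∈ L', ((b i ∩ A).card : ℝ) * (b i \ A).card * ((1 - (2 * s - 3) * ε) / 2) +
      (b i \ A).card * ((b i \ A).card - 1) / 2 * κ ≤
      (1 - (1 - ε) / 2) * ((b i).card : ℝ) - (1 / 2 + (2 * s - 1) * ε / 2) := by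
    intro i hi
    have hiL := mem_of_mem_erase hi
    have hne := ne_of_mem_erase hi
    have hc : (b i ∩ A).card + (b i \ A).card = (b i).card := card_inter_add_card_sdiff _ _
    have hx1 : (b i ∩ A).card ≤ 1 := by
      rw [card_le_one]
      intro u hu v hv
      by_contra huv
      rw [mem_inter] at hu hv
      exact hne (huniq u (hAT hu.2) v (hAT hv.2) huv i hiL i0 hi0 hu.1 hv.1 hu.2 hv.2)
    have := line_cost (b i ∩ A).card (b i \ A).card l r ((1 - ε) / 2) ((1 - (2 * s - 3) * ε) / 2) κ
      hx1 (hc ▸ h2 i hiL) (hc ▸ hmax i hiL)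
      (card_le_card (sdiff_subset_sdiff (hbT i hiL) le_rfl)) (by linarith) (by linarith)
      (by nlinarith) (by omega) (by rw [hκ]; congr 2; ring)
    rw [← hc]
    push_cast
    linarith
  have hsum1 : ∑ i ∈ L', ((b i ∩ A).card * (b i \ A).card) = l * r := by
    have h1 : ∀ i ∈ L', (b i ∩ A).card * (b i \ A).card =
        ∑ p ∈ A ×ˢ O, if p.1 ∈ b i ∧ p.2 ∈ b i then 1 else 0 := by
      intro i hi
      rw [← card_product, ← card_filter]
      congr 1
      ext ⟨x, y⟩
      simp only [mem_product, mem_inter, mem_sdiff, mem_filter, hO]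
      have := hbT i (mem_of_mem_erase hi)
      constructor
      · rintro ⟨⟨h1, h2⟩, h3, h4⟩; exact ⟨⟨h2, this h3, h4⟩, h1, h3⟩
      · rintro ⟨⟨h1, h2, h3⟩, h4, h5⟩; exact ⟨⟨h4, h1⟩, h5, h3⟩
    rw [sum_congr rfl h1, sum_comm]
    have h3 : ∀ p ∈ A ×ˢ O, (∑ i ∈ L', if p.1 ∈ b i ∧ p.2 ∈ b i then 1 else 0) = 1 := by
      rintro ⟨x, y⟩ hp
      simp only [mem_product, mem_sdiff, hO] at hp
      have hxT := hAT hp.1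
      have hxy : x ≠ y := fun h => hp.2.2 (h ▸ hp.1)
      obtain ⟨i, hi, hix, hiy⟩ := hex x hxT y hp.2.1 hxy
      rw [← card_filter, card_eq_one]
      refine ⟨i, ?_⟩
      ext j
      simp only [mem_filter, mem_singleton, hL', mem_erase]
      constructor
      · rintro ⟨⟨-, hj⟩, hjx, hjy⟩
        exact huniq x hxT y hp.2.1 hxy j hj i hi hjx hjy hix hiy
      · rintro rfl
        refine ⟨⟨?_, hi⟩, hix, hiy⟩
        rintro rfl
        exact hp.2.2 hiy
    rw [sum_congr rfl h3, sum_const, card_product, smul_eq_mul, mul_one]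
  have hsum2 : ∑ i ∈ L', ((b i \ A).card * (b i \ A).card - (b i \ A).card) = r * r - r := by
    have h1 : ∀ i ∈ L', (b i \ A).card * (b i \ A).card - (b i \ A).card =
        ∑ p ∈ O.offDiag, if p.1 ∈ b i ∧ p.2 ∈ b i then 1 else 0 := by
      intro i hi
      rw [← offDiag_card, ← card_filter]
      congr 1
      ext ⟨x, y⟩
      simp only [mem_offDiag, mem_sdiff, mem_filter, hO]
      have := hbT i (mem_of_mem_erase hi)
      constructor
      · rintro ⟨⟨h1, h2⟩, ⟨h3, h4⟩, h5⟩; exact ⟨⟨⟨this h1, h2⟩, ⟨this h3, h4⟩, h5⟩, h1, h3⟩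
      · rintro ⟨⟨⟨h1, h2⟩, ⟨h3, h4⟩, h5⟩, h6, h7⟩; exact ⟨⟨h6, h2⟩, ⟨h7, h4⟩, h5⟩
    rw [sum_congr rfl h1, sum_comm]
    have h3 : ∀ p ∈ O.offDiag, (∑ i ∈ L', if p.1 ∈ b i ∧ p.2 ∈ b i then 1 else 0) = 1 := by
      rintro ⟨x, y⟩ hp
      simp only [mem_offDiag, mem_sdiff, hO] at hp
      obtain ⟨⟨hxT, hxA⟩, ⟨hyT, hyA⟩, hxy⟩ := hp
      obtain ⟨i, hi, hix, hiy⟩ := hex x hxT y hyT hxy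
      rw [← card_filter, card_eq_one]
      refine ⟨i, ?_⟩
      ext j
      simp only [mem_filter, mem_singleton, hL', mem_erase]
      constructor
      · rintro ⟨⟨-, hj⟩, hjx, hjy⟩
        exact huniq x hxT y hyT hxy j hj i hi hjx hjy hix hiy
      · rintro rfl
        refine ⟨⟨?_, hi⟩, hix, hiy⟩
        rintro rfl
        exact hxA hix
    rw [sum_congr rfl h3, sum_const, offDiag_card, smul_eq_mul, mul_one]
  have hsum1' : ∑ i ∈ L', (((b i ∩ A).card : ℝ) * (b i \ A).card) = l * r := by
    exact_mod_cast hsum1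
  have hcast : ∀ n : ℕ, ((n * n - n : ℕ) : ℝ) = n * (n - 1) := by
    intro n
    rw [Nat.cast_sub (Nat.le_mul_self n)]; push_cast; ring
  have hsum2' : ∑ i ∈ L', (((b i \ A).card : ℝ) * ((b i \ A).card - 1)) = r * (r - 1) := by
    rw [← hcast, ← hsum2]
    push_cast [hcast]
    rfl
  have hfin := sum_le_sum hcost
  rw [sum_add_distrib, ← sum_mul, ← sum_mul, ← sum_div, hsum1', hsum2'] at hfin
  rw [← add_sum_erase L _ hi0]
  have hlr' : (l : ℝ) + r = s + d := by exact_mod_cast hlr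
  push_cast
  have : ((b i0).card : ℝ) = l := rfl
  rw [this]
  linarith

end

section
open Finset

theorem resample {X Y : Type*} [Fintype X] [DecidableEq X] [Fintype Y] (D : Finset X)
    (h : (X → Y) → ℝ) :
    ∑ ω : X → Y, ∑ ω' : X → Y, h (D.piecewise ω' ω) =
      (Fintype.card (X → Y) : ℝ) * ∑ ω : X → Y, h ω := by
  rw [← Fintype.sum_prod_type' (f := fun ω ω' : X → Y => h (D.piecewise ω' ω))]
  let e : (X → Y) × (X → Y) ≃ (X → Y) × (X → Y) :=
    { toFun := fun p => (D.piecewise p.2 p.1, D.piecewise p.1 p.2)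
      invFun := fun p => (D.piecewise p.2 p.1, D.piecewise p.1 p.2)
      left_inv := by
        rintro ⟨a, b⟩
        ext x <;> by_cases hx : x ∈ D <;> simp [hx]
      right_inv := by
        rintro ⟨a, b⟩
        ext x <;> by_cases hx : x ∈ D <;> simp [hx] }
  have : ∑ p : (X → Y) × (X → Y), h (D.piecewise p.2 p.1) = ∑ p : (X → Y) × (X → Y), h p.1 :=
    Fintype.sum_equiv e _ _ (fun p => rfl)
  rw [this, Fintype.sum_prod_type]
  simp [mul_sum]

theorem indep_sum {X Y : Type*} [Fintype X] [DecidableEq X] [Fintype Y] (D : Finset X)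
    (f g : (X → Y) → ℝ) (hf : ∀ ω ω', (∀ x, x ∉ D → ω x = ω' x) → f ω = f ω')
    (hg : ∀ ω ω', (∀ x ∈ D, ω x = ω' x) → g ω = g ω') :
    (Fintype.card (X → Y) : ℝ) * ∑ ω : X → Y, f ω * g ω = (∑ ω, f ω) * ∑ ω, g ω := by
  rw [← resample D, sum_mul_sum]
  refine sum_congr rfl fun ω _ => sum_congr rfl fun ω' _ => ?_
  rw [hf (D.piecewise ω' ω) ω (fun x hx => by simp [hx]),
    hg (D.piecewise ω' ω) ω' (fun x hx => by simp [hx])]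

theorem resample_one {X Y : Type*} [Fintype X] [DecidableEq X] [Fintype Y] (a : X)
    (h : (X → Y) → ℝ) :
    ∑ ω : X → Y, ∑ y : Y, h (Function.update ω a y) =
      (Fintype.card Y : ℝ) * ∑ ω : X → Y, h ω := by
  rw [← Fintype.sum_prod_type' (f := fun (ω : X → Y) (y : Y) => h (Function.update ω a y))]
  let e : (X → Y) × Y ≃ (X → Y) × Y :=
    { toFun := fun p => (Function.update p.1 a p.2, p.1 a)
      invFun := fun p => (Function.update p.1 a p.2, p.1 a)
      left_inv := by rintro ⟨a, b⟩; simp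
      right_inv := by rintro ⟨a, b⟩; simp }
  have : ∑ p : (X → Y) × Y, h (Function.update p.1 a p.2) = ∑ p : (X → Y) × Y, h p.1 :=
    Fintype.sum_equiv e _ _ (fun p => rfl)
  rw [this, Fintype.sum_prod_type]
  simp [mul_sum]

theorem adaptive {X Y : Type*} [Fintype X] [LinearOrder X] [Fintype Y] [Nonempty Y]
    (w : X → (X → Y) → ℝ) (K : X → ℝ) (hw : ∀ i ω, 0 ≤ w i ω)
    (hdep : ∀ i ω ω', (∀ j ≤ i, ω j = ω' j) → w i ω = w i ω')
    (hK : ∀ i ω, ∑ y, w i (Function.update ω i y) ≤ K i * Fintype.card Y) (J : Finset X) :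
    ∑ ω : X → Y, ∏ i ∈ J, w i ω ≤ (∏ i ∈ J, K i) * Fintype.card (X → Y) := by
  induction J using Finset.induction_on_max with
  | empty => simp
  | insert a J ha ih =>
    have haJ : a ∉ J := fun h => lt_irrefl _ (ha a h)
    have hY : (0 : ℝ) < Fintype.card Y := by exact_mod_cast Fintype.card_pos
    have hKa : 0 ≤ K a := by
      obtain ⟨y0⟩ := ‹Nonempty Y›
      have h0 : 0 ≤ ∑ y, w a (Function.update (fun _ => y0) a y) := sum_nonneg fun y _ => hw a _
      have := h0.trans (hK a (fun _ => y0))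
      exact nonneg_of_mul_nonneg_left this hY
    refine le_of_mul_le_mul_left ?_ hY
    rw [← resample_one a]
    have h1 : ∀ ω : X → Y, ∑ y, ∏ i ∈ insert a J, w i (Function.update ω a y) ≤
        (∏ i ∈ J, w i ω) * (K a * Fintype.card Y) := by
      intro ω
      have : ∀ y, ∏ i ∈ insert a J, w i (Function.update ω a y) =
          (∏ i ∈ J, w i ω) * w a (Function.update ω a y) := by
        intro y
        rw [prod_insert haJ, mul_comm]
        congr 1
        refine prod_congr rfl fun i hi => hdep i _ _ fun j hj => ?_
        rw [Function.update_of_ne]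
        exact (lt_of_le_of_lt hj (ha i hi)).ne
      simp_rw [this]
      rw [← mul_sum]
      exact mul_le_mul_of_nonneg_left (hK a ω) (prod_nonneg fun i _ => hw i ω)
    calc _ ≤ ∑ ω : X → Y, (∏ i ∈ J, w i ω) * (K a * Fintype.card Y) := sum_le_sum fun ω _ => h1 ω
      _ = (∑ ω : X → Y, (∏ i ∈ J, w i ω)) * (K a * Fintype.card Y) := by rw [sum_mul]
      _ ≤ ((∏ i ∈ J, K i) * Fintype.card (X → Y)) * (K a * Fintype.card Y) :=
        mul_le_mul_of_nonneg_right ih (by positivity)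
      _ = _ := by rw [prod_insert haJ]; ring

theorem sum_prod_pi {X Y : Type*} [Fintype X] [DecidableEq X] [Fintype Y] (g : X → Y → ℝ) :
    ∑ ω : X → Y, ∏ i, g i (ω i) = ∏ i, ∑ y, g i y := by
  rw [Finset.prod_univ_sum, Fintype.piFinset_univ]

/-- number of functions whose image contains a given set -/
theorem card_image_superset {X Y : Type*} [Fintype X] [DecidableEq X] [Fintype Y] [DecidableEq Y]
    [Nonempty Y]
    (P : Finset Y) :
    ((univ.filter fun φ : X → Y => P ⊆ univ.image φ).card : ℝ) ≤
      ((Fintype.card X : ℝ) / Fintype.card Y) ^ P.card * Fintype.card (X → Y) := by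
  classical
  have hY : (0 : ℝ) < Fintype.card Y := by exact_mod_cast Fintype.card_pos
  have hsub : (univ.filter fun φ : X → Y => P ⊆ univ.image φ) ⊆
      (univ : Finset (P → X)).biUnion fun g => univ.filter fun φ : X → Y => ∀ p : P, φ (g p) = p := by
    intro φ hφ
    have hφ' : P ⊆ univ.image φ := by simpa using hφ
    have : ∀ p : P, ∃ x, φ x = p := fun p => by
      have := hφ' p.2
      simpa using this
    choose g hg using this
    simp only [mem_biUnion, mem_univ, true_and, mem_filter]
    exact ⟨g, hg⟩
  have hone : ∀ g : P → X, (((univ.filter fun φ : X → Y => ∀ p : P, φ (g p) = p).card : ℕ) : ℝ) ≤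
      (1 / Fintype.card Y : ℝ) ^ P.card * Fintype.card (X → Y) := by
    intro g
    by_cases hinj : Function.Injective g
    · have h1 : (univ.filter fun φ : X → Y => ∀ p : P, φ (g p) = p) ⊆
          Fintype.piFinset fun x => univ.filter fun y : Y => ∀ p : P, g p = x → y = p := by
        intro φ hφ
        simp only [mem_filter, mem_univ, true_and, Fintype.mem_piFinset] at hφ ⊢
        rintro x p rfl
        exact hφ p
      have h2 : ((Fintype.piFinset fun x => univ.filter fun y : Y => ∀ p : P, g p = x → y = p).card : ℝ)
          ≤ ∏ x : X, ((if x ∈ univ.image g then (1 / Fintype.card Y : ℝ) else 1) * Fintype.card Y) := by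
        rw [Fintype.card_piFinset]
        push_cast
        refine prod_le_prod (fun _ _ => by positivity) fun x _ => ?_
        split_ifs with hx
        · rw [one_div, inv_mul_cancel₀ hY.ne']
          norm_cast
          obtain ⟨p, -, rfl⟩ := mem_image.1 hx
          refine (card_le_card (t := {(p : Y)}) ?_).trans (by simp)
          intro y hy
          simp only [mem_filter, mem_univ, true_and] at hy
          simpa using hy p rfl
        · rw [one_mul]
          norm_cast
          exact (card_filter_le _ _).trans (by simp)
      refine (Nat.cast_le.2 (card_le_card h1)).trans (h2.trans ?_)
      rw [prod_mul_distrib, prod_ite]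
      simp only [prod_const, one_pow, mul_one]
      rw [filter_mem_eq_inter, univ_inter, card_image_of_injective _ hinj, card_univ,
        Fintype.card_coe, card_univ, Fintype.card_fun]
      push_cast
      rfl
    · have : (univ.filter fun φ : X → Y => ∀ p : P, φ (g p) = p) = ∅ := by
        rw [filter_eq_empty_iff]
        intro φ _ h
        apply hinj
        intro p q hpq
        have := h p
        rw [hpq, h q] at this
        exact Subtype.ext this.symm
      rw [this]
      simp only [card_empty, Nat.cast_zero]
      positivity
  calc _ ≤ (((univ : Finset (P → X)).biUnion fun g =>
        univ.filter fun φ : X → Y => ∀ p : P, φ (g p) = p).card : ℝ) :=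
        Nat.cast_le.2 (card_le_card hsub)
    _ ≤ ∑ g : P → X, (((univ.filter fun φ : X → Y => ∀ p : P, φ (g p) = p).card : ℕ) : ℝ) := by
        exact_mod_cast card_biUnion_le
    _ ≤ ∑ g : P → X, (1 / Fintype.card Y : ℝ) ^ P.card * Fintype.card (X → Y) :=
        sum_le_sum fun g _ => hone g
    _ = _ := by
        rw [sum_const, card_univ, Fintype.card_fun, Fintype.card_coe, nsmul_eq_mul]
        push_cast
        rw [div_pow, div_pow, one_pow]
        ring

end

section
open Finset

section defsER
variable {V I : Type*} [DecidableEq V] [DecidableEq I]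

/-- incidences of a configuration -/
def ERincs (B : I → Finset V) (S : Finset (V ⊕ I)) : Finset (V × I) :=
  (S.toLeft ×ˢ S.toRight).filter fun p => p.1 ∈ B p.2

/-- the weight of a configuration -/
noncomputable def ERF (δ β : ℝ) (B : I → Finset V) (S : Finset (V ⊕ I)) : ℝ :=
  (S.toLeft.card : ℝ) + δ * S.toRight.card - β * (ERincs B S).card

/-- block edges of a configuration -/
def ERedges (B : I → Finset V) (S : Finset (V ⊕ I)) : Finset (I × Finset V) :=
  (S.toRight ×ˢ S.toLeft.powersetCard 2).filter fun e => e.2 ⊆ B e.1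

/-- bad configurations -/
def ERBad (r : ℕ) (δ β : ℝ) (B : I → Finset V) (S : Finset (V ⊕ I)) : Prop :=
  S.card ≤ r ∧ (∃ e ∈ ERedges B S, ∃ e' ∈ ERedges B S, e.1 ≠ e'.1) ∧
    ∀ S' ⊆ S, (ERedges B S').Nonempty → ERF δ β B S ≤ ERF δ β B S'

/-- adjacency in the random graph -/
def ERadj (s r Q : ℕ) (δ β : ℝ) (B : I → Finset V) (ω : (I × V) ⊕ (I × Finset V) → Fin Q)
    (u v : V) : Prop :=
  u ≠ v ∧ ∃ i, u ∈ B i ∧ v ∈ B i ∧ (∀ j, u ∈ B j → v ∈ B j → j = i) ∧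
    (ω (Sum.inl (i, u))).val % s ≠ (ω (Sum.inl (i, v))).val % s ∧
    (ω (Sum.inr (i, {u, v}))).val = 0 ∧
    ∀ S, ERBad r δ β B S → (i, ({u, v} : Finset V)) ∈ ERedges B S →
      ∃ e ∈ ERedges B S, (ω (Sum.inr e)).val ≠ 0

/-- the random graph -/
def ERgraph (s r Q : ℕ) (δ β : ℝ) (B : I → Finset V) (ω : (I × V) ⊕ (I × Finset V) → Fin Q) :
    SimpleGraph V where
  Adj u v := ERadj s r Q δ β B ω u v
  symm := ⟨by
    rintro u v ⟨h1, i, h2, h3, h4, h5, h6, h7⟩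
    refine ⟨h1.symm, i, h3, h2, fun j a b => h4 j b a, h5.symm, ?_, ?_⟩
    · rw [pair_comm]; exact h6
    · rw [pair_comm]; exact h7⟩
  loopless := ⟨fun u h => h.1 rfl⟩

theorem mem_ERedges (B : I → Finset V) (S : Finset (V ⊕ I)) (i : I) (e : Finset V) :
    (i, e) ∈ ERedges B S ↔ Sum.inr i ∈ S ∧ (∀ v ∈ e, Sum.inl v ∈ S) ∧ e.card = 2 ∧ e ⊆ B i := by
  simp only [ERedges, mem_filter, mem_product, mem_toRight, mem_powersetCard, subset_iff, mem_toLeft]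
  tauto

theorem ERedges_mono (B : I → Finset V) {S S' : Finset (V ⊕ I)} (h : S ⊆ S') :
    ERedges B S ⊆ ERedges B S' := by
  rintro ⟨i, e⟩ he
  rw [mem_ERedges] at he ⊢
  exact ⟨h he.1, fun v hv => h (he.2.1 v hv), he.2.2⟩

theorem card_ERincs (B : I → Finset V) (S : Finset (V ⊕ I)) :
    (ERincs B S).card = ∑ i ∈ S.toRight, (S.toLeft ∩ B i).card := by
  rw [ERincs, card_filter, sum_product_right]
  refine sum_congr rfl fun i _ => ?_
  rw [← card_filter]
  congr 1

theorem ERgraph_cliqueFree (s d Q r : ℕ) (ε : ℝ) (hd : 2 ≤ d)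
    (hds : d + 1 ≤ s) (hε : 0 < ε)
    (hE : ε * ((2 * s - 3) * d * (s - 1) + s - d) ≤ ((s : ℝ) - 2) * (d - 1))
    (hR : ε * ((2 * s - 3) * d * (2 * s + d - 1) - 2 * (s - 2)) ≤
      (d : ℝ) * (2 * s + d - 5) - 2 * (s - 2))
    (hr : (s + d) + (s + d) * (s + d) ≤ r)
    [Fintype I]
    (B : I → Finset V) (ω : (I × V) ⊕ (I × Finset V) → Fin Q) :
    (ERgraph s r Q (1 / 2 + (2 * s - 1) * ε / 2) (1 - (1 - ε) / 2) B ω).CliqueFree (s + d) := by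
  intro T hTc
  set δ : ℝ := 1 / 2 + (2 * s - 1) * ε / 2 with hδ
  set β : ℝ := 1 - (1 - ε) / 2 with hβ
  have hds' : (d : ℝ) + 1 ≤ s := by exact_mod_cast hds
  have hd' : (2 : ℝ) ≤ d := by exact_mod_cast hd
  have hadj : ∀ u ∈ T, ∀ v ∈ T, u ≠ v → ERadj s r Q δ β B ω u v := fun u hu v hv huv =>
    hTc.1 hu hv huv
  have hcard : T.card = s + d := hTc.2
  set L : Finset I := univ.filter fun i => 2 ≤ (T ∩ B i).card with hL
  have huniq : ∀ u ∈ T, ∀ v ∈ T, u ≠ v → ∀ i j, u ∈ B i → v ∈ B i → u ∈ B j →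
      v ∈ B j → i = j := by
    intro u hu v hv huv i j h1 h2 h3 h4
    obtain ⟨-, k, -, -, hk, -⟩ := hadj u hu v hv huv
    rw [hk i h1 h2, hk j h3 h4]
  -- adjacency data on given block
  have hdat : ∀ u ∈ T, ∀ v ∈ T, u ≠ v → ∀ i, u ∈ B i → v ∈ B i →
      (ω (Sum.inl (i, u))).val % s ≠ (ω (Sum.inl (i, v))).val % s ∧
      (ω (Sum.inr (i, {u, v}))).val = 0 ∧
      ∀ S, ERBad r δ β B S → (i, ({u, v} : Finset V)) ∈ ERedges B S →
        ∃ e ∈ ERedges B S, (ω (Sum.inr e)).val ≠ 0 := by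
    intro u hu v hv huv i h1 h2
    obtain ⟨-, k, hk1, hk2, hk, h⟩ := hadj u hu v hv huv
    rw [hk i h1 h2]
    exact h
  have hex : ∀ u ∈ T, ∀ v ∈ T, u ≠ v → ∃ i ∈ L, u ∈ T ∩ B i ∧ v ∈ T ∩ B i := by
    intro u hu v hv huv
    obtain ⟨-, k, hk1, hk2, hk, h⟩ := hadj u hu v hv huv
    refine ⟨k, ?_, mem_inter.2 ⟨hu, hk1⟩, mem_inter.2 ⟨hv, hk2⟩⟩
    simp only [hL, mem_filter, mem_univ, true_and]
    exact one_lt_card.2 ⟨u, mem_inter.2 ⟨hu, hk1⟩, v, mem_inter.2 ⟨hv, hk2⟩, huv⟩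
  have hs0 : 0 < s := by omega
  have hle : ∀ i, (T ∩ B i).card ≤ s := by
    intro i
    have : (T ∩ B i).card ≤ (range s).card := by
      apply card_le_card_of_injOn (fun v => (ω (Sum.inl (i, v))).val % s)
      · intro v _
        simpa using Nat.mod_lt _ hs0
      · intro u hu v hv huv
        by_contra hne
        simp only [coe_inter, Set.mem_inter_iff, mem_coe] at hu hv
        exact (hdat u hu.1 v hv.1 hne i hu.2 hv.2).1 huv
    simpa using this
  have hls := linear_space s d ε hd hds hε hE hR T L (fun i => T ∩ B i) hcard
    (fun i _ => inter_subset_left) hex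
    (fun u hu v hv huv i _ j _ h1 h2 h3 h4 => huniq u hu v hv huv i j (mem_inter.1 h1).2
      (mem_inter.1 h2).2 (mem_inter.1 h3).2 (mem_inter.1 h4).2)
    (fun i hi => (mem_filter.1 hi).2) (fun i _ => hle i)
  rw [← hδ, ← hβ] at hls
  -- the full configuration
  set S0 : Finset (V ⊕ I) := T.disjSum L with hS0
  have hS0l : S0.toLeft = T := by simp [hS0]
  have hS0r : S0.toRight = L := by simp [hS0]
  have hF0 : ERF δ β B S0 ≤ 2 * ((1 - ε) / 2) + δ := by
    rw [ERF, card_ERincs, hS0l, hS0r, hcard]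
    rw [sum_sub_distrib, ← mul_sum, sum_const, nsmul_eq_mul] at hls
    push_cast at hls ⊢
    linarith
  -- edges on every pair
  have hLcard : L.card ≤ (s + d) * (s + d) := by
    have : L.card ≤ (T ×ˢ T).card := by
      have : ∀ i : L, ∃ p : V × V, p.1 ∈ T ∩ B i ∧ p.2 ∈ T ∩ B i ∧ p.1 ≠ p.2 := by
        rintro ⟨i, hi⟩
        obtain ⟨u, hu, v, hv, huv⟩ := one_lt_card.1 (mem_filter.1 hi).2
        exact ⟨(u, v), hu, hv, huv⟩
      choose f hf1 hf2 hf3 using this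
      rw [← card_attach]
      apply card_le_card_of_injOn f
      · intro i _
        simp only [coe_product, Set.mem_prod, mem_coe]
        exact ⟨(mem_inter.1 (hf1 i)).1, (mem_inter.1 (hf2 i)).1⟩
      · intro i _ j _ hij
        apply Subtype.ext
        have a1 := mem_inter.1 (hf1 i)
        have a2 := mem_inter.1 (hf2 i)
        have a3 := mem_inter.1 (hf1 j)
        have a4 := mem_inter.1 (hf2 j)
        rw [← hij] at a3 a4
        exact huniq _ a1.1 _ a2.1 (hf3 i) _ _ a1.2 a2.2 a3.2 a4.2
    rwa [card_product, hcard] at this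
  have hS0card : S0.card ≤ r := by
    rw [hS0, card_disjSum, hcard]; omega
  -- pair to edge
  have hedge : ∀ i ∈ L, ∃ e, (i, e) ∈ ERedges B S0 := by
    intro i hi
    obtain ⟨u, hu, v, hv, huv⟩ := one_lt_card.1 (mem_filter.1 hi).2
    rw [mem_inter] at hu hv
    refine ⟨{u, v}, ?_⟩
    rw [mem_ERedges]
    refine ⟨by simpa [hS0] using hi, ?_, card_pair huv, ?_⟩
    · intro w hw
      simp only [mem_insert, mem_singleton] at hw
      rcases hw with rfl | rfl
      · simpa [hS0] using hu.1
      · simpa [hS0] using hv.1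
    · intro w hw
      simp only [mem_insert, mem_singleton] at hw
      rcases hw with rfl | rfl
      · exact hu.2
      · exact hv.2
  have hLne : L.Nonempty := by
    obtain ⟨u, hu, v, hv, huv⟩ := one_lt_card.1 (by omega : 1 < T.card)
    obtain ⟨i, hi, -⟩ := hex u hu v hv huv
    exact ⟨i, hi⟩
  have hS0ne : (ERedges B S0).Nonempty := by
    obtain ⟨i, hi⟩ := hLne
    obtain ⟨e, he⟩ := hedge i hi
    exact ⟨_, he⟩
  -- S0 has edges on two blocks
  have hS0two : ∃ e ∈ ERedges B S0, ∃ e' ∈ ERedges B S0, e.1 ≠ e'.1 := by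
    obtain ⟨i, hi⟩ := hLne
    have : ∃ v ∈ T, v ∉ B i := by
      by_contra hc
      push Not at hc
      have : T ∩ B i = T := inter_eq_left.2 hc
      have h2 := hle i
      rw [this, hcard] at h2
      omega
    obtain ⟨v, hv, hvi⟩ := this
    obtain ⟨u, hu, huv⟩ := exists_mem_ne (by omega : 1 < T.card) v
    obtain ⟨j, hj, h1, h2⟩ := hex u hu v hv huv
    obtain ⟨e, he⟩ := hedge i hi
    obtain ⟨e', he'⟩ := hedge j hj
    refine ⟨_, he, _, he', ?_⟩
    rintro rfl
    exact hvi (mem_inter.1 h2).2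
  -- single-block configurations are expensive
  have hsingle : ∀ S ⊆ S0, (ERedges B S).Nonempty →
      (¬ ∃ e ∈ ERedges B S, ∃ e' ∈ ERedges B S, e.1 ≠ e'.1) →
      2 * ((1 - ε) / 2) + δ ≤ ERF δ β B S := by
    rintro S hS ⟨⟨i, e⟩, he⟩ hno
    push Not at hno
    have he' := (mem_ERedges B S i e).1 he
    have hiR : i ∈ S.toRight := mem_toRight.2 he'.1
    have heS : e ⊆ S.toLeft ∩ B i := fun v hv =>
      mem_inter.2 ⟨mem_toLeft.2 (he'.2.1 v hv), he'.2.2.2 hv⟩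
    have h2 : 2 ≤ (S.toLeft ∩ B i).card := he'.2.2.1 ▸ card_le_card heS
    have hoth : ∀ j ∈ S.toRight.erase i, (S.toLeft ∩ B j).card ≤ 1 := by
      intro j hj
      by_contra hc
      push Not at hc
      obtain ⟨e2, he2, he2c⟩ := exists_subset_card_eq hc
      have : (j, e2) ∈ ERedges B S := by
        rw [mem_ERedges]
        refine ⟨mem_toRight.1 (mem_of_mem_erase hj), fun v hv => ?_, he2c, fun v hv => ?_⟩
        · exact mem_toLeft.1 (mem_inter.1 (he2 hv)).1
        · exact (mem_inter.1 (he2 hv)).2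
      exact ne_of_mem_erase hj (hno _ he _ this).symm
    rw [ERF, card_ERincs, ← add_sum_erase _ _ hiR]
    have hsum : ∑ j ∈ S.toRight.erase i, (S.toLeft ∩ B j).card ≤ (S.toRight.erase i).card := by
      simpa using sum_le_sum hoth
    have hce : (S.toRight.erase i).card + 1 = S.toRight.card := card_erase_add_one hiR
    have hb : (S.toLeft ∩ B i).card ≤ S.toLeft.card := card_le_card inter_subset_left
    rw [← hce]
    have hsum' : (∑ j ∈ S.toRight.erase i, ((S.toLeft ∩ B j).card : ℝ)) ≤ (S.toRight.erase i).card := by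
      exact_mod_cast hsum
    have hb' : ((S.toLeft ∩ B i).card : ℝ) ≤ S.toLeft.card := by exact_mod_cast hb
    have h2' : (2 : ℝ) ≤ ((S.toLeft ∩ B i).card : ℝ) := by exact_mod_cast h2
    push_cast
    have hβ0 : 0 < β := by rw [hβ]; linarith
    have hβ1 : 1 - β = (1 - ε) / 2 := by rw [hβ]; ring
    have hδβ : β ≤ δ := by rw [hβ, hδ]; nlinarith
    have hε1 : ε < 1 := by
      have h1 : ε * (2 * s - 3) * (d * (s - 1)) ≤ ((s : ℝ) - 2) * (d - 1) := by nlinarith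
      have h3 : 0 < (d : ℝ) * (s - 1) := by apply mul_pos <;> linarith
      have h2 : ε * (2 * s - 3) * (d * (s - 1)) < 1 * (d * ((s : ℝ) - 1)) := by nlinarith
      have := lt_of_mul_lt_mul_right h2 h3.le
      nlinarith
    have hc0 : (0 : ℝ) ≤ ((S.toRight.erase i).card : ℝ) := by positivity
    have e1 := mul_le_mul_of_nonneg_left hsum' hβ0.le
    have e2 := mul_le_mul_of_nonneg_right hδβ hc0
    have e3 := mul_le_mul_of_nonneg_right h2' (by linarith : 0 ≤ (1 - ε) / 2)
    nlinarith
  -- choose the minimiser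
  obtain ⟨S, hSS, hSne, hSmin, hStwo⟩ : ∃ S ⊆ S0, (ERedges B S).Nonempty ∧
      (∀ S' ⊆ S0, (ERedges B S').Nonempty → ERF δ β B S ≤ ERF δ β B S') ∧
      ∃ e ∈ ERedges B S, ∃ e' ∈ ERedges B S, e.1 ≠ e'.1 := by
    by_cases hmin : ∀ S' ⊆ S0, (ERedges B S').Nonempty → ERF δ β B S0 ≤ ERF δ β B S'
    · exact ⟨S0, le_rfl, hS0ne, hmin, hS0two⟩
    · push Not at hmin
      obtain ⟨S1, hS1, hS1ne, hS1F⟩ := hmin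
      obtain ⟨S, hS, hSm⟩ := exists_min_image
        (S0.powerset.filter fun S => (ERedges B S).Nonempty) (ERF δ β B)
        ⟨S0, by simp [hS0ne]⟩
      simp only [mem_filter, mem_powerset] at hS hSm
      refine ⟨S, hS.1, hS.2, fun S' h1 h2 => hSm S' ⟨h1, h2⟩, ?_⟩
      by_contra hno
      have := hsingle S hS.1 hS.2 hno
      have h3 := hSm S1 ⟨hS1, hS1ne⟩
      linarith
  have hbad : ERBad r δ β B S := ⟨(card_le_card hSS).trans hS0card, hStwo,
    fun S' h1 h2 => hSmin S' (h1.trans hSS) h2⟩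
  -- all edges of S are low
  have hpair : ∀ i e, (i, e) ∈ ERedges B S → ∃ u v, e = {u, v} ∧ u ∈ T ∧ v ∈ T ∧ u ≠ v ∧
      u ∈ B i ∧ v ∈ B i := by
    intro i e he
    have he' := (mem_ERedges B S0 i e).1 (ERedges_mono B hSS he)
    obtain ⟨u, v, huv, rfl⟩ := card_eq_two.1 he'.2.2.1
    have h1 := he'.2.1 u (by simp)
    have h2 := he'.2.1 v (by simp)
    refine ⟨u, v, rfl, by simpa [hS0] using h1, by simpa [hS0] using h2, huv,
      he'.2.2.2 (by simp), he'.2.2.2 (by simp)⟩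
  obtain ⟨⟨i, e⟩, he⟩ := hSne
  obtain ⟨u, v, rfl, hu, hv, huv, hui, hvi⟩ := hpair i e he
  obtain ⟨⟨j, e2⟩, he2, hlow⟩ := (hdat u hu v hv huv i hui hvi).2.2 S hbad he
  obtain ⟨u', v', rfl, hu', hv', huv', hui', hvi'⟩ := hpair j e2 he2
  exact hlow (hdat u' hu' v' hv' huv' j hui' hvi').2.1

end defsER

end

section
open Finset

theorem exists_indep_subset {ι : Type*} [DecidableEq ι] (J : Finset ι) (R : ι → ι → Prop) (D : ℕ)
    (hsymm : ∀ i j, R i j → R j i)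
    (hdeg : ∀ i ∈ J, ∃ N : Finset ι, N.card ≤ D ∧ ∀ j ∈ J, j ≠ i → R i j → j ∈ N) :
    ∃ J' ⊆ J, (∀ i ∈ J', ∀ j ∈ J', i ≠ j → ¬ R i j) ∧ J.card ≤ J'.card * (D + 1) := by
  classical
  obtain ⟨J', hJ', hmax⟩ := exists_max_image
    (J.powerset.filter fun J' => ∀ i ∈ J', ∀ j ∈ J', i ≠ j → ¬ R i j) card ⟨∅, by simp⟩
  simp only [mem_filter, mem_powerset] at hJ' hmax
  refine ⟨J', hJ'.1, hJ'.2, ?_⟩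
  choose! N hN1 hN2 using hdeg
  have hsub : J ⊆ J'.biUnion fun i => insert i (N i) := by
    intro j hj
    by_contra hc
    simp only [mem_biUnion, mem_insert, not_exists, not_and, not_or] at hc
    have hjJ' : j ∉ J' := fun h => (hc j h).1 rfl
    have := hmax (insert j J') ⟨insert_subset hj hJ'.1, ?_⟩
    · rw [card_insert_of_notMem hjJ'] at this; omega
    · intro a ha b hb hab hR
      rw [mem_insert] at ha hb
      rcases ha with rfl | ha <;> rcases hb with rfl | hb
      · exact hab rfl
      · exact (hc b hb).2 (hN2 b (hJ'.1 hb) a hj hab (hsymm _ _ hR))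
      · exact (hc a ha).2 (hN2 a (hJ'.1 ha) b hj hab.symm hR)
      · exact hJ'.2 a ha b hb hab hR
  refine (card_le_card hsub).trans (card_biUnion_le_card_mul _ _ _ fun i hi => ?_)
  exact (card_insert_le _ _).trans (Nat.succ_le_succ (hN1 i (hJ'.1 hi)))

theorem box_prob {X Y : Type*} [Fintype X] [DecidableEq X] [Fintype Y] [DecidableEq Y] [Nonempty Y]
    (D : Finset X) (W : X → Finset Y) :
    ((univ.filter fun ω : X → Y => ∀ x ∈ D, ω x ∈ W x).card : ℝ) =
      (∏ x ∈ D, ((W x).card : ℝ) / Fintype.card Y) * Fintype.card (X → Y) := by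
  have hY : (0 : ℝ) < Fintype.card Y := by exact_mod_cast Fintype.card_pos
  have h1 : (univ.filter fun ω : X → Y => ∀ x ∈ D, ω x ∈ W x) =
      Fintype.piFinset fun x => if x ∈ D then W x else univ := by
    ext ω
    simp only [mem_filter, mem_univ, true_and, Fintype.mem_piFinset]
    refine forall_congr' fun x => ?_
    by_cases hx : x ∈ D <;> simp [hx]
  rw [h1, Fintype.card_piFinset, Fintype.card_fun]
  push_cast
  have h2 : ∀ x, ((if x ∈ D then W x else univ).card : ℝ) =
      (if x ∈ D then ((W x).card : ℝ) / Fintype.card Y else 1) * Fintype.card Y := by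
    intro x
    split_ifs
    · rw [div_mul_cancel₀ _ hY.ne']
    · simp
  simp_rw [h2]
  rw [prod_mul_distrib, prod_ite_mem, univ_inter]
  simp

open Classical in
theorem box_indep {X Y ι : Type*} [Fintype X] [DecidableEq X] [Fintype Y] [Nonempty Y]
    (J : Finset ι) (D : ι → Finset X) (W : ι → X → Finset Y) (p : ℝ)
    (hdisj : ∀ i ∈ J, ∀ j ∈ J, i ≠ j → Disjoint (D i) (D j))
    (hp1 : p ≤ 1)
    (hp : ∀ i ∈ J, p * Fintype.card (X → Y) ≤
      ((univ.filter fun ω : X → Y => ∀ x ∈ D i, ω x ∈ W i x).card : ℝ)) :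
    ((univ.filter fun ω : X → Y => ∀ i ∈ J, ¬ ∀ x ∈ D i, ω x ∈ W i x).card : ℝ) ≤
      (1 - p) ^ J.card * Fintype.card (X → Y) := by
  induction J using Finset.induction_on with
  | empty => simp
  | insert a J ha ih =>
    have ih' := ih (fun i hi j hj => hdisj i (mem_insert_of_mem hi) j (mem_insert_of_mem hj))
      (fun i hi => hp i (mem_insert_of_mem hi))
    have hΩ : (0 : ℝ) < Fintype.card (X → Y) := by exact_mod_cast Fintype.card_pos
    have := indep_sum (D a) (fun ω : X → Y => if ∀ i ∈ J, ¬ ∀ x ∈ D i, ω x ∈ W i x then (1 : ℝ) else 0)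
      (fun ω : X → Y => if ¬ ∀ x ∈ D a, ω x ∈ W a x then (1 : ℝ) else 0) ?_ ?_
    · have e1 : ∀ ω : X → Y, ((if ∀ i ∈ J, ¬ ∀ x ∈ D i, ω x ∈ W i x then (1 : ℝ) else 0) *
          if ¬ ∀ x ∈ D a, ω x ∈ W a x then (1 : ℝ) else 0) =
          if ∀ i ∈ insert a J, ¬ ∀ x ∈ D i, ω x ∈ W i x then (1 : ℝ) else 0 := by
        intro ω
        have hfi : (∀ i ∈ insert a J, ¬ ∀ x ∈ D i, ω x ∈ W i x) ↔
            (¬ ∀ x ∈ D a, ω x ∈ W a x) ∧ ∀ i ∈ J, ¬ ∀ x ∈ D i, ω x ∈ W i x := forall_mem_insert _ _ _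
        by_cases h1 : ∀ i ∈ J, ¬ ∀ x ∈ D i, ω x ∈ W i x <;>
          by_cases h2 : ∀ x ∈ D a, ω x ∈ W a x
        · rw [if_pos h1, if_neg (not_not.2 h2), if_neg (fun h => (hfi.1 h).1 h2), mul_zero]
        · rw [if_pos h1, if_pos h2, if_pos (hfi.2 ⟨h2, h1⟩), mul_one]
        · rw [if_neg h1, if_neg (fun h => h1 (hfi.1 h).2), zero_mul]
        · rw [if_neg h1, if_neg (fun h => h1 (hfi.1 h).2), zero_mul]
      simp only [e1, sum_boole] at this
      have hc : ((univ.filter fun ω : X → Y => ¬ ∀ x ∈ D a, ω x ∈ W a x).card : ℝ) ≤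
          (1 - p) * Fintype.card (X → Y) := by
        have h3 := card_filter_add_card_filter_not (s := (univ : Finset (X → Y)))
          (fun ω : X → Y => ∀ x ∈ D a, ω x ∈ W a x)
        rw [card_univ] at h3
        have h4 : ((univ.filter fun ω : X → Y => ∀ x ∈ D a, ω x ∈ W a x).card : ℝ) +
          ((univ.filter fun ω : X → Y => ¬ ∀ x ∈ D a, ω x ∈ W a x).card : ℝ) =
            Fintype.card (X → Y) := by exact_mod_cast h3
        have := hp a (mem_insert_self _ _)
        linarith
      refine le_of_mul_le_mul_left ?_ hΩ
      rw [this, card_insert_of_notMem ha, pow_succ]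
      calc _ ≤ ((1 - p) ^ J.card * Fintype.card (X → Y)) * ((1 - p) * Fintype.card (X → Y)) :=
            mul_le_mul ih' hc (by positivity) (mul_nonneg (pow_nonneg (by linarith) _) hΩ.le)
        _ = _ := by ring
    · intro ω ω' h
      have : (∀ i ∈ J, ¬ ∀ x ∈ D i, ω x ∈ W i x) ↔ (∀ i ∈ J, ¬ ∀ x ∈ D i, ω' x ∈ W i x) := by
        refine forall_congr' fun i => forall_congr' fun hi => not_congr ?_
        refine forall_congr' fun x => forall_congr' fun hx => ?_
        rw [h x]
        have hia : i ≠ a := fun h => ha (h ▸ hi)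
        exact disjoint_left.1 (hdisj i (mem_insert_of_mem hi) a (mem_insert_self _ _) hia) hx
      simp only [this]
    · intro ω ω' h
      have : (∀ x ∈ D a, ω x ∈ W a x) ↔ (∀ x ∈ D a, ω' x ∈ W a x) := by
        refine forall_congr' fun x => forall_congr' fun hx => ?_
        rw [h x hx]
      simp only [this]

end

section
open Finset

theorem card_fin_val_eq (Q c : ℕ) (h : c < Q) : (univ.filter fun y : Fin Q => y.val = c).card = 1 := by
  rw [card_eq_one]
  refine ⟨⟨c, h⟩, ?_⟩
  ext y
  simp [Fin.ext_iff]

theorem card_fin_val_ne_zero (Q : ℕ) (h : 0 < Q) :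
    (univ.filter fun y : Fin Q => y.val ≠ 0).card + 1 = Q := by
  have h1 := card_filter_add_card_filter_not (s := (univ : Finset (Fin Q))) (fun y => y.val = 0)
  rw [card_fin_val_eq Q 0 h, card_univ, Fintype.card_fin] at h1
  simp only [ne_eq]
  omega

open Classical in
theorem phase2_count {V I : Type*} [Fintype V] [DecidableEq V] [Fintype I] [DecidableEq I]
    (s r Q Δ M : ℕ) (δ β : ℝ) (B : I → Finset V) (hs : 1 ≤ s)
    (hM : s + s * s + s * s * (Δ * r ^ 3) ≤ M) (hMQ : 2 * M ≤ Q)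
    (hP2 : ∀ i e, e.card = 2 → e ⊆ B i → ∃ 𝓑 : Finset (Finset (V ⊕ I)), 𝓑.card ≤ Δ ∧
      ∀ S, ERBad r δ β B S → (i, e) ∈ ERedges B S → S ∈ 𝓑)
    (J : Finset I) (κ : I → Finset V) (hκ : ∀ i ∈ J, (κ i).card = s) (hκB : ∀ i ∈ J, κ i ⊆ B i)
    (hκu : ∀ i ∈ J, ∀ u ∈ κ i, ∀ v ∈ κ i, u ≠ v → ∀ j, u ∈ B j → v ∈ B j → j = i)
    (N' : ℕ) (hN' : J.card < (N' + 1) * (M * (1 + Δ * r) + 1) → False) :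
    ((univ.filter fun ω : (I × V) ⊕ (I × Finset V) → Fin Q =>
      ∀ i ∈ J, ¬ (ERgraph s r Q δ β B ω).IsClique (κ i : Set V)).card : ℝ) ≤
      (1 - (1 / Q : ℝ) ^ (s + s * s) / 2) ^ N' *
        Fintype.card ((I × V) ⊕ (I × Finset V) → Fin Q) := by
  have hsM : s ≤ M := by
    have := Nat.zero_le (s * s + s * s * (Δ * r ^ 3)); omega
  have hQ0 : 0 < Q := by omega
  have hsQ : s ≤ Q := by omega
  haveI : Nonempty (Fin Q) := ⟨⟨0, hQ0⟩⟩
  choose! 𝓑 h𝓑1 h𝓑2 using hP2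
  let 𝓒 : I → Finset V → Finset (Finset (V ⊕ I)) := fun i e =>
    if e.card = 2 ∧ e ⊆ B i then (𝓑 i e).filter fun S => ERBad r δ β B S ∧ (i, e) ∈ ERedges B S else ∅
  have h𝓒card : ∀ i e, (𝓒 i e).card ≤ Δ := by
    intro i e
    by_cases h : e.card = 2 ∧ e ⊆ B i
    · simp only [𝓒, if_pos h]
      exact (card_filter_le _ _).trans (h𝓑1 i e h.1 h.2)
    · simp only [𝓒, if_neg h]; simp
  have h𝓒 : ∀ i e S, S ∈ 𝓒 i e ↔ ERBad r δ β B S ∧ (i, e) ∈ ERedges B S := by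
    intro i e S
    constructor
    · intro hS
      by_cases h : e.card = 2 ∧ e ⊆ B i
      · simp only [𝓒, if_pos h, mem_filter] at hS
        exact hS.2
      · simp only [𝓒, if_neg h] at hS; simp at hS
    · rintro ⟨h1, h2⟩
      have h := ((mem_ERedges B S i e).1 h2).2.2
      simp only [𝓒, if_pos h, mem_filter]
      exact ⟨h𝓑2 i e h.1 h.2 S h1 h2, h1, h2⟩
  have hedgecard : ∀ S, ERBad r δ β B S → (ERedges B S).card ≤ r ^ 3 := by
    intro S hS
    have hl : S.toLeft.card ≤ r := card_toLeft_le.trans hS.1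
    have hr : S.toRight.card ≤ r := card_toRight_le.trans hS.1
    calc (ERedges B S).card ≤ (S.toRight ×ˢ S.toLeft.powersetCard 2).card := card_filter_le _ _
      _ = S.toRight.card * S.toLeft.card.choose 2 := by rw [card_product, card_powersetCard]
      _ ≤ r * r ^ 2 := Nat.mul_le_mul hr ((Nat.choose_le_pow _ _).trans (Nat.pow_le_pow_left hl 2))
      _ = r ^ 3 := by ring
  have hcol : ∀ i ∈ J, ∃ f : V → ℕ, (∀ v ∈ κ i, f v < s) ∧ Set.InjOn f (κ i) := by
    intro i hi
    have e := (κ i).equivFinOfCardEq (hκ i hi)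
    refine ⟨fun v => if h : v ∈ κ i then (e ⟨v, h⟩).val else 0, fun v hv => ?_, fun u hu v hv huv => ?_⟩
    · simp [hv]
    · rw [mem_coe] at hu hv
      simp only [hu, hv, dif_pos] at huv
      have := e.injective (Fin.ext huv)
      simpa using this
  choose! col hcol1 hcol2 using hcol
  let Off : I → Finset (I × Finset V) := fun i =>
    ((κ i).powersetCard 2).biUnion fun e => (𝓒 i e).biUnion fun S =>
      (ERedges B S).filter fun x => x.1 ≠ i
  let D1 : I → Finset ((I × V) ⊕ (I × Finset V)) := fun i =>
    (κ i).image (fun v => Sum.inl (i, v)) ∪ ((κ i).powersetCard 2).image (fun e => Sum.inr (i, e))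
  let D2 : I → Finset ((I × V) ⊕ (I × Finset V)) := fun i => (Off i).image Sum.inr
  let W : I → (I × V) ⊕ (I × Finset V) → Finset (Fin Q) := fun i x =>
    match x with
    | Sum.inl (_, v) => univ.filter fun y : Fin Q => y.val = col i v
    | Sum.inr (j, _) => if j = i then univ.filter fun y : Fin Q => y.val = 0
        else univ.filter fun y : Fin Q => y.val ≠ 0
  have hpc : ∀ i ∈ J, ((κ i).powersetCard 2).card ≤ s * s := by
    intro i hi
    rw [card_powersetCard, hκ i hi, ← sq]
    exact Nat.choose_le_pow _ _
  have hD1card : ∀ i ∈ J, (D1 i).card ≤ s + s * s := by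
    intro i hi
    refine (card_union_le _ _).trans (Nat.add_le_add ?_ ?_)
    · exact card_image_le.trans (hκ i hi).le
    · exact card_image_le.trans (hpc i hi)
  have hOffcard : ∀ i ∈ J, (Off i).card ≤ s * s * (Δ * r ^ 3) := by
    intro i hi
    refine (card_biUnion_le_card_mul _ _ (Δ * r ^ 3) fun e he => ?_).trans
      (Nat.mul_le_mul_right _ (hpc i hi))
    refine (card_biUnion_le_card_mul _ _ (r ^ 3) fun S hS => ?_).trans
      (Nat.mul_le_mul_right _ (h𝓒card i e))
    exact (card_filter_le _ _).trans (hedgecard S ((h𝓒 i e S).1 hS).1)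
  have hDcard : ∀ i ∈ J, (D1 i ∪ D2 i).card ≤ M := by
    intro i hi
    refine (card_union_le _ _).trans (le_trans (Nat.add_le_add (hD1card i hi)
      (card_image_le.trans (hOffcard i hi))) hM)
  -- choose an independent subfamily
  obtain ⟨J', hJ'J, hJ'ind, hJ'card⟩ := exists_indep_subset J
    (fun i j => ¬ Disjoint (D1 i ∪ D2 i) (D1 j ∪ D2 j)) (M * (1 + Δ * r))
    (fun i j h h' => h h'.symm) (by
      intro i hi
      refine ⟨(D1 i ∪ D2 i).biUnion fun x => match x with
        | Sum.inl (j, _) => {j}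
        | Sum.inr (j, e) => insert j ((𝓒 j e).biUnion fun S => S.toRight), ?_, ?_⟩
      · refine (card_biUnion_le_card_mul _ _ (1 + Δ * r) ?_).trans
          (Nat.mul_le_mul_right _ (hDcard i hi))
        rintro (⟨j, v⟩ | ⟨j, e⟩) _
        · simp
        · refine (card_insert_le _ _).trans ?_
          rw [add_comm]
          refine Nat.add_le_add_left ?_ 1
          refine (card_biUnion_le_card_mul _ _ r fun S hS => ?_).trans
            (Nat.mul_le_mul_right _ (h𝓒card j e))
          exact card_toRight_le.trans ((h𝓒 j e S).1 hS).1.1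
      · intro j hj hji hnd
        rw [not_disjoint_iff] at hnd
        obtain ⟨x, hxi, hxj⟩ := hnd
        rw [mem_biUnion]
        refine ⟨x, hxi, ?_⟩
        simp only [D1, D2, mem_union, mem_image] at hxj
        rcases hxj with (⟨v, hv, rfl⟩ | ⟨e, he, rfl⟩) | ⟨⟨k, e⟩, hx, rfl⟩
        · simp
        · simp
        · simp only [Off, mem_biUnion, mem_filter] at hx
          obtain ⟨e0, he0, S, hS, hkS, hkj⟩ := hx
          simp only [mem_insert, mem_biUnion]
          right
          have hS' := (h𝓒 j e0 S).1 hS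
          refine ⟨S, (h𝓒 k e S).2 ⟨hS'.1, hkS⟩, ?_⟩
          exact mem_toRight.2 ((mem_ERedges B S j e0).1 hS'.2).1)
  have hJ'N : N' ≤ J'.card := by
    by_contra hc
    apply hN'
    refine lt_of_le_of_lt hJ'card ?_
    apply Nat.mul_lt_mul_of_pos_right (by omega) (by omega)
  -- probabilities
  set p : ℝ := (1 / Q : ℝ) ^ (s + s * s) / 2 with hp
  have hQ1 : (1 : ℝ) ≤ Q := by exact_mod_cast hQ0
  have hinv1 : (1 / Q : ℝ) ≤ 1 := by rw [div_le_one (by linarith)]; exact hQ1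
  have hinv0 : (0 : ℝ) ≤ (1 / Q : ℝ) := by positivity
  have hp0 : 0 ≤ p := by positivity
  have hp1 : p ≤ 1 := by
    have : (1 / Q : ℝ) ^ (s + s * s) ≤ 1 := pow_le_one₀ hinv0 hinv1
    rw [hp]; linarith
  have hbox := box_indep J' (fun i => D1 i ∪ D2 i) W p
    (fun i hi j hj hij => not_not.1 (hJ'ind i hi j hj hij)) hp1 (by
      intro i hi
      have hiJ := hJ'J hi
      refine le_trans ?_ (le_of_eq ((box_prob (D1 i ∪ D2 i) (W i)).symm.trans (by congr!)))
      refine mul_le_mul_of_nonneg_right ?_ (by positivity)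
      have hdisj : Disjoint (D1 i) (D2 i) := by
        rw [disjoint_left]
        intro x hx1 hx2
        simp only [D1, D2, mem_union, mem_image] at hx1 hx2
        obtain ⟨⟨k, e⟩, hx, rfl⟩ := hx2
        simp only [Off, mem_biUnion, mem_filter] at hx
        obtain ⟨e0, he0, S, hS, hkS, hkj⟩ := hx
        rcases hx1 with ⟨v, hv, h⟩ | ⟨e', he, h⟩
        · cases h
        · simp only [Sum.inr.injEq, Prod.mk.injEq] at h
          exact hkj h.1.symm
      rw [prod_union hdisj]
      have hf1 : ∀ x ∈ D1 i, ((W i x).card : ℝ) / Fintype.card (Fin Q) = 1 / Q := by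
        intro x hx
        rw [Fintype.card_fin]
        congr 1
        simp only [D1, mem_union, mem_image] at hx
        rcases hx with ⟨v, hv, rfl⟩ | ⟨e', he, rfl⟩
        · simp only [W]
          rw [card_fin_val_eq]; simp
          exact (hcol1 i hiJ v hv).trans_le hsQ
        · simp only [W, if_true]
          rw [card_fin_val_eq _ _ hQ0]; simp
      have hf2 : ∀ x ∈ D2 i, ((W i x).card : ℝ) / Fintype.card (Fin Q) = 1 - 1 / Q := by
        intro x hx
        rw [Fintype.card_fin]
        simp only [D2, mem_image] at hx
        obtain ⟨⟨k, e⟩, hx, rfl⟩ := hx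
        simp only [Off, mem_biUnion, mem_filter] at hx
        obtain ⟨e0, he0, S, hS, hkS, hkj⟩ := hx
        simp only [W]
        rw [if_neg hkj]
        have := card_fin_val_ne_zero Q hQ0
        have h2 : (((univ.filter fun y : Fin Q => y.val ≠ 0).card : ℕ) : ℝ) + 1 = Q := by
          exact_mod_cast this
        rw [eq_sub_iff_add_eq, ← add_div, h2, div_self (by linarith)]
      rw [prod_congr rfl hf1, prod_congr rfl hf2, prod_const, prod_const]
      have g1 : (1 / Q : ℝ) ^ (s + s * s) ≤ (1 / Q : ℝ) ^ (D1 i).card :=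
        pow_le_pow_of_le_one hinv0 hinv1 (hD1card i hiJ)
      have g2 : (1 / 2 : ℝ) ≤ (1 - 1 / Q) ^ (D2 i).card := by
        have h1 : (1 - 1 / Q : ℝ) ^ M ≤ (1 - 1 / Q) ^ (D2 i).card := by
          apply pow_le_pow_of_le_one (by linarith) (by linarith)
          exact (card_le_card subset_union_right).trans (hDcard i hiJ)
        have h2 := one_add_mul_le_pow (a := (-(1 / Q) : ℝ)) (by linarith) M
        have h3 : (2 : ℝ) * M ≤ Q := by exact_mod_cast hMQ
        have h4 : (M : ℝ) * (1 / Q) ≤ 1 / 2 := by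
          rw [mul_one_div, div_le_iff₀ (by linarith)]; linarith
        have h5 : (1 + -(1 / Q : ℝ)) = 1 - 1 / Q := by ring
        rw [h5] at h2
        linarith
      calc p = (1 / Q : ℝ) ^ (s + s * s) * (1 / 2) := by rw [hp]; ring
        _ ≤ _ := mul_le_mul g1 g2 (by norm_num) (by positivity))
  have hsub : (univ.filter fun ω : (I × V) ⊕ (I × Finset V) → Fin Q =>
      ∀ i ∈ J, ¬ (ERgraph s r Q δ β B ω).IsClique (κ i : Set V)) ⊆
      (univ.filter fun ω : (I × V) ⊕ (I × Finset V) → Fin Q =>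
        ∀ i ∈ J', ¬ ∀ x ∈ D1 i ∪ D2 i, ω x ∈ W i x) := by
    intro ω hω
    simp only [mem_filter, mem_univ, true_and] at hω ⊢
    intro i hi hall
    have hiJ := hJ'J hi
    apply hω i hiJ
    intro u hu v hv huv
    rw [mem_coe] at hu hv
    have hcolour : ∀ v ∈ κ i, (ω (Sum.inl (i, v))).val = col i v := by
      intro v hv
      have := hall (Sum.inl (i, v)) (by
        simp only [D1, mem_union, mem_image]
        exact Or.inl (Or.inl ⟨v, hv, rfl⟩))
      simpa only [W, mem_filter, mem_univ, true_and] using this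
    have hpm : ({u, v} : Finset V) ∈ (κ i).powersetCard 2 := by
      rw [mem_powersetCard]
      refine ⟨?_, card_pair huv⟩
      intro w hw
      simp only [mem_insert, mem_singleton] at hw
      rcases hw with rfl | rfl <;> assumption
    refine ⟨huv, i, hκB i hiJ hu, hκB i hiJ hv, hκu i hiJ u hu v hv huv, ?_, ?_, ?_⟩
    · rw [hcolour u hu, hcolour v hv, Nat.mod_eq_of_lt (hcol1 i hiJ u hu),
        Nat.mod_eq_of_lt (hcol1 i hiJ v hv)]
      intro h
      exact huv (hcol2 i hiJ hu hv h)
    · have := hall (Sum.inr (i, {u, v})) (by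
        simp only [D1, mem_union, mem_image]
        exact Or.inl (Or.inr ⟨_, hpm, rfl⟩))
      simpa only [W, if_true, mem_filter, mem_univ, true_and] using this
    · intro S hS heS
      obtain ⟨x, hx, hxi⟩ : ∃ x ∈ ERedges B S, x.1 ≠ i := by
        obtain ⟨e, he, e', he', hne⟩ := hS.2.1
        by_cases h : e.1 = i
        · exact ⟨e', he', fun h' => hne (h.trans h'.symm)⟩
        · exact ⟨e, he, h⟩
      refine ⟨x, hx, ?_⟩
      have := hall (Sum.inr x) (by
        simp only [D2, Off, mem_union, mem_image]
        refine Or.inr ⟨x, ?_, rfl⟩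
        simp only [mem_biUnion, mem_filter]
        exact ⟨_, hpm, S, (h𝓒 i _ S).2 ⟨hS, heS⟩, hx, hxi⟩)
      obtain ⟨k, e⟩ := x
      simp only [W] at this
      rw [if_neg hxi] at this
      simpa only [mem_filter, mem_univ, true_and] using this
  calc _ ≤ (((univ.filter fun ω : (I × V) ⊕ (I × Finset V) → Fin Q =>
        ∀ i ∈ J', ¬ ∀ x ∈ D1 i ∪ D2 i, ω x ∈ W i x).card : ℕ) : ℝ) := by
        exact_mod_cast card_le_card hsub
    _ ≤ (1 - p) ^ J'.card * Fintype.card ((I × V) ⊕ (I × Finset V) → Fin Q) := by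
        convert hbox
    _ ≤ _ := by
        refine mul_le_mul_of_nonneg_right ?_ (by positivity)
        exact pow_le_pow_of_le_one (by linarith) (by linarith) hJ'N

end

section
open Finset

theorem sunflower_count {α : Type*} [DecidableEq α] (𝓕 : Finset (Finset α)) (r p : ℕ)
    (hr : ∀ S ∈ 𝓕, S.card ≤ r) (d : ℕ) (K0 : Finset α) (hd : r - K0.card ≤ d)
    (hsun : ∀ K, K0 ⊆ K → K.card ≤ r → ∀ 𝓢 ⊆ 𝓕, (∀ S ∈ 𝓢, K ⊂ S) →
      (∀ S ∈ 𝓢, ∀ S' ∈ 𝓢, S ≠ S' → S ∩ S' ⊆ K) → 𝓢.card < p) :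
    (𝓕.filter (K0 ⊆ ·)).card ≤ (1 + p * r) ^ d := by
  induction d generalizing K0 with
  | zero =>
    rw [pow_zero, card_le_one]
    intro S hS S' hS'
    simp only [mem_filter] at hS hS'
    have h1 := hr _ hS.1
    have h2 := hr _ hS'.1
    rw [← eq_of_subset_of_card_le hS.2 (by omega), ← eq_of_subset_of_card_le hS'.2 (by omega)]
  | succ d ih =>
    by_cases hK0 : K0.card ≤ r
    swap
    · have : 𝓕.filter (K0 ⊆ ·) = ∅ := by
        rw [filter_eq_empty_iff]
        intro S hS hKS
        exact hK0 ((card_le_card hKS).trans (hr S hS))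
      rw [this]; simp
    obtain ⟨𝓢, h𝓢, hmax⟩ := exists_max_image
      (𝓕.powerset.filter fun 𝓢 => (∀ S ∈ 𝓢, K0 ⊂ S) ∧
        ∀ S ∈ 𝓢, ∀ S' ∈ 𝓢, S ≠ S' → S ∩ S' ⊆ K0) card ⟨∅, by simp⟩
    simp only [mem_filter, mem_powerset] at h𝓢 hmax
    have hp := hsun K0 subset_rfl hK0 𝓢 h𝓢.1 h𝓢.2.1 h𝓢.2.2
    set X := (𝓢.biUnion id) \ K0 with hX
    have hXc : X.card ≤ p * r := by
      refine (card_le_card sdiff_subset).trans ?_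
      refine (card_biUnion_le_card_mul 𝓢 id r fun S hS => hr S (h𝓢.1 hS)).trans ?_
      exact Nat.mul_le_mul_right _ hp.le
    have hsub : 𝓕.filter (K0 ⊆ ·) ⊆
        {K0} ∪ X.biUnion fun x => 𝓕.filter (insert x K0 ⊆ ·) := by
      intro S hS
      simp only [mem_filter] at hS
      simp only [mem_union, mem_singleton, mem_biUnion, mem_filter]
      by_cases hSK : S = K0
      · exact Or.inl hSK
      right
      have hss : K0 ⊂ S := lt_of_le_of_ne hS.2 (Ne.symm hSK)
      suffices h : ∃ x ∈ X, x ∈ S by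
        obtain ⟨x, hx, hxS⟩ := h
        exact ⟨x, hx, hS.1, insert_subset hxS hS.2⟩
      by_contra hc
      push Not at hc
      have hinter : ∀ S' ∈ 𝓢, S ∩ S' ⊆ K0 := by
        intro S' hS' x hx
        rw [mem_inter] at hx
        by_contra hxK
        exact hc x (mem_sdiff.2 ⟨mem_biUnion.2 ⟨S', hS', hx.2⟩, hxK⟩) hx.1
      by_cases hSS : S ∈ 𝓢
      · exact hss.2 (by simpa using hinter S hSS)
      have := hmax (insert S 𝓢) ⟨insert_subset hS.1 h𝓢.1, ?_, ?_⟩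
      · rw [card_insert_of_notMem hSS] at this; omega
      · intro S' hS'
        rw [mem_insert] at hS'
        rcases hS' with rfl | hS'
        · exact hss
        · exact h𝓢.2.1 S' hS'
      · intro S1 h1 S2 h2 hne
        rw [mem_insert] at h1 h2
        rcases h1 with rfl | h1 <;> rcases h2 with rfl | h2
        · exact absurd rfl hne
        · exact hinter _ h2
        · rw [inter_comm]; exact hinter _ h1
        · exact h𝓢.2.2 S1 h1 S2 h2 hne
    have hcount : (X.biUnion fun x => 𝓕.filter (insert x K0 ⊆ ·)).card ≤
        X.card * (1 + p * r) ^ d := by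
      refine card_biUnion_le_card_mul _ _ _ fun x hx => ?_
      have hxK : x ∉ K0 := (mem_sdiff.1 hx).2
      refine ih (insert x K0) ?_ ?_
      · rw [card_insert_of_notMem hxK]; omega
      · intro K hK
        exact hsun K ((subset_insert x K0).trans hK)
    have h1 : 1 ≤ (1 + p * r) ^ d := Nat.one_le_pow _ _ (by omega)
    calc _ ≤ _ := card_le_card hsub
      _ ≤ 1 + X.card * (1 + p * r) ^ d := by
        refine (card_union_le _ _).trans ?_
        rw [card_singleton]; omega
      _ ≤ (1 + p * r) ^ d + (p * r) * (1 + p * r) ^ d :=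
        Nat.add_le_add h1 (Nat.mul_le_mul_right _ hXc)
      _ = _ := by ring

/-- random blocks -/
def ERB {V I X : Type*} [Fintype X] [DecidableEq V] (ω : I → X → V) (i : I) : Finset V :=
  univ.image (ω i)

theorem card_incs_subset {V I X : Type*} [Fintype V] [DecidableEq V] [Nonempty V] [Fintype I]
    [DecidableEq I] [Fintype X] [DecidableEq X] (J : Finset (V × I)) :
    ((univ.filter fun ω : I → X → V => ∀ q ∈ J, q.1 ∈ ERB ω q.2).card : ℝ) ≤
      ((Fintype.card X : ℝ) / Fintype.card V) ^ J.card * Fintype.card (I → X → V) := by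
  classical
  let P : I → Finset V := fun i => univ.filter fun v => (v, i) ∈ J
  have h1 : (univ.filter fun ω : I → X → V => ∀ q ∈ J, q.1 ∈ ERB ω q.2) =
      Fintype.piFinset fun i => univ.filter fun φ : X → V => P i ⊆ univ.image φ := by
    ext ω
    simp only [mem_filter, mem_univ, true_and, Fintype.mem_piFinset, P, subset_iff, Prod.forall]
    constructor
    · intro h i v hv; exact h v i hv
    · intro h v i hv; exact h i hv
  have h2 : J.card = ∑ i, (P i).card := by
    have := card_eq_sum_card_fiberwise (f := Prod.snd) (s := J) (t := univ) (by simp)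
    rw [this]
    refine sum_congr rfl fun i _ => ?_
    refine card_bij (fun q _ => q.1) ?_ ?_ ?_
    · rintro ⟨v, j⟩ h
      simp only [mem_filter] at h
      obtain ⟨h, rfl⟩ := h
      simpa [P] using h
    · rintro ⟨v, j⟩ h ⟨v', j'⟩ h' hv
      simp only [mem_filter] at h h'
      ext
      · exact hv
      · exact h.2.trans h'.2.symm
    · intro v hv
      refine ⟨(v, i), ?_, rfl⟩
      simpa [P] using hv
  rw [h1, Fintype.card_piFinset, h2, ← prod_pow_eq_pow_sum]
  rw [Fintype.card_fun (α := I)]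
  push_cast
  calc _ ≤ ∏ i, (((Fintype.card X : ℝ) / Fintype.card V) ^ (P i).card * Fintype.card (X → V)) :=
        prod_le_prod (fun _ _ => by positivity) fun i _ => card_image_superset (P i)
    _ = _ := by
        rw [prod_mul_distrib]; simp

end

section
open Finset

theorem sum_T_bound {V I : Type*} [Fintype V] [DecidableEq V] [Fintype I] [DecidableEq I]
    (r : ℕ) (x y c : ℝ) (hx : 0 ≤ x) (hy : 0 ≤ y) (hc : 0 ≤ c)
    (hsum : Fintype.card V * x + Fintype.card I * y ≤ 2)
    (K : Finset (V ⊕ I)) (T : Finset (Finset (V ⊕ I) × Finset (V × I)))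
    (hT : ∀ q ∈ T, K ⊂ q.1 ∧ q.1.card ≤ r ∧ q.2 ⊆ q.1.toLeft ×ˢ q.1.toRight)
    (f : Finset (V ⊕ I) × Finset (V × I) → ℝ)
    (hf : ∀ q ∈ T, f q ≤ c * (x ^ (q.1 \ K).toLeft.card * y ^ (q.1 \ K).toRight.card)) :
    ∑ q ∈ T, f q ≤ 2 ^ (r * r) * Real.exp 2 * c := by
  classical
  let w : V ⊕ I → ℝ := Sum.elim (fun _ => x) (fun _ => y)
  have hw : ∀ z, 0 ≤ w z := by rintro (z | z) <;> simp [w, hx, hy]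
  have hwp : ∀ D : Finset (V ⊕ I), ∏ z ∈ D, w z = x ^ D.toLeft.card * y ^ D.toRight.card := by
    intro D
    rw [prod_sum_eq_prod_toLeft_mul_prod_toRight]
    simp [w]
  let U : Finset (Finset (V ⊕ I)) := univ.filter fun S => K ⊂ S ∧ S.card ≤ r
  let T' : Finset (Σ _ : Finset (V ⊕ I), Finset (V × I)) :=
    U.sigma fun S => (S.toLeft ×ˢ S.toRight).powerset
  have h1 : ∑ q ∈ T, f q ≤ ∑ q ∈ T', c * ∏ z ∈ q.1 \ K, w z := by
    calc _ ≤ ∑ q ∈ T, c * ∏ z ∈ q.1 \ K, w z :=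
          sum_le_sum fun q hq => by rw [hwp]; exact hf q hq
      _ = ∑ q ∈ T.image fun q => (⟨q.1, q.2⟩ : Σ _ : Finset (V ⊕ I), Finset (V × I)),
            c * ∏ z ∈ q.1 \ K, w z := by
          rw [sum_image]
          rintro ⟨a, b⟩ _ ⟨a', b'⟩ _ h
          simpa using h
      _ ≤ _ := by
          refine sum_le_sum_of_subset_of_nonneg ?_ fun q _ _ =>
            mul_nonneg hc (prod_nonneg fun z _ => hw z)
          intro q hq
          rw [mem_image] at hq
          obtain ⟨q, hq, rfl⟩ := hq
          have := hT q hq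
          simp only [T', U, mem_sigma, mem_filter, mem_univ, true_and, mem_powerset]
          exact ⟨⟨this.1, this.2.1⟩, this.2.2⟩
  have h2 : ∑ q ∈ T', c * ∏ z ∈ q.1 \ K, w z ≤ ∑ S ∈ U, (2 : ℝ) ^ (r * r) * (c * ∏ z ∈ S \ K, w z) := by
    rw [sum_sigma]
    refine sum_le_sum fun S hS => ?_
    simp only [U, mem_filter, mem_univ, true_and] at hS
    dsimp only
    rw [sum_const, nsmul_eq_mul, card_powerset, card_product]
    refine mul_le_mul_of_nonneg_right ?_ (mul_nonneg hc (prod_nonneg fun z _ => hw z))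
    push_cast
    refine pow_le_pow_right₀ (by norm_num) ?_
    exact Nat.mul_le_mul (card_toLeft_le.trans hS.2) (card_toRight_le.trans hS.2)
  have h3 : ∑ S ∈ U, ∏ z ∈ S \ K, w z ≤ Real.exp 2 := by
    calc _ = ∑ D ∈ U.image (· \ K), ∏ z ∈ D, w z := by
          rw [sum_image]
          intro S hS S' hS' h
          simp only [U, coe_filter, mem_univ, true_and, Set.mem_ofPred_eq] at hS hS' h
          rw [← sdiff_union_of_subset hS.1.1, ← sdiff_union_of_subset hS'.1.1, h]
      _ ≤ ∑ D ∈ (univ : Finset (V ⊕ I)).powerset, ∏ z ∈ D, w z := by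
          refine sum_le_sum_of_subset_of_nonneg ?_ fun q _ _ => prod_nonneg fun z _ => hw z
          intro D _
          simp
      _ = ∏ z, (1 + w z) := (prod_one_add _).symm
      _ ≤ ∏ z, Real.exp (w z) := by
          refine prod_le_prod (fun z _ => by have := hw z; linarith) fun z _ => ?_
          rw [add_comm]; exact Real.add_one_le_exp _
      _ = Real.exp (∑ z, w z) := (Real.exp_sum _ _).symm
      _ ≤ _ := by
          apply Real.exp_le_exp.2
          rw [Fintype.sum_sum_type]
          simpa [w] using hsum
  calc _ ≤ _ := h1
    _ ≤ _ := h2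
    _ = 2 ^ (r * r) * c * ∑ S ∈ U, ∏ z ∈ S \ K, w z := by
        rw [mul_sum]; refine sum_congr rfl fun _ _ => by ring
    _ ≤ 2 ^ (r * r) * c * Real.exp 2 := mul_le_mul_of_nonneg_left h3 (by positivity)
    _ = _ := by ring

open Classical in
theorem sunflower_prob {V I X : Type*} [Fintype V] [DecidableEq V] [Nonempty V] [Fintype I]
    [DecidableEq I] [Fintype X] [DecidableEq X] (r p : ℕ) (δ β x y c : ℝ)
    (hx : 0 ≤ x) (hy : 0 ≤ y) (hc : 0 ≤ c)
    (hsum : Fintype.card V * x + Fintype.card I * y ≤ 2)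
    (hκ : ∀ v b j : ℕ, 1 ≤ v + b → (v : ℝ) + δ * b ≤ β * j →
      ((Fintype.card X : ℝ) / Fintype.card V) ^ j ≤ c * (x ^ v * y ^ b))
    (K : Finset (V ⊕ I)) :
    ((univ.filter fun ω : I → X → V => (ERedges (ERB ω) K).Nonempty ∧
      ∃ 𝓢 : Finset (Finset (V ⊕ I)), p ≤ 𝓢.card ∧
        (∀ S ∈ 𝓢, K ⊂ S ∧ ERBad r δ β (ERB ω) S) ∧
        (∀ S ∈ 𝓢, ∀ S' ∈ 𝓢, S ≠ S' → S ∩ S' ⊆ K)).card : ℝ) ≤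
      (2 ^ (r * r) * Real.exp 2 * c) ^ p * Fintype.card (I → X → V) := by
  set κ : ℝ := (Fintype.card X : ℝ) / Fintype.card V with hκdef
  have hκ0 : 0 ≤ κ := by positivity
  let T : Finset (Finset (V ⊕ I) × Finset (V × I)) := univ.filter fun q =>
    K ⊂ q.1 ∧ q.1.card ≤ r ∧ q.2 ⊆ q.1.toLeft ×ˢ q.1.toRight ∧
      ((q.1 \ K).toLeft.card : ℝ) + δ * (q.1 \ K).toRight.card ≤ β * q.2.card
  have hTsum : ∑ q ∈ T, κ ^ q.2.card ≤ 2 ^ (r * r) * Real.exp 2 * c := by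
    refine sum_T_bound r x y c hx hy hc hsum K T ?_ _ ?_
    · intro q hq
      simp only [T, mem_filter, mem_univ, true_and] at hq
      exact ⟨hq.1, hq.2.1, hq.2.2.1⟩
    · intro q hq
      simp only [T, mem_filter, mem_univ, true_and] at hq
      refine hκ _ _ _ ?_ hq.2.2.2
      rw [card_toLeft_add_card_toRight, Nat.one_le_iff_ne_zero, Ne, card_eq_zero,
        sdiff_eq_empty_iff_subset]
      exact hq.1.2
  let G : Finset (Fin p → Finset (V ⊕ I) × Finset (V × I)) :=
    (Fintype.piFinset fun _ : Fin p => T).filter fun g =>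
      ∀ j j', j ≠ j' → Disjoint (g j).2 (g j').2
  have hsub : (univ.filter fun ω : I → X → V => (ERedges (ERB ω) K).Nonempty ∧
      ∃ 𝓢 : Finset (Finset (V ⊕ I)), p ≤ 𝓢.card ∧
        (∀ S ∈ 𝓢, K ⊂ S ∧ ERBad r δ β (ERB ω) S) ∧
        (∀ S ∈ 𝓢, ∀ S' ∈ 𝓢, S ≠ S' → S ∩ S' ⊆ K)) ⊆
      G.biUnion fun g => univ.filter fun ω : I → X → V =>
        ∀ q ∈ univ.biUnion (fun j => (g j).2), q.1 ∈ ERB ω q.2 := by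
    intro ω hω
    simp only [mem_filter, mem_univ, true_and] at hω
    obtain ⟨hKe, 𝓢, hp, hS, hdis⟩ := hω
    obtain ⟨f⟩ : Nonempty (Fin p ↪ 𝓢) :=
      Function.Embedding.nonempty_of_card_le (by simpa using hp)
    let JJ : Finset (V ⊕ I) → Finset (V × I) := fun S => ERincs (ERB ω) S \ (K.toLeft ×ˢ K.toRight)
    rw [mem_biUnion]
    refine ⟨fun j => ((f j).1, JJ (f j).1), ?_, ?_⟩
    · simp only [G, mem_filter, Fintype.mem_piFinset, T, mem_univ, true_and]
      refine ⟨fun j => ?_, ?_⟩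
      · have h := hS _ (f j).2
        set S := (f j).1
        refine ⟨h.1, h.2.1, ?_, ?_⟩
        · exact sdiff_subset.trans (filter_subset _ _)
        · have hF := h.2.2.2 K h.1.1 hKe
          have hinc : (ERincs (ERB ω) S).card = (JJ S).card + (ERincs (ERB ω) K).card := by
            have : ERincs (ERB ω) K = ERincs (ERB ω) S ∩ (K.toLeft ×ˢ K.toRight) := by
              ext ⟨u, i⟩
              simp only [ERincs, mem_filter, mem_product, mem_toLeft, mem_toRight, mem_inter]
              have := @h.1.1 (Sum.inl u)
              have := @h.1.1 (Sum.inr i)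
              tauto
            rw [this]
            exact (card_sdiff_add_card_inter _ _).symm
          have hl : (S.toLeft.card : ℝ) = (S \ K).toLeft.card + K.toLeft.card := by
            rw [toLeft_sdiff]
            exact_mod_cast (card_sdiff_add_card_eq_card (toLeft_subset_toLeft h.1.1)).symm
          have hr : (S.toRight.card : ℝ) = (S \ K).toRight.card + K.toRight.card := by
            rw [toRight_sdiff]
            exact_mod_cast (card_sdiff_add_card_eq_card (toRight_subset_toRight h.1.1)).symm
          have hinc' : ((ERincs (ERB ω) S).card : ℝ) = (JJ S).card + (ERincs (ERB ω) K).card := by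
            exact_mod_cast hinc
          unfold ERF at hF
          rw [hl, hr, hinc'] at hF
          linarith
      · intro j j' hjj
        have hne : (f j).1 ≠ (f j').1 := fun h => hjj (f.injective (Subtype.ext h))
        have hd := hdis _ (f j).2 _ (f j').2 hne
        rw [disjoint_left]
        rintro ⟨u, i⟩ h1 h2
        simp only [JJ, ERincs, mem_sdiff, mem_filter, mem_product, mem_toLeft, mem_toRight] at h1 h2
        exact h1.2 ⟨hd (mem_inter.2 ⟨h1.1.1.1, h2.1.1.1⟩), hd (mem_inter.2 ⟨h1.1.1.2, h2.1.1.2⟩)⟩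
    · simp only [mem_filter, mem_univ, true_and, mem_biUnion]
      rintro ⟨u, i⟩ ⟨j, hj⟩
      simp only [JJ, ERincs, mem_sdiff, mem_filter] at hj
      exact hj.1.2
  calc _ ≤ (((G.biUnion fun g => univ.filter fun ω : I → X → V =>
        ∀ q ∈ univ.biUnion (fun j => (g j).2), q.1 ∈ ERB ω q.2).card : ℕ) : ℝ) := by
        exact_mod_cast card_le_card hsub
    _ ≤ ∑ g ∈ G, ((univ.filter fun ω : I → X → V =>
        ∀ q ∈ univ.biUnion (fun j => (g j).2), q.1 ∈ ERB ω q.2).card : ℝ) := by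
        exact_mod_cast card_biUnion_le
    _ ≤ ∑ g ∈ G, (∏ j, κ ^ (g j).2.card) * Fintype.card (I → X → V) := by
        refine sum_le_sum fun g hg => ?_
        simp only [G, mem_filter] at hg
        refine le_trans (le_of_eq ?_) ((card_incs_subset (X := X) (univ.biUnion (fun j => (g j).2))).trans
          (le_of_eq ?_))
        · congr!
        · rw [card_biUnion (fun j _ j' _ h => hg.2 j j' h), prod_pow_eq_pow_sum]
    _ = (∑ g ∈ G, ∏ j, κ ^ (g j).2.card) * Fintype.card (I → X → V) := by rw [sum_mul]
    _ ≤ (∑ g ∈ Fintype.piFinset fun _ : Fin p => T, ∏ j, κ ^ (g j).2.card) *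
          Fintype.card (I → X → V) := by
        refine mul_le_mul_of_nonneg_right ?_ (by positivity)
        exact sum_le_sum_of_subset_of_nonneg (filter_subset _ _)
          fun _ _ _ => prod_nonneg fun _ _ => by positivity
    _ = (∑ q ∈ T, κ ^ q.2.card) ^ p * Fintype.card (I → X → V) := by
        rw [← prod_univ_sum (t := fun _ : Fin p => T) (f := fun _ q => κ ^ q.2.card)]; simp
    _ ≤ _ := by
        refine mul_le_mul_of_nonneg_right ?_ (by positivity)
        exact pow_le_pow_left₀ (sum_nonneg fun _ _ => by positivity) hTsum _

/-- the property needed in phase 2 -/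
def ERP2 {V I : Type*} [DecidableEq V] [DecidableEq I] (r Δ : ℕ) (δ β : ℝ) (B : I → Finset V) :
    Prop :=
  ∀ i e, e.card = 2 → e ⊆ B i → ∃ 𝓑 : Finset (Finset (V ⊕ I)), 𝓑.card ≤ Δ ∧
      ∀ S, ERBad r δ β B S → (i, e) ∈ ERedges B S → S ∈ 𝓑

open Classical in
theorem phase1B {V I X : Type*} [Fintype V] [DecidableEq V] [Nonempty V] [Fintype I]
    [DecidableEq I] [Fintype X] [DecidableEq X] (r p : ℕ) (δ β x y c : ℝ)
    (hx : 0 ≤ x) (hy : 0 ≤ y) (hc : 0 ≤ c)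
    (hsum : Fintype.card V * x + Fintype.card I * y ≤ 2)
    (hκ : ∀ v b j : ℕ, 1 ≤ v + b → (v : ℝ) + δ * b ≤ β * j →
      ((Fintype.card X : ℝ) / Fintype.card V) ^ j ≤ c * (x ^ v * y ^ b)) :
    ((univ.filter fun ω : I → X → V => ¬ ERP2 r ((1 + p * r) ^ r) δ β (ERB ω)).card : ℝ) ≤
      ((r + 1) * (Fintype.card V + Fintype.card I + 1) ^ r) *
      (2 ^ (r * r) * Real.exp 2 * c) ^ p * Fintype.card (I → X → V) := by
  set Ks : Finset (Finset (V ⊕ I)) := univ.filter fun K => K.card ≤ r with hKs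
  have hKcard : (Ks.card : ℝ) ≤ (r + 1) * (Fintype.card V + Fintype.card I + 1) ^ r := by
    have h1 : Ks ⊆ (range (r + 1)).biUnion fun j => powersetCard j univ := by
      intro K hK
      simp only [Ks, mem_filter, mem_univ, true_and] at hK
      simp only [mem_biUnion, mem_range, mem_powersetCard]
      exact ⟨K.card, by omega, subset_univ _, rfl⟩
    have h2 : Ks.card ≤ (r + 1) * (Fintype.card V + Fintype.card I + 1) ^ r := by
      refine (card_le_card h1).trans ?_
      have := card_biUnion_le_card_mul (range (r + 1))
        (fun j => powersetCard j (univ : Finset (V ⊕ I)))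
        ((Fintype.card V + Fintype.card I + 1) ^ r) ?_
      · simpa using this
      · intro j hj
        rw [mem_range] at hj
        rw [card_powersetCard, card_univ, Fintype.card_sum]
        refine (Nat.choose_le_pow _ _).trans ?_
        refine (Nat.pow_le_pow_left (Nat.le_succ _) j).trans ?_
        exact Nat.pow_le_pow_right (by omega) (by omega)
    exact_mod_cast h2
  have hsub : (univ.filter fun ω : I → X → V => ¬ ERP2 r ((1 + p * r) ^ r) δ β (ERB ω)) ⊆
      Ks.biUnion fun K => univ.filter fun ω : I → X → V => (ERedges (ERB ω) K).Nonempty ∧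
      ∃ 𝓢 : Finset (Finset (V ⊕ I)), p ≤ 𝓢.card ∧
        (∀ S ∈ 𝓢, K ⊂ S ∧ ERBad r δ β (ERB ω) S) ∧
        (∀ S ∈ 𝓢, ∀ S' ∈ 𝓢, S ≠ S' → S ∩ S' ⊆ K) := by
    intro ω hω
    simp only [mem_filter, mem_univ, true_and] at hω
    by_contra hc
    apply hω
    intro i e he heB
    set 𝓕 : Finset (Finset (V ⊕ I)) := univ.filter fun S => ERBad r δ β (ERB ω) S with h𝓕
    set K0 : Finset (V ⊕ I) := insert (Sum.inr i) (e.image Sum.inl) with hK0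
    refine ⟨𝓕.filter (K0 ⊆ ·), ?_, ?_⟩
    · refine sunflower_count 𝓕 r p ?_ r K0 (Nat.sub_le _ _) ?_
      · intro S hS
        simp only [h𝓕, mem_filter, mem_univ, true_and] at hS
        exact hS.1
      · intro K hK hKr 𝓢 h𝓢 hKS hdis
        by_contra hp
        apply hc
        simp only [mem_biUnion, hKs, mem_filter, mem_univ, true_and]
        refine ⟨K, hKr, ⟨(i, e), ?_⟩, 𝓢, not_lt.1 hp, fun S hS => ⟨hKS S hS, ?_⟩, hdis⟩
        · rw [mem_ERedges]
          refine ⟨hK (by simp [hK0]), fun v hv => hK (by simp [hK0, hv]), he, heB⟩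
        · have := h𝓢 hS
          simpa [h𝓕] using this
    · intro S hS hie
      rw [mem_ERedges] at hie
      simp only [h𝓕, mem_filter, mem_univ, true_and]
      refine ⟨hS, ?_⟩
      intro z hz
      simp only [hK0, mem_insert, mem_image] at hz
      rcases hz with rfl | ⟨v, hv, rfl⟩
      · exact hie.1
      · exact hie.2.1 v hv
  calc _ ≤ (((Ks.biUnion fun K => univ.filter fun ω : I → X → V => (ERedges (ERB ω) K).Nonempty ∧
      ∃ 𝓢 : Finset (Finset (V ⊕ I)), p ≤ 𝓢.card ∧
        (∀ S ∈ 𝓢, K ⊂ S ∧ ERBad r δ β (ERB ω) S) ∧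
        (∀ S ∈ 𝓢, ∀ S' ∈ 𝓢, S ≠ S' → S ∩ S' ⊆ K)).card : ℕ) : ℝ) := by
        exact_mod_cast card_le_card hsub
    _ ≤ ∑ K ∈ Ks, ((univ.filter fun ω : I → X → V => (ERedges (ERB ω) K).Nonempty ∧
      ∃ 𝓢 : Finset (Finset (V ⊕ I)), p ≤ 𝓢.card ∧
        (∀ S ∈ 𝓢, K ⊂ S ∧ ERBad r δ β (ERB ω) S) ∧
        (∀ S ∈ 𝓢, ∀ S' ∈ 𝓢, S ≠ S' → S ∩ S' ⊆ K)).card : ℝ) := by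
        exact_mod_cast card_biUnion_le
    _ ≤ ∑ K ∈ Ks, (2 ^ (r * r) * Real.exp 2 * c) ^ p * Fintype.card (I → X → V) := by
        refine sum_le_sum fun K _ => ?_
        exact sunflower_prob r p δ β x y c hx hy hc hsum hκ K
    _ = Ks.card * ((2 ^ (r * r) * Real.exp 2 * c) ^ p * Fintype.card (I → X → V)) := by
        rw [sum_const, nsmul_eq_mul]
    _ ≤ _ := by
        rw [mul_assoc ((r + 1 : ℝ) * _)]
        exact mul_le_mul_of_nonneg_right hKcard (by positivity)

end

section
open Finset

theorem exists_parts {V : Type*} [DecidableEq V] (s a' : ℕ) (A : Finset V) (hA : A.card = s * a') :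
    ∃ P : Fin s → Finset V, (∀ g, P g ⊆ A) ∧ (∀ g, (P g).card = a') ∧
      ∀ g g', g ≠ g' → Disjoint (P g) (P g') := by
  have e : Fin s × Fin a' ≃ A := Fintype.equivOfCardEq (by simp [hA])
  refine ⟨fun g => univ.image fun b => (e (g, b)).1, ?_, ?_, ?_⟩
  · intro g v hv
    simp only [mem_image, mem_univ, true_and] at hv
    obtain ⟨b, rfl⟩ := hv
    exact (e (g, b)).2
  · intro g
    rw [card_image_of_injective]
    · simp
    · intro b b' h
      have := e.injective (Subtype.ext h)
      simpa using this
  · intro g g' hne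
    rw [disjoint_left]
    intro v hv hv'
    simp only [mem_image, mem_univ, true_and] at hv hv'
    obtain ⟨b, rfl⟩ := hv
    obtain ⟨b', h⟩ := hv'
    have := e.injective (Subtype.ext h)
    simp only [Prod.mk.injEq] at this
    exact hne this.1.symm

theorem hit_lower {V : Type*} [Fintype V] [DecidableEq V] [Nonempty V] (s k' a' : ℕ)
    (A : Finset V) (hA : A.card = s * a')
    (hn : (2 : ℝ) * (s * a') * (s * k') ≤ Fintype.card V) :
    1 / 2 * ((k' : ℝ) * a' / Fintype.card V) ^ s * Fintype.card (Fin s × Fin k' → V) ≤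
      ((univ.filter fun φ : Fin s × Fin k' → V => s ≤ (A ∩ univ.image φ).card).card : ℝ) := by
  obtain ⟨P, hPA, hPc, hPd⟩ := exists_parts s a' A hA
  set n : ℝ := ((Fintype.card V : ℕ) : ℝ) with hnd
  have hn0 : 0 < n := by rw [hnd]; exact_mod_cast Fintype.card_pos
  let W : (Fin s → Fin k') → Fin s × Fin k' → Finset V := fun h x =>
    if x.2 = h x.1 then P x.1 else Aᶜ
  let E : (Fin s → Fin k') → Finset (Fin s × Fin k' → V) := fun h => Fintype.piFinset (W h)
  have hAn : (A.card : ℝ) ≤ n := by rw [hnd]; exact_mod_cast card_le_univ A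
  have hsub : (univ.biUnion E) ⊆
      univ.filter fun φ : Fin s × Fin k' → V => s ≤ (A ∩ univ.image φ).card := by
    intro φ hφ
    simp only [mem_biUnion, mem_univ, true_and, E, Fintype.mem_piFinset, W] at hφ
    obtain ⟨h, hφ⟩ := hφ
    have hφ' : ∀ g, φ (g, h g) ∈ P g := fun g => by simpa using hφ (g, h g)
    simp only [mem_filter, mem_univ, true_and]
    have hinj : Function.Injective fun g => φ (g, h g) := by
      intro g g' hg
      by_contra hne
      have h1 := hφ' g
      have h2 := hφ' g'
      have hg' : φ (g, h g) = φ (g', h g') := hg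
      rw [hg'] at h1
      exact disjoint_left.1 (hPd g g' hne) h1 h2
    have : s = (univ.image fun g => φ (g, h g)).card := by
      rw [card_image_of_injective _ hinj]; simp
    refine this.le.trans (card_le_card ?_)
    intro v hv
    simp only [mem_image, mem_univ, true_and] at hv
    obtain ⟨g, rfl⟩ := hv
    exact mem_inter.2 ⟨hPA g (hφ' g), mem_image_of_mem _ (mem_univ _)⟩
  have hdisj : ∀ h ∈ (univ : Finset (Fin s → Fin k')), ∀ h' ∈ (univ : Finset (Fin s → Fin k')),
      h ≠ h' → Disjoint (E h) (E h') := by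
    intro h _ h' _ hne
    rw [disjoint_left]
    intro φ h1 h2
    simp only [E, Fintype.mem_piFinset, W] at h1 h2
    apply hne
    ext g : 1
    by_contra hg
    have e1 := h1 (g, h g)
    have e2 := h2 (g, h g)
    simp only [if_true, hg, if_false, mem_compl] at e1 e2
    exact e2 (hPA g e1)
  have hE : ∀ h, 1 / 2 * ((a' : ℝ) / n) ^ s * Fintype.card (Fin s × Fin k' → V) ≤ ((E h).card : ℝ) := by
    intro h
    have h1 : ((E h).card : ℝ) = (∏ x, ((W h x).card : ℝ) / n) * Fintype.card (Fin s × Fin k' → V) := by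
      simp only [E]
      rw [Fintype.card_piFinset, Fintype.card_fun, prod_div_distrib, prod_const, card_univ]
      push_cast
      rw [← hnd]
      exact (div_mul_cancel₀ _ (pow_ne_zero _ hn0.ne')).symm
    rw [h1]
    refine mul_le_mul_of_nonneg_right ?_ (by positivity)
    have hx0 : 0 ≤ 1 - (A.card : ℝ) / n := by
      rw [sub_nonneg, div_le_one hn0]; exact hAn
    have h2 : ∏ x : Fin s × Fin k', ((if x.2 = h x.1 then (a' : ℝ) / n else 1) * (1 - (A.card : ℝ) / n)) ≤
        ∏ x, ((W h x).card : ℝ) / n := by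
      refine prod_le_prod (fun x _ => ?_) fun x _ => ?_
      · refine mul_nonneg ?_ hx0
        split_ifs <;> positivity
      · simp only [W]
        split_ifs
        · rw [hPc]
          refine mul_le_of_le_one_right (by positivity) ?_
          have : 0 ≤ (A.card : ℝ) / n := by positivity
          linarith
        · rw [card_compl, Nat.cast_sub (card_le_univ A), ← hnd, sub_div, div_self hn0.ne', one_mul]
    refine le_trans ?_ h2
    rw [prod_mul_distrib, Fintype.prod_prod_type]
    have h3 : ∀ g : Fin s, ∏ j : Fin k', (if j = h g then (a' : ℝ) / n else 1) = a' / n := by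
      intro g; simp
    simp only [h3]
    rw [prod_const, prod_const, card_univ, card_univ, Fintype.card_prod, Fintype.card_fin, Fintype.card_fin,
      mul_comm]
    refine mul_le_mul_of_nonneg_left ?_ (by positivity)
    have hb := one_add_mul_le_pow (a := -((A.card : ℝ) / n)) (by linarith) (s * k')
    rw [← sub_eq_add_neg] at hb
    refine le_trans ?_ hb
    rw [hA]
    push_cast
    have : (s * k' : ℝ) * ((s * a') / n) ≤ 1 / 2 := by
      rw [mul_div_assoc', div_le_iff₀ hn0]; linarith
    linarith
  calc _ = ∑ h : Fin s → Fin k', 1 / 2 * ((a' : ℝ) / n) ^ s * Fintype.card (Fin s × Fin k' → V) := by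
        rw [sum_const, nsmul_eq_mul, card_univ, Fintype.card_fun (α := Fin s) (β := Fin k'), Fintype.card_fin, Fintype.card_fin]
        push_cast
        rw [mul_div_assoc, mul_pow]; ring
    _ ≤ ∑ h, ((E h).card : ℝ) := sum_le_sum fun h _ => hE h
    _ = ((univ.biUnion E).card : ℝ) := by rw [card_biUnion hdisj]; push_cast; rfl
    _ ≤ _ := by exact_mod_cast card_le_card hsub

/-- lower tail -/
theorem lower_tail {I Y : Type*} [Fintype I] [DecidableEq I] [Fintype Y] [Nonempty Y]
    (E : Y → Prop) [DecidablePred E] (q : ℝ)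
    (hE : q * Fintype.card Y ≤ ((univ.filter E).card : ℝ)) :
    ((univ.filter fun ω : I → Y => ((univ.filter fun i => E (ω i)).card : ℝ) ≤
      q * Fintype.card I / 4).card : ℝ) ≤
      Real.exp (-(q * Fintype.card I / 4)) * Fintype.card (I → Y) := by
  classical
  set m : ℝ := ((Fintype.card I : ℕ) : ℝ) with hm
  have hY : (0 : ℝ) < Fintype.card Y := by exact_mod_cast Fintype.card_pos
  let g : Y → ℝ := fun y => if E y then 1 / 2 else 1
  have h1 : ∑ y, g y ≤ Real.exp (-(q / 2)) * Fintype.card Y := by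
    have : ∑ y, g y = Fintype.card Y - (1 / 2) * (univ.filter E).card := by
      have : ∀ y, g y = 1 - 1 / 2 * (if E y then 1 else 0) := by
        intro y; simp only [g]; split_ifs <;> norm_num
      simp_rw [this]
      rw [sum_sub_distrib, ← mul_sum, sum_boole]
      simp
    rw [this]
    have h2 := Real.add_one_le_exp (-(q / 2))
    nlinarith
  have h2 : ∑ ω : I → Y, ∏ i, g (ω i) ≤ Real.exp (-(q * m / 2)) * Fintype.card (I → Y) := by
    rw [sum_prod_pi (fun _ => g), prod_const, card_univ]
    refine (pow_le_pow_left₀ (sum_nonneg fun y _ => by simp only [g]; split_ifs <;> norm_num) h1 _).trans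
      (le_of_eq ?_)
    rw [mul_pow, ← Real.exp_nat_mul, Fintype.card_fun]
    push_cast
    rw [← hm]
    congr 2; ring
  have h3 : ((univ.filter fun ω : I → Y => ((univ.filter fun i => E (ω i)).card : ℝ) ≤
      q * m / 4).card : ℝ) * Real.exp (-(q * m / 4)) ≤ ∑ ω : I → Y, ∏ i, g (ω i) := by
    rw [← nsmul_eq_mul, ← sum_const]
    refine (sum_le_sum (f := fun _ => Real.exp (-(q * m / 4))) (g := fun ω : I → Y => ∏ i, g (ω i)) ?_).trans
      (sum_le_sum_of_subset_of_nonneg (subset_univ _) fun ω _ _ => prod_nonneg fun i _ => by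
        simp only [g]; split_ifs <;> norm_num)
    intro ω hω
    simp only [mem_filter, mem_univ, true_and] at hω
    have : ∏ i, g (ω i) = (1 / 2) ^ (univ.filter fun i => E (ω i)).card := by
      simp only [g]
      rw [prod_ite]; simp
    rw [this]
    have h4 : Real.exp (-1) ≤ 1 / 2 := by
      have := Real.exp_one_gt_d9
      rw [Real.exp_neg, one_div]
      exact inv_anti₀ (by norm_num) (by linarith)
    calc Real.exp (-(q * m / 4)) ≤ Real.exp (-((univ.filter fun i => E (ω i)).card : ℝ)) :=
          Real.exp_le_exp.2 (by linarith)
      _ = Real.exp (-1) ^ (univ.filter fun i => E (ω i)).card := by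
          rw [← Real.exp_nat_mul]; congr 1; ring
      _ ≤ _ := pow_le_pow_left₀ (Real.exp_pos _).le h4 _
  have h5 := h3.trans h2
  have h6 : Real.exp (-(q * m / 2)) = Real.exp (-(q * m / 4)) * Real.exp (-(q * m / 4)) := by
    rw [← Real.exp_add]; congr 1; ring
  rw [h6] at h5
  have := Real.exp_pos (-(q * m / 4))
  nlinarith

end

section
open Finset

theorem choose_two_pow (M : ℕ) : ((M.choose 2 : ℕ) : ℝ) * 2 ^ M ≤ 8 ^ M - 1 - 7 * M := by
  have h0 : ∀ M : ℕ, (M : ℝ) * M ≤ 4 ^ M := by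
    intro M
    have h : (M : ℝ) ≤ 2 ^ M := by exact_mod_cast (Nat.lt_two_pow_self (n := M)).le
    calc (M : ℝ) * M ≤ 2 ^ M * 2 ^ M := by gcongr
      _ = 4 ^ M := by rw [← mul_pow]; norm_num
  rcases Nat.lt_or_ge M 2 with h | h
  · interval_cases M <;> norm_num
  · have h1 : ((M.choose 2 : ℕ) : ℝ) ≤ M * M / 2 := by
      rw [Nat.cast_choose_two]
      have : (0 : ℝ) ≤ M := by positivity
      nlinarith
    have h2 : (M : ℝ) * M / 2 * 2 ^ M ≤ 8 ^ M / 2 := by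
      have : (8 : ℝ) ^ M = 4 ^ M * 2 ^ M := by rw [← mul_pow]; norm_num
      rw [this]
      have := h0 M
      have h3 : (0 : ℝ) < 2 ^ M := by positivity
      nlinarith
    have h4 : (1 : ℝ) + 7 * M ≤ 8 ^ M / 2 := by
      have : ∀ j : ℕ, (1 : ℝ) + 7 * (j + 2 : ℕ) ≤ 8 ^ (j + 2) / 2 := by
        intro j
        induction j with
        | zero => norm_num
        | succ j ih =>
          push_cast at ih ⊢
          have : (0 : ℝ) ≤ j := by positivity
          rw [show j + 1 + 2 = (j + 2) + 1 by ring, pow_succ (8 : ℝ)]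
          linarith
      obtain ⟨j, rfl⟩ := Nat.exists_eq_add_of_le' h
      exact this j
    calc _ ≤ (M : ℝ) * M / 2 * 2 ^ M := by gcongr
      _ ≤ _ := by linarith

theorem pair_mgf {V X : Type*} [Fintype V] [DecidableEq V] [Nonempty V] [Fintype X] [DecidableEq X]
    [Nonempty X] (A : Finset V)
    (hu : 7 * (Fintype.card X * A.card / Fintype.card V : ℝ) ≤ 1) :
    ∑ φ : X → V, Real.exp (((A ∩ univ.image φ).card.choose 2 : ℕ) / Fintype.card X) ≤
      (1 + (7 * (Fintype.card X * A.card / Fintype.card V : ℝ)) ^ 2 / Fintype.card X) *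
        Fintype.card (X → V) := by
  set k : ℝ := ((Fintype.card X : ℕ) : ℝ) with hk
  set n : ℝ := ((Fintype.card V : ℕ) : ℝ) with hn
  set a : ℝ := ((A.card : ℕ) : ℝ) with ha
  have hk0 : 0 < k := by rw [hk]; exact_mod_cast Fintype.card_pos
  have hn0 : 0 < n := by rw [hn]; exact_mod_cast Fintype.card_pos
  have ha0 : 0 ≤ a := by positivity
  let M : (X → V) → ℕ := fun φ => (univ.filter fun x => φ x ∈ A).card
  have hNM : ∀ φ : X → V, (A ∩ univ.image φ).card ≤ M φ := by
    intro φ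
    have : A ∩ univ.image φ ⊆ (univ.filter fun x => φ x ∈ A).image φ := by
      intro v hv
      simp only [mem_inter, mem_image, mem_univ, true_and] at hv
      obtain ⟨hv, x, rfl⟩ := hv
      exact mem_image_of_mem _ (by simpa using hv)
    exact (card_le_card this).trans card_image_le
  have hMk : ∀ φ : X → V, M φ ≤ Fintype.card X := fun φ => card_le_univ _
  have h1 : ∀ φ : X → V, Real.exp (((A ∩ univ.image φ).card.choose 2 : ℕ) / k) ≤
      1 + (1 / k) * (8 ^ M φ - 1 - 7 * M φ) := by
    intro φ
    set z : ℝ := ((A ∩ univ.image φ).card.choose 2 : ℕ) / k with hz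
    have hcc : (((A ∩ univ.image φ).card.choose 2 : ℕ) : ℝ) ≤ ((M φ).choose 2 : ℕ) := by
      exact_mod_cast Nat.choose_le_choose 2 (hNM φ)
    have hz1 : z ≤ (1 / k) * ((M φ).choose 2 : ℕ) := by
      rw [hz, one_div_mul_eq_div]; gcongr
    have hz2 : z ≤ M φ / 2 := by
      refine hz1.trans ?_
      rw [one_div_mul_eq_div, div_le_iff₀ hk0, Nat.cast_choose_two]
      have h1 : (M φ : ℝ) ≤ k := by rw [hk]; exact_mod_cast hMk φ
      have h2 : (0 : ℝ) ≤ M φ := by positivity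
      nlinarith
    have hz0 : 0 ≤ z := by positivity
    have he : Real.exp z ≤ 2 ^ M φ := by
      calc Real.exp z ≤ Real.exp (M φ / 2) := Real.exp_le_exp.2 hz2
        _ = Real.exp (1 / 2) ^ M φ := by rw [← Real.exp_nat_mul]; congr 1; ring
        _ ≤ 2 ^ M φ := by
          refine pow_le_pow_left₀ (Real.exp_pos _).le ?_ _
          have h1 : Real.exp (1 / 2) * Real.exp (1 / 2) = Real.exp 1 := by
            rw [← Real.exp_add]; norm_num
          have h2 := Real.exp_one_lt_d9
          have h3 := Real.exp_pos (1 / 2)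
          nlinarith
    have h5 : Real.exp z ≤ 1 + z * Real.exp z := by
      have h6 := Real.add_one_le_exp (-z)
      have h7 : Real.exp (-z) * Real.exp z = 1 := by rw [← Real.exp_add]; simp
      have h8 := Real.exp_pos z
      nlinarith
    have h9 := choose_two_pow (M φ)
    calc Real.exp z ≤ 1 + z * Real.exp z := h5
      _ ≤ 1 + ((1 / k) * ((M φ).choose 2 : ℕ)) * 2 ^ M φ := by gcongr
      _ = 1 + (1 / k) * (((M φ).choose 2 : ℕ) * 2 ^ M φ) := by ring
      _ ≤ _ := by gcongr
  have h8 : ∑ φ : X → V, (8 : ℝ) ^ M φ ≤ Real.exp (7 * (k * a / n)) * Fintype.card (X → V) := by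
    have : ∀ φ : X → V, (8 : ℝ) ^ M φ = ∏ x, (if φ x ∈ A then (8 : ℝ) else 1) := by
      intro φ
      rw [prod_ite]; simp [M]
    simp_rw [this]
    rw [sum_prod_pi (fun (_ : X) (v : V) => if v ∈ A then (8 : ℝ) else 1), prod_const, card_univ]
    have h2 : ∑ v : V, (if v ∈ A then (8 : ℝ) else 1) = n * (1 + 7 * (a / n)) := by
      have : ∀ v : V, (if v ∈ A then (8 : ℝ) else 1) = 1 + 7 * (if v ∈ A then 1 else 0) := by
        intro v; split_ifs <;> norm_num
      simp_rw [this]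
      rw [sum_add_distrib, ← mul_sum, sum_boole]
      simp only [sum_const, card_univ, nsmul_eq_mul, mul_one, filter_mem_eq_inter, univ_inter]
      rw [← hn, ← ha]; field_simp
    rw [h2, mul_pow, Fintype.card_fun, mul_comm]
    push_cast
    rw [← hn]
    refine mul_le_mul_of_nonneg_right ?_ (by positivity)
    have h3 := Real.add_one_le_exp (7 * (a / n))
    calc (1 + 7 * (a / n)) ^ Fintype.card X ≤ Real.exp (7 * (a / n)) ^ Fintype.card X :=
          pow_le_pow_left₀ (by positivity) (by linarith) _
      _ = _ := by rw [← Real.exp_nat_mul, ← hk]; congr 1; ring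
  have hM : ∑ φ : X → V, (M φ : ℝ) = k * a / n * Fintype.card (X → V) := by
    have h1 : ∀ φ : X → V, (M φ : ℝ) = ∑ x, (if φ x ∈ A then (1 : ℝ) else 0) := by
      intro φ; rw [sum_boole]
    simp_rw [h1]
    rw [sum_comm]
    have h2 : ∀ x : X, ∑ φ : X → V, (if φ x ∈ A then (1 : ℝ) else 0) = a / n * Fintype.card (X → V) := by
      intro x
      have := box_prob (X := X) {x} (fun _ => A)
      simp only [mem_singleton, forall_eq, prod_singleton] at this
      rw [sum_boole, this]
    simp_rw [h2]
    rw [sum_const, card_univ, nsmul_eq_mul, ← hk]; ring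
  have hfin := Real.abs_exp_sub_one_sub_id_le (x := 7 * (k * a / n)) (by
    rw [abs_of_nonneg (by positivity)]; exact hu)
  have hfin2 := (abs_le.1 hfin).2
  have hC : (0 : ℝ) < Fintype.card (X → V) := by exact_mod_cast Fintype.card_pos
  calc _ ≤ ∑ φ : X → V, (1 + (1 / k) * (8 ^ M φ - 1 - 7 * M φ)) := sum_le_sum fun φ _ => h1 φ
    _ = Fintype.card (X → V) + (1 / k) * (∑ φ : X → V, (8 : ℝ) ^ M φ - Fintype.card (X → V)
          - 7 * ∑ φ : X → V, (M φ : ℝ)) := by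
        rw [sum_add_distrib, ← mul_sum, sum_sub_distrib, sum_sub_distrib, ← mul_sum]; simp
    _ ≤ Fintype.card (X → V) + (1 / k) * (Real.exp (7 * (k * a / n)) * Fintype.card (X → V) -
          Fintype.card (X → V) - 7 * (k * a / n * Fintype.card (X → V))) := by
        rw [hM]; gcongr
    _ = Fintype.card (X → V) + (1 / k) * ((Real.exp (7 * (k * a / n)) - 1 - 7 * (k * a / n)) *
          Fintype.card (X → V)) := by ring
    _ ≤ Fintype.card (X → V) + (1 / k) * ((7 * (k * a / n)) ^ 2 * Fintype.card (X → V)) := by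
        gcongr
    _ = _ := by ring

theorem pair_tail {V I X : Type*} [Fintype V] [DecidableEq V] [Nonempty V] [Fintype X] [DecidableEq X]
    [Nonempty X] [Fintype I] [DecidableEq I] (A : Finset V)
    (hu : 7 * (Fintype.card X * A.card / Fintype.card V : ℝ) ≤ 1) (T : ℝ)
    (hT : 2 * (Fintype.card I * (7 * (Fintype.card X * A.card / Fintype.card V : ℝ)) ^ 2) ≤ T) :
    ((univ.filter fun ω : I → X → V =>
      T ≤ ∑ i, (((A ∩ ERB ω i).card.choose 2 : ℕ) : ℝ)).card : ℝ) ≤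
      Real.exp (-(T / (2 * Fintype.card X))) * Fintype.card (I → X → V) := by
  classical
  have hk0 : (0 : ℝ) < Fintype.card X := by exact_mod_cast Fintype.card_pos
  set k : ℝ := ((Fintype.card X : ℕ) : ℝ) with hk
  set u : ℝ := 7 * (k * A.card / Fintype.card V : ℝ) with hud
  set m : ℝ := ((Fintype.card I : ℕ) : ℝ) with hm
  have h1 := pair_mgf (X := X) A hu
  rw [← hk, ← hud] at h1
  have h2 : ∑ ω : I → X → V, ∏ i, Real.exp (((A ∩ univ.image (ω i)).card.choose 2 : ℕ) / k) ≤
      Real.exp (m * u ^ 2 / k) * Fintype.card (I → X → V) := by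
    rw [sum_prod_pi (fun (_ : I) (φ : X → V) => Real.exp (((A ∩ univ.image φ).card.choose 2 : ℕ) / k)),
      prod_const, card_univ]
    refine (pow_le_pow_left₀ (sum_nonneg fun y _ => (Real.exp_pos _).le) h1 _).trans ?_
    rw [mul_pow, Fintype.card_fun (α := I)]
    push_cast
    refine mul_le_mul_of_nonneg_right ?_ (by positivity)
    have h3 := Real.add_one_le_exp (u ^ 2 / k)
    calc (1 + u ^ 2 / k) ^ Fintype.card I ≤ Real.exp (u ^ 2 / k) ^ Fintype.card I :=
          pow_le_pow_left₀ (by positivity) (by linarith) _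
      _ = _ := by rw [← Real.exp_nat_mul, ← hm]; congr 1; ring
  have h3 : ((univ.filter fun ω : I → X → V =>
      T ≤ ∑ i, (((A ∩ ERB ω i).card.choose 2 : ℕ) : ℝ)).card : ℝ) * Real.exp (T / k) ≤
      ∑ ω : I → X → V, ∏ i, Real.exp (((A ∩ univ.image (ω i)).card.choose 2 : ℕ) / k) := by
    rw [← nsmul_eq_mul, ← sum_const]
    refine (sum_le_sum (f := fun _ => Real.exp (T / k)) (g := fun ω : I → X → V =>
      ∏ i, Real.exp (((A ∩ univ.image (ω i)).card.choose 2 : ℕ) / k)) ?_).trans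
      (sum_le_sum_of_subset_of_nonneg (subset_univ _) fun ω _ _ => prod_nonneg fun i _ =>
        (Real.exp_pos _).le)
    intro ω hω
    have hω' := (mem_filter.1 hω).2
    rw [← Real.exp_sum, ← sum_div]
    apply Real.exp_le_exp.2
    exact div_le_div_of_nonneg_right hω' hk0.le
  have h5 := h3.trans h2
  have h6 : Real.exp (m * u ^ 2 / k) ≤ Real.exp (-(T / (2 * k))) * Real.exp (T / k) := by
    rw [← Real.exp_add]
    apply Real.exp_le_exp.2
    have : -(T / (2 * k)) + T / k = T / 2 / k := by field_simp; ring
    rw [this]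
    gcongr
    linarith
  have h7 := Real.exp_pos (T / k)
  have h8 : (0 : ℝ) ≤ Fintype.card (I → X → V) := by positivity
  have h9 := h5.trans (mul_le_mul_of_nonneg_right h6 h8)
  rw [mul_right_comm] at h9
  exact le_of_mul_le_mul_right h9 h7

end

section
open Finset

theorem card_hit_pair {V X : Type*} [Fintype V] [DecidableEq V] [Nonempty V] [Fintype X] [DecidableEq X]
    (s : ℕ) (hs : 2 ≤ s) (A : Finset V) (𝓒 : Finset (Finset V))
    (h𝓒 : ∀ e ∈ 𝓒, e.card = 2 ∧ e ⊆ A) :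
    ((univ.filter fun φ : X → V => s ≤ (A ∩ univ.image φ).card ∧ ∃ e ∈ 𝓒, e ⊆ univ.image φ).card : ℝ) ≤
      𝓒.card * (A.card : ℝ) ^ (s - 2) * ((Fintype.card X : ℝ) / Fintype.card V) ^ s *
        Fintype.card (X → V) := by
  classical
  let Q := (𝓒 ×ˢ powersetCard (s - 2) A).filter fun q => (q.1 ∪ q.2).card = s
  have hsub : (univ.filter fun φ : X → V => s ≤ (A ∩ univ.image φ).card ∧
      ∃ e ∈ 𝓒, e ⊆ univ.image φ) ⊆
      Q.biUnion fun q => univ.filter fun φ : X → V => q.1 ∪ q.2 ⊆ univ.image φ := by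
    intro φ hφ
    obtain ⟨hN, e, he, heφ⟩ := (mem_filter.1 hφ).2
    obtain ⟨S, heS, hSA, hSc⟩ := exists_subsuperset_card_eq
      (subset_inter (h𝓒 e he).2 heφ) (by rw [(h𝓒 e he).1]; exact hs) hN
    have hu : e ∪ (S \ e) = S := union_sdiff_of_subset heS
    refine mem_biUnion.2 ⟨(e, S \ e), ?_, ?_⟩
    · refine mem_filter.2 ⟨mem_product.2 ⟨he, mem_powersetCard.2 ⟨?_, ?_⟩⟩, ?_⟩
      · exact sdiff_subset.trans (hSA.trans inter_subset_left)
      · rw [card_sdiff_of_subset heS, hSc, (h𝓒 e he).1]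
      · simp only [hu, hSc]
    · refine mem_filter.2 ⟨mem_univ _, ?_⟩
      simp only [hu]
      exact hSA.trans inter_subset_right
  have hQ : (Q.card : ℝ) ≤ 𝓒.card * (A.card : ℝ) ^ (s - 2) := by
    have : Q.card ≤ 𝓒.card * A.card ^ (s - 2) := by
      refine (card_filter_le _ _).trans ?_
      rw [card_product, card_powersetCard]
      exact Nat.mul_le_mul_left _ (Nat.choose_le_pow _ _)
    exact_mod_cast this
  calc _ ≤ (((Q.biUnion fun q => univ.filter fun φ : X → V => q.1 ∪ q.2 ⊆ univ.image φ).card : ℕ) : ℝ) := by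
        exact_mod_cast card_le_card hsub
    _ ≤ ∑ q ∈ Q, ((univ.filter fun φ : X → V => q.1 ∪ q.2 ⊆ univ.image φ).card : ℝ) := by
        exact_mod_cast card_biUnion_le
    _ ≤ ∑ q ∈ Q, ((Fintype.card X : ℝ) / Fintype.card V) ^ s * Fintype.card (X → V) := by
        refine sum_le_sum fun q hq => ?_
        have := card_image_superset (X := X) (q.1 ∪ q.2)
        rwa [(mem_filter.1 hq).2] at this
    _ = Q.card * (((Fintype.card X : ℝ) / Fintype.card V) ^ s * Fintype.card (X → V)) := by
        rw [sum_const, nsmul_eq_mul]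
    _ ≤ 𝓒.card * (A.card : ℝ) ^ (s - 2) * (((Fintype.card X : ℝ) / Fintype.card V) ^ s *
          Fintype.card (X → V)) := mul_le_mul_of_nonneg_right hQ (by positivity)
    _ = _ := by ring

/-- pairs of `A` covered by earlier blocks -/
def ERpast {V I X : Type*} [DecidableEq V] [Fintype X] [Fintype I] [LinearOrder I]
    (A : Finset V) (ω : I → X → V) (i : I) : Finset (Finset V) :=
  (univ.filter (· < i)).biUnion fun j => powersetCard 2 (A ∩ ERB ω j)

/-- a block repeating a pair of an earlier block -/
def ERfwd {V I X : Type*} [DecidableEq V] [Fintype X] [Fintype I] [LinearOrder I]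
    (s : ℕ) (T : ℝ) (A : Finset V) (ω : I → X → V) (i : I) : Prop :=
  s ≤ (A ∩ ERB ω i).card ∧ ((ERpast A ω i).card : ℝ) ≤ T ∧ ∃ e ∈ ERpast A ω i, e ⊆ ERB ω i

open Classical in
theorem fwd_tail {V I X : Type*} [Fintype V] [DecidableEq V] [Nonempty V] [Fintype X] [DecidableEq X]
    [Fintype I] [LinearOrder I] (s : ℕ) (hs : 2 ≤ s) (T q : ℝ) (A : Finset V)
    (hq : Real.exp 2 * (T * (A.card : ℝ) ^ (s - 2) * ((Fintype.card X : ℝ) / Fintype.card V) ^ s) ≤ q / 16) :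
    ((univ.filter fun ω : I → X → V => q * Fintype.card I / 16 ≤
        ((univ.filter fun i => ERfwd s T A ω i).card : ℝ)).card : ℝ) ≤
      Real.exp (-(q * Fintype.card I / 16)) * Fintype.card (I → X → V) := by
  set m : ℝ := ((Fintype.card I : ℕ) : ℝ) with hm
  set pb : ℝ := T * (A.card : ℝ) ^ (s - 2) * ((Fintype.card X : ℝ) / Fintype.card V) ^ s with hpb
  let w : I → (I → X → V) → ℝ := fun i ω => if ERfwd s T A ω i then Real.exp 2 else 1
  have he2 : 1 ≤ Real.exp 2 := Real.one_le_exp (by norm_num)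
  have hw1 : ∀ i ω, 1 ≤ w i ω := by
    intro i ω; simp only [w]; split_ifs
    · exact he2
    · exact le_rfl
  by_cases hT : 0 ≤ T
  swap
  · -- no bad blocks at all
    have hno : ∀ (ω : I → X → V) i, ¬ ERfwd s T A ω i := by
      rintro ω i ⟨_, h, _⟩
      exact hT (le_trans (by positivity) h)
    by_cases hqm : q * m / 16 ≤ 0
    · refine le_trans (b := (1 : ℝ) * Fintype.card (I → X → V)) ?_ ?_
      · rw [one_mul]; exact_mod_cast card_le_univ _
      · refine mul_le_mul_of_nonneg_right (Real.one_le_exp (by linarith)) (by positivity)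
    · rw [filter_eq_empty_iff.2]
      · simp; positivity
      · intro ω _
        simp only [hno]
        simpa using hqm
  have hpb0 : 0 ≤ pb := by positivity
  have hpast : ∀ i (ω ω' : I → X → V), (∀ j < i, ω j = ω' j) → ERpast A ω i = ERpast A ω' i := by
    intro i ω ω' h
    unfold ERpast
    refine biUnion_congr rfl fun j hj => ?_
    have := h j (by simpa using hj)
    simp only [ERB, this]
  have had := adaptive w (fun _ => 1 + Real.exp 2 * pb) (fun i ω => zero_le_one.trans (hw1 i ω)) (by
      intro i ω ω' h
      have h1 := hpast i ω ω' fun j hj => h j hj.le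
      have h2 : ERB ω i = ERB ω' i := by simp only [ERB, h i le_rfl]
      have h3 : ERfwd s T A ω i ↔ ERfwd s T A ω' i := by unfold ERfwd; rw [h1, h2]
      simp only [w, h3]) (by
      intro i ω
      set 𝓒 := ERpast A ω i with h𝓒
      have h1 : ∀ φ : X → V, ERpast A (Function.update ω i φ) i = 𝓒 := by
        intro φ
        refine hpast i _ _ fun j hj => ?_
        rw [Function.update_of_ne hj.ne]
      have h2 : ∀ φ : X → V, ERB (Function.update ω i φ) i = univ.image φ := by
        intro φ; simp [ERB]
      have h3 : ∀ φ : X → V, w i (Function.update ω i φ) ≤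
          1 + Real.exp 2 * (if (𝓒.card : ℝ) ≤ T ∧ s ≤ (A ∩ univ.image φ).card ∧
            ∃ e ∈ 𝓒, e ⊆ univ.image φ then 1 else 0) := by
        intro φ
        simp only [w, ERfwd, h1, h2]
        by_cases h : s ≤ (A ∩ univ.image φ).card ∧ (𝓒.card : ℝ) ≤ T ∧ ∃ e ∈ 𝓒, e ⊆ univ.image φ
        · rw [if_pos h, if_pos ⟨h.2.1, h.1, h.2.2⟩]; linarith
        · rw [if_neg h, if_neg (fun h' => h ⟨h'.2.1, h'.1, h'.2.2⟩)]; linarith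
      refine (sum_le_sum fun φ _ => h3 φ).trans ?_
      rw [sum_add_distrib, ← mul_sum, sum_boole, sum_const, card_univ, nsmul_eq_mul, mul_one, add_mul,
        one_mul, mul_assoc]
      refine add_le_add le_rfl (mul_le_mul_of_nonneg_left ?_ (by positivity))
      by_cases hc : (𝓒.card : ℝ) ≤ T
      · simp only [hc, true_and]
        refine (card_hit_pair (X := X) s hs A 𝓒 ?_).trans ?_
        · intro e he
          simp only [h𝓒, ERpast, mem_biUnion, mem_powersetCard] at he
          obtain ⟨j, _, he⟩ := he
          exact ⟨he.2, he.1.trans inter_subset_left⟩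
        · rw [hpb]; gcongr
      · simp only [hc, false_and, filter_false, card_empty, Nat.cast_zero]
        positivity) univ
  have h2 : ∑ ω : I → X → V, ∏ i, w i ω ≤ Real.exp (q * m / 16) * Fintype.card (I → X → V) := by
    refine had.trans ?_
    refine mul_le_mul_of_nonneg_right ?_ (by positivity)
    rw [prod_const, card_univ]
    have h3 := Real.add_one_le_exp (Real.exp 2 * pb)
    calc (1 + Real.exp 2 * pb) ^ Fintype.card I ≤ Real.exp (Real.exp 2 * pb) ^ Fintype.card I :=
          pow_le_pow_left₀ (by positivity) (by linarith) _
      _ = Real.exp (m * (Real.exp 2 * pb)) := by rw [← Real.exp_nat_mul]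
      _ ≤ _ := by
          apply Real.exp_le_exp.2
          have : 0 ≤ m := by positivity
          nlinarith
  have h3 : ((univ.filter fun ω : I → X → V => q * m / 16 ≤
        ((univ.filter fun i => ERfwd s T A ω i).card : ℝ)).card : ℝ) * Real.exp (2 * (q * m / 16)) ≤
      ∑ ω : I → X → V, ∏ i, w i ω := by
    rw [← nsmul_eq_mul, ← sum_const]
    refine (sum_le_sum (f := fun _ => Real.exp (2 * (q * m / 16)))
      (g := fun ω : I → X → V => ∏ i, w i ω) ?_).trans
      (sum_le_sum_of_subset_of_nonneg (subset_univ _) fun ω _ _ => prod_nonneg fun i _ =>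
        zero_le_one.trans (hw1 i ω))
    intro ω hω
    have hω' := (mem_filter.1 hω).2
    have : ∏ i, w i ω = Real.exp 2 ^ (univ.filter fun i => ERfwd s T A ω i).card := by
      simp only [w]
      rw [prod_ite]; simp
    rw [this, ← Real.exp_nat_mul]
    apply Real.exp_le_exp.2
    linarith
  have h5 := h3.trans h2
  have h6 : Real.exp (q * m / 16) = Real.exp (-(q * m / 16)) * Real.exp (2 * (q * m / 16)) := by
    rw [← Real.exp_add]; congr 1; ring
  rw [h6, mul_right_comm] at h5
  exact le_of_mul_le_mul_right h5 (Real.exp_pos _)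

/-- clean blocks -/
def ERclean {V I X : Type*} [DecidableEq V] [Fintype X]
    (s : ℕ) (A : Finset V) (ω : I → X → V) (i : I) : Prop :=
  s ≤ (A ∩ ERB ω i).card ∧ ∀ u ∈ A ∩ ERB ω i, ∀ v ∈ A ∩ ERB ω i, u ≠ v →
    ∀ j, u ∈ ERB ω j → v ∈ ERB ω j → j = i

open Classical in
theorem bwd_tail {V I X : Type*} [Fintype V] [DecidableEq V] [Nonempty V] [Fintype X] [DecidableEq X]
    [Fintype I] [LinearOrder I] (s : ℕ) (hs : 2 ≤ s) (T q : ℝ) (A : Finset V)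
    (hq : Real.exp 2 * (T * (A.card : ℝ) ^ (s - 2) * ((Fintype.card X : ℝ) / Fintype.card V) ^ s) ≤ q / 16) :
    ((univ.filter fun ω : I → X → V => q * Fintype.card I / 16 ≤
        ((univ.filter fun i : Iᵒᵈ => ERfwd s T A (fun j : Iᵒᵈ => ω (OrderDual.ofDual j)) i).card : ℝ)).card : ℝ) ≤
      Real.exp (-(q * Fintype.card I / 16)) * Fintype.card (I → X → V) := by
  have h := fwd_tail (I := Iᵒᵈ) (X := X) s hs T q A hq
  exact h

end

section
open Finset

theorem not_fwd {V I X : Type*} [DecidableEq V] [Fintype X] [DecidableEq X]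
    [Fintype I] [LinearOrder I] (s : ℕ) (T : ℝ) (A : Finset V) (ω : I → X → V)
    (hT : ∑ i, (((A ∩ ERB ω i).card.choose 2 : ℕ) : ℝ) < T) (i : I)
    (hi : s ≤ (A ∩ ERB ω i).card) (hf : ¬ ERfwd s T A ω i) (u v : V)
    (hu : u ∈ A ∩ ERB ω i) (hv : v ∈ A ∩ ERB ω i) (huv : u ≠ v) (j : I) (hj : j < i)
    (huj : u ∈ ERB ω j) (hvj : v ∈ ERB ω j) : False := by
  rw [mem_inter] at hu hv
  apply hf
  refine ⟨hi, ?_, {u, v}, ?_, ?_⟩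
  · refine le_trans ?_ hT.le
    have h1 : (ERpast A ω i).card ≤ ∑ j, ((A ∩ ERB ω j).card.choose 2) := by
      unfold ERpast
      refine card_biUnion_le.trans ?_
      simp only [card_powersetCard]
      exact sum_le_sum_of_subset (subset_univ _)
    exact_mod_cast h1
  · simp only [ERpast, mem_biUnion, mem_filter, mem_univ, true_and, mem_powersetCard]
    refine ⟨j, hj, ?_, card_pair huv⟩
    intro x hx
    simp only [mem_insert, mem_singleton] at hx
    rcases hx with rfl | rfl
    · exact mem_inter.2 ⟨hu.1, huj⟩
    · exact mem_inter.2 ⟨hv.1, hvj⟩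
  · intro x hx
    simp only [mem_insert, mem_singleton] at hx
    rcases hx with rfl | rfl
    · exact hu.2
    · exact hv.2

open Classical in
theorem phase1A {V I : Type*} [Fintype V] [DecidableEq V] [Nonempty V] [Fintype I] [LinearOrder I]
    (s k' a' : ℕ) (hs : 2 ≤ s) (hk' : 1 ≤ k') (q T : ℝ)
    (hqd : q = 1 / 2 * ((k' : ℝ) * a' / Fintype.card V) ^ s)
    (hn : (7 : ℝ) * ((s * k') * (s * a')) ≤ Fintype.card V)
    (hT : 2 * (Fintype.card I * (7 * ((s * k') * (s * a') / Fintype.card V : ℝ)) ^ 2) ≤ T)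
    (hq : Real.exp 2 * (T * (s * a' : ℝ) ^ (s - 2) * ((s * k' : ℝ) / Fintype.card V) ^ s) ≤ q / 16)
    (A : Finset V) (hA : A.card = s * a') :
    ((univ.filter fun ω : I → Fin s × Fin k' → V =>
      ((univ.filter fun i => ERclean s A ω i).card : ℝ) < q * Fintype.card I / 8).card : ℝ) ≤
      (3 * Real.exp (-(q * Fintype.card I / 16)) + Real.exp (-(T / (2 * (s * k'))))) *
        Fintype.card (I → Fin s × Fin k' → V) := by
  have : Nonempty (Fin s × Fin k') := ⟨⟨⟨0, by omega⟩, ⟨0, by omega⟩⟩⟩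
  have hn0 : (0 : ℝ) < Fintype.card V := by exact_mod_cast Fintype.card_pos
  have hX : ((Fintype.card (Fin s × Fin k') : ℕ) : ℝ) = s * k' := by simp
  have hAc : ((A.card : ℕ) : ℝ) = s * a' := by rw [hA]; push_cast; ring
  have hq0 : 0 ≤ q := by rw [hqd]; positivity
  set m : ℝ := ((Fintype.card I : ℕ) : ℝ) with hm
  have h1 := lower_tail (I := I) (fun φ : Fin s × Fin k' → V => s ≤ (A ∩ univ.image φ).card) q (by
    rw [hqd]
    refine hit_lower s k' a' A hA ?_
    have : (0 : ℝ) ≤ s * k' * (s * a') := by positivity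
    nlinarith)
  have h2 := pair_tail (I := I) (X := Fin s × Fin k') A (by
    rw [hX, hAc, ← mul_div_assoc, div_le_one hn0]; exact hn) T (by rw [hX, hAc]; exact hT)
  have h3 := fwd_tail (I := I) (X := Fin s × Fin k') s hs T q A (by rw [hX, hAc]; exact hq)
  have h4 := bwd_tail (I := I) (X := Fin s × Fin k') s hs T q A (by rw [hX, hAc]; exact hq)
  rw [hX] at h2
  set Ω : ℝ := ((Fintype.card (I → Fin s × Fin k' → V) : ℕ) : ℝ) with hΩ
  have hΩ0 : 0 ≤ Ω := by positivity
  set E1 := univ.filter fun ω : I → Fin s × Fin k' → V =>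
    ((univ.filter fun i => s ≤ (A ∩ univ.image (ω i)).card).card : ℝ) ≤ q * m / 4 with hE1
  set E2 := univ.filter fun ω : I → Fin s × Fin k' → V =>
      T ≤ ∑ i, (((A ∩ ERB ω i).card.choose 2 : ℕ) : ℝ) with hE2
  set E3 := univ.filter fun ω : I → Fin s × Fin k' → V => q * m / 16 ≤
        ((univ.filter fun i => ERfwd s T A ω i).card : ℝ) with hE3
  set E4 := univ.filter fun ω : I → Fin s × Fin k' → V => q * m / 16 ≤
        ((univ.filter fun i : Iᵒᵈ => ERfwd s T A (fun j : Iᵒᵈ => ω (OrderDual.ofDual j)) i).card : ℝ) with hE4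
  have hsub : (univ.filter fun ω : I → Fin s × Fin k' → V =>
      ((univ.filter fun i => ERclean s A ω i).card : ℝ) < q * m / 8) ⊆ E1 ∪ E2 ∪ (E3 ∪ E4) := by
    intro ω hω
    have hω' := (mem_filter.1 hω).2
    by_contra hc
    simp only [mem_union, not_or] at hc
    obtain ⟨⟨c1, c2⟩, c3, c4⟩ := hc
    have c1' := not_le.1 fun h => c1 (mem_filter.2 ⟨mem_univ _, h⟩)
    have c2' := not_le.1 fun h => c2 (mem_filter.2 ⟨mem_univ _, h⟩)
    have c3' := not_le.1 fun h => c3 (mem_filter.2 ⟨mem_univ _, h⟩)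
    have c4' := not_le.1 fun h => c4 (mem_filter.2 ⟨mem_univ _, h⟩)
    have c2d : ∑ i : Iᵒᵈ, (((A ∩ ERB (fun j : Iᵒᵈ => ω (OrderDual.ofDual j)) i).card.choose 2 : ℕ) : ℝ) < T := c2'
    set Z := univ.filter fun i => s ≤ (A ∩ univ.image (ω i)).card with hZ
    set F := univ.filter fun i => ERfwd s T A ω i with hF
    set G : Finset I := univ.filter fun i : I =>
      ERfwd s T A (fun j : Iᵒᵈ => ω (OrderDual.ofDual j)) (OrderDual.toDual i) with hG
    have hGc : (G.card : ℝ) < q * m / 16 := c4'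
    have hsub2 : Z ⊆ (univ.filter fun i => ERclean s A ω i) ∪ (F ∪ G) := by
      intro i hi
      have hi' : s ≤ (A ∩ ERB ω i).card := (mem_filter.1 hi).2
      by_contra hc
      simp only [mem_union, not_or] at hc
      obtain ⟨d1, d2, d3⟩ := hc
      have d2' : ¬ ERfwd s T A ω i := fun h => d2 (mem_filter.2 ⟨mem_univ _, h⟩)
      have d3' : ¬ ERfwd s T A (fun j : Iᵒᵈ => ω (OrderDual.ofDual j)) (OrderDual.toDual i) :=
        fun h => d3 (mem_filter.2 ⟨mem_univ _, h⟩)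
      apply d1
      refine mem_filter.2 ⟨mem_univ _, hi', ?_⟩
      intro u hu v hv huv j huj hvj
      by_contra hne
      rcases lt_or_gt_of_ne hne with h | h
      · exact not_fwd s T A ω c2' i hi' d2' u v hu hv huv j h huj hvj
      · exact not_fwd (I := Iᵒᵈ) s T A (fun j : Iᵒᵈ => ω (OrderDual.ofDual j)) c2d (OrderDual.toDual i) hi'
          d3' u v hu hv huv (OrderDual.toDual j) h huj hvj
    have hcard : (Z.card : ℝ) ≤ (univ.filter fun i => ERclean s A ω i).card + (F.card + G.card) := by
      have := (card_le_card hsub2).trans ((card_union_le _ _).trans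
        (Nat.add_le_add_left (card_union_le _ _) _))
      exact_mod_cast this
    linarith
  have hcard : ((univ.filter fun ω : I → Fin s × Fin k' → V =>
      ((univ.filter fun i => ERclean s A ω i).card : ℝ) < q * m / 8).card : ℝ) ≤
      (E1.card : ℝ) + E2.card + (E3.card + E4.card) := by
    have := (card_le_card hsub).trans ((card_union_le _ _).trans
        (Nat.add_le_add (card_union_le _ _) (card_union_le _ _)))
    exact_mod_cast this
  have hexp : Real.exp (-(q * m / 4)) ≤ Real.exp (-(q * m / 16)) := by
    apply Real.exp_le_exp.2
    have : 0 ≤ q * m := by positivity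
    linarith
  have h1' : (E1.card : ℝ) ≤ Real.exp (-(q * m / 16)) * Ω :=
    le_trans (le_trans (le_of_eq (by congr!)) h1) (mul_le_mul_of_nonneg_right hexp hΩ0)
  linarith

end

section
open Finset

theorem erdosRogers_le (s t n a : ℕ) (G : SimpleGraph (Fin n)) (hG : G.CliqueFree t)
    (h : ∀ A : Finset (Fin n), A.card = a → ∃ κ ⊆ A, κ.card = s ∧ G.IsClique (κ : Set (Fin n))) :
    erdosRogers s t n ≤ a := by
  have hmem : sSup { m : ℕ | ∃ A : Finset (Fin n), A.card = m ∧
      (G.induce (A : Set (Fin n))).CliqueFree s } ∈ { k : ℕ | ∃ G : SimpleGraph (Fin n),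
        G.CliqueFree t ∧ k = sSup { m : ℕ | ∃ A : Finset (Fin n), A.card = m ∧
      (G.induce (A : Set (Fin n))).CliqueFree s } } := ⟨G, hG, rfl⟩
  refine (Nat.sInf_le hmem).trans ?_
  refine csSup_le' ?_
  rintro m ⟨A, rfl, hA⟩
  by_contra hc
  obtain ⟨A', hA'A, hA'c⟩ := exists_subset_card_eq (not_le.1 hc).le
  obtain ⟨κ, hκA, hκc, hκ⟩ := h A' hA'c
  refine hA (κ.subtype (· ∈ (A : Set (Fin n)))) ⟨?_, ?_⟩
  · intro u hu v hv huv
    rw [mem_coe, mem_subtype] at hu hv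
    exact hκ (mem_coe.2 hu) (mem_coe.2 hv) (fun h => huv (Subtype.ext h))
  · rw [card_subtype, filter_true_of_mem, hκc]
    intro x hx
    exact hA'A (hκA hx)

open Classical in
theorem exists_not_bad {Ω ι : Type*} [Fintype Ω] (A : Finset ι) (E : Finset Ω) (F : ι → Finset Ω)
    (e f : ℝ) (hE : (E.card : ℝ) ≤ e * Fintype.card Ω)
    (hF : ∀ i ∈ A, ((F i).card : ℝ) ≤ f * Fintype.card Ω) (hΩ : 0 < Fintype.card Ω)
    (hlt : e + A.card * f < 1) : ∃ ω, ω ∉ E ∧ ∀ i ∈ A, ω ∉ F i := by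
  by_contra hc
  push Not at hc
  have hsub : (univ : Finset Ω) ⊆ E ∪ A.biUnion F := by
    intro ω _
    by_cases h : ω ∈ E
    · exact mem_union_left _ h
    · obtain ⟨i, hi, hiF⟩ := hc ω h
      exact mem_union_right _ (mem_biUnion.2 ⟨i, hi, hiF⟩)
  have h1 : (Fintype.card Ω : ℝ) ≤ E.card + ∑ i ∈ A, ((F i).card : ℝ) := by
    have := (card_le_card hsub).trans ((card_union_le _ _).trans
      (Nat.add_le_add_left card_biUnion_le _))
    rw [card_univ] at this
    exact_mod_cast this
  have h2 : ∑ i ∈ A, ((F i).card : ℝ) ≤ A.card * (f * Fintype.card Ω) := by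
    rw [← nsmul_eq_mul, ← sum_const]
    exact sum_le_sum hF
  have h3 : (0 : ℝ) < Fintype.card Ω := by exact_mod_cast hΩ
  nlinarith

theorem phase_all (s d n m k' a' r p Q M N' : ℕ) (ε x y c q T : ℝ)
    (hd : 2 ≤ d) (hds : d + 1 ≤ s) (hε : 0 < ε)
    (hE : ε * ((2 * s - 3) * d * (s - 1) + s - d) ≤ ((s : ℝ) - 2) * (d - 1))
    (hR : ε * ((2 * s - 3) * d * (2 * s + d - 1) - 2 * (s - 2)) ≤
      (d : ℝ) * (2 * s + d - 5) - 2 * (s - 2))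
    (hr : (s + d) + (s + d) * (s + d) ≤ r)
    (hn0 : 0 < n) (hk' : 1 ≤ k')
    -- first phase, second part
    (hx : 0 ≤ x) (hy : 0 ≤ y) (hc : 0 ≤ c) (hsum : n * x + m * y ≤ 2)
    (hκ : ∀ v b j : ℕ, 1 ≤ v + b →
      (v : ℝ) + (1 / 2 + (2 * s - 1) * ε / 2) * b ≤ (1 - (1 - ε) / 2) * j →
      ((s * k' : ℝ) / n) ^ j ≤ c * (x ^ v * y ^ b))
    -- first phase, first part
    (hqd : q = 1 / 2 * ((k' : ℝ) * a' / n) ^ s)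
    (hn : (7 : ℝ) * ((s * k') * (s * a')) ≤ n)
    (hT : 2 * (m * (7 * ((s * k') * (s * a') / n : ℝ)) ^ 2) ≤ T)
    (hq : Real.exp 2 * (T * (s * a' : ℝ) ^ (s - 2) * ((s * k' : ℝ) / n) ^ s) ≤ q / 16)
    (hlt1 : ((r + 1) * (n + m + 1) ^ r) * (2 ^ (r * r) * Real.exp 2 * c) ^ p +
      n ^ (s * a') * (3 * Real.exp (-(q * m / 16)) + Real.exp (-(T / (2 * (s * k'))))) < 1)
    -- phase 2
    (hM : s + s * s + s * s * ((1 + p * r) ^ r * r ^ 3) ≤ M) (hMQ : 2 * M ≤ Q)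
    (hN' : ((N' + 1) * (M * (1 + (1 + p * r) ^ r * r) + 1) : ℝ) ≤ q * m / 8)
    (hlt2 : (n : ℝ) ^ (s * a') * (1 - (1 / Q : ℝ) ^ (s + s * s) / 2) ^ N' < 1) :
    erdosRogers s (s + d) n ≤ s * a' := by
  classical
  set δ : ℝ := 1 / 2 + (2 * s - 1) * ε / 2 with hδ
  set β : ℝ := 1 - (1 - ε) / 2 with hβ
  have : Nonempty (Fin n) := ⟨⟨0, hn0⟩⟩
  set As : Finset (Finset (Fin n)) := powersetCard (s * a') univ with hAs
  have hAsc : (As.card : ℝ) ≤ (n : ℝ) ^ (s * a') := by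
    rw [hAs, card_powersetCard, card_univ, Fintype.card_fin]
    exact_mod_cast Nat.choose_le_pow _ _
  -- phase 1
  have hX : ((Fintype.card (Fin s × Fin k') : ℕ) : ℝ) = s * k' := by simp
  have hB := phase1B (V := Fin n) (I := Fin m) (X := Fin s × Fin k') r p δ β x y c hx hy hc
    (by simpa using hsum) (by rw [hX, Fintype.card_fin]; exact hκ)
  rw [Fintype.card_fin, Fintype.card_fin] at hB
  obtain ⟨ω1, hω1, hωA⟩ := exists_not_bad As
    (univ.filter fun ω : Fin m → Fin s × Fin k' → Fin n => ¬ ERP2 r ((1 + p * r) ^ r) δ β (ERB ω))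
    (fun A => univ.filter fun ω : Fin m → Fin s × Fin k' → Fin n =>
      ((univ.filter fun i => ERclean s A ω i).card : ℝ) < q * m / 8) _ _
    (le_trans (le_of_eq (by congr!)) hB)
    (fun A hA => by
      have hA' := phase1A (V := Fin n) (I := Fin m) s k' a' (by omega) hk' q T
        (by simpa using hqd) (by simpa using hn) (by simpa using hT) (by simpa using hq) A
        (mem_powersetCard.1 hA).2
      simp only [Fintype.card_fin m] at hA'
      exact le_trans (le_of_eq (by congr!)) hA')
    Fintype.card_pos
    (by
      refine lt_of_le_of_lt ?_ hlt1
      gcongr)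
  have hP2 : ERP2 r ((1 + p * r) ^ r) δ β (ERB ω1) := by
    by_contra h
    exact hω1 (mem_filter.2 ⟨mem_univ _, h⟩)
  have hclean : ∀ A ∈ As, q * m / 8 ≤ ((univ.filter fun i => ERclean s A ω1 i).card : ℝ) := by
    intro A hA
    by_contra h
    exact hωA A hA (mem_filter.2 ⟨mem_univ _, not_le.1 h⟩)
  -- phase 2
  have hQ0 : 0 < Q := by
    have : s ≤ M := le_trans (by rw [add_assoc]; exact Nat.le_add_right _ _) hM
    omega
  have : Nonempty (Fin Q) := ⟨⟨0, hQ0⟩⟩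
  have hsel : ∀ A : Finset (Fin n), ∀ i, ∃ κ : Finset (Fin n), ERclean s A ω1 i →
      κ ⊆ A ∩ ERB ω1 i ∧ κ.card = s := by
    intro A i
    by_cases h : ERclean s A ω1 i
    · obtain ⟨κ, h1, h2⟩ := exists_subset_card_eq h.1
      exact ⟨κ, fun _ => ⟨h1, h2⟩⟩
    · exact ⟨∅, fun h' => absurd h' h⟩
  choose κ hκ1 using hsel
  obtain ⟨ω2, -, hω2⟩ := exists_not_bad As (∅ : Finset ((Fin m × Fin n) ⊕ (Fin m × Finset (Fin n)) → Fin Q))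
    (fun A => univ.filter fun ω : (Fin m × Fin n) ⊕ (Fin m × Finset (Fin n)) → Fin Q =>
      ∀ i ∈ univ.filter fun i => ERclean s A ω1 i,
        ¬ (ERgraph s r Q δ β (ERB ω1) ω).IsClique (κ A i : Set (Fin n)))
    0 ((1 - (1 / Q : ℝ) ^ (s + s * s) / 2) ^ N') (by simp)
    (fun A hA => by
      have hp := phase2_count s r Q ((1 + p * r) ^ r) M δ β (ERB ω1) (by omega) hM hMQ hP2
        (univ.filter fun i => ERclean s A ω1 i) (κ A)
        (fun i hi => (hκ1 A i (mem_filter.1 hi).2).2)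
        (fun i hi => (hκ1 A i (mem_filter.1 hi).2).1.trans inter_subset_right)
        (fun i hi u hu v hv huv j huj hvj => by
          have hcl := (mem_filter.1 hi).2
          have hsub := (hκ1 A i hcl).1
          exact hcl.2 u (hsub hu) v (hsub hv) huv j huj hvj) N' (by
          intro hlt
          have h1 := hN'.trans (hclean A hA)
          have h2 : (N' + 1) * (M * (1 + (1 + p * r) ^ r * r) + 1) ≤
            (univ.filter fun i => ERclean s A ω1 i).card := by exact_mod_cast h1
          omega)
      exact le_trans (le_of_eq (by congr!)) hp)
    Fintype.card_pos
    (by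
      rw [zero_add]
      refine lt_of_le_of_lt ?_ hlt2
      refine mul_le_mul_of_nonneg_right hAsc (pow_nonneg ?_ _)
      have hQ1 : (1 : ℝ) ≤ Q := by exact_mod_cast hQ0
      have : (1 / Q : ℝ) ^ (s + s * s) ≤ 1 :=
        pow_le_one₀ (by positivity) (by rw [div_le_one (by linarith)]; exact hQ1)
      linarith)
  refine erdosRogers_le s (s + d) n (s * a') (ERgraph s r Q δ β (ERB ω1) ω2)
    (ERgraph_cliqueFree s d Q r ε hd hds hε hE hR hr (ERB ω1) ω2) ?_
  intro A hA
  have hAm : A ∈ As := mem_powersetCard.2 ⟨subset_univ _, hA⟩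
  have h := hω2 A hAm
  simp only [mem_filter, mem_univ, true_and, not_forall, not_not] at h
  obtain ⟨i, hi, hcl⟩ := h
  exact ⟨κ A i, (hκ1 A i hi).1.trans inter_subset_left, (hκ1 A i hi).2, hcl⟩

end

section
open Finset

theorem asym_kappa (nn L A δ α K : ℝ) (hn : 1 ≤ nn) (hL : 1 ≤ L) (hA : A = nn ^ α) (hδ : 0 < δ)
    (hK0 : 0 ≤ K) (hK : K ≤ A / L) (v b j : ℕ) (hvb : 1 ≤ v + b)
    (h : (v : ℝ) + δ * b ≤ (1 - α) * j) :
    (K / nn) ^ j ≤ 1 / L * ((nn ^ (-1 : ℝ)) ^ v * (nn ^ (-δ)) ^ b) := by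
  have hn0 : 0 < nn := by linarith
  have hj : j ≠ 0 := by
    rintro rfl
    rw [Nat.cast_zero, mul_zero] at h
    rcases Nat.eq_zero_or_pos b with hb | hb
    · subst hb
      have : (1 : ℝ) ≤ v := by exact_mod_cast hvb
      simp at h
      subst h
      simp at hvb
    · have : (1 : ℝ) ≤ b := by exact_mod_cast hb
      have hv : (0 : ℝ) ≤ v := by positivity
      nlinarith
  have h1 : K / nn ≤ nn ^ (-(1 - α)) * (1 / L) := by
    have : nn ^ (-(1 - α)) = A / nn := by
      rw [hA, neg_sub, Real.rpow_sub hn0, Real.rpow_one]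
    rw [this]
    calc K / nn ≤ (A / L) / nn := by gcongr
      _ = _ := by field_simp
  have h2 : (K / nn) ^ j ≤ (nn ^ (-(1 - α)) * (1 / L)) ^ j := by
    apply pow_le_pow_left₀ _ h1
    positivity
  refine h2.trans ?_
  rw [mul_pow, mul_comm]
  have h3 : (1 / L) ^ j ≤ 1 / L := by
    apply pow_le_of_le_one (by positivity) _ hj
    rw [div_le_one (by linarith)]; exact hL
  have h4 : (nn ^ (-(1 - α))) ^ j ≤ (nn ^ (-1 : ℝ)) ^ v * (nn ^ (-δ)) ^ b := by
    rw [← Real.rpow_natCast, ← Real.rpow_natCast, ← Real.rpow_natCast, ← Real.rpow_mul hn0.le,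
      ← Real.rpow_mul hn0.le, ← Real.rpow_mul hn0.le, ← Real.rpow_add hn0]
    apply Real.rpow_le_rpow_of_exponent_le hn
    linarith
  gcongr

set_option maxHeartbeats 4000000 in
theorem asym_core (s d C r D : ℕ) (ε K1 K2 K3 θ : ℝ)
    (hd : 2 ≤ d) (hds : d + 1 ≤ s) (hε : 0 < ε) (hε1 : (2 * s - 3) * ε < 1)
    (hE : ε * ((2 * s - 3) * d * (s - 1) + s - d) ≤ ((s : ℝ) - 2) * (d - 1))
    (hR : ε * ((2 * s - 3) * d * (2 * s + d - 1) - 2 * (s - 2)) ≤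
      (d : ℝ) * (2 * s + d - 5) - 2 * (s - 2))
    (hr : (s + d) + (s + d) * (s + d) = r)
    (hD : D = 2 * r + r * (s + s * s)) (hC : C = D + s + 2)
    (hK1 : K1 = s + s * s + s * s * ((1 + 2 * r) ^ r * r ^ 3))
    (hK2 : K2 = K1 * (1 + (1 + 2 * r) ^ r * r) + 1)
    (hK3 : K3 = 1 / 4 * (1 / (2 * s)) ^ s)
    (hθ : θ = 1 / (32 * Real.exp 2 * (s : ℝ) ^ (2 * s)))
    (n : ℕ) (L A : ℝ) (hL : L = Real.log n) (hA : A = (n : ℝ) ^ ((1 - ε) / 2))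
    (e1 : 1 ≤ L) (e2 : 2 * s * L ≤ A) (e3 : 2 ≤ K3 / (16 * K2) * A)
    (e4 : 8 * s * (2 * K1) ^ (s + s * s) * (16 * K2) ≤ K3 * L)
    (e5 : 64 * s ≤ K3 * L)
    (e6 : 2 ^ (r * r) * Real.exp 2 * Real.exp (2 * r + 1) ≤ L)
    (e7 : 4 * (r + 1) * (3 : ℝ) ^ r + 12 ≤ n)
    (e8 : 4 ≤ θ * s * L) (e9 : 14 * s * L ^ C ≤ (n : ℝ) ^ ε)
    (e10 : 98 ≤ θ * (n : ℝ) ^ ((1 - (2 * s - 3) * ε) / 2))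
    (e11 : 2 * s ≤ L) :
    (erdosRogers s (s + d) n : ℝ) ≤ (n : ℝ) ^ ((1 - ε) / 2) * L ^ (C + 1) := by
  have hs3 : (3 : ℝ) ≤ s := by exact_mod_cast (by omega : 3 ≤ s)
  have hs0 : (0 : ℝ) < s := by linarith
  have hL0 : 0 < L := by linarith
  have hn12 : (12 : ℝ) ≤ n := by
    have : (0 : ℝ) ≤ 4 * (r + 1) * (3 : ℝ) ^ r := by positivity
    linarith
  have hn0 : (0 : ℝ) < n := by linarith
  have hn1 : (1 : ℝ) ≤ n := by linarith
  have hnL : (n : ℝ) = Real.exp L := by rw [hL, Real.exp_log hn0]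
  have hA0 : 0 < A := by rw [hA]; positivity
  set δ : ℝ := 1 / 2 + (2 * s - 1) * ε / 2 with hδ
  have hδ0 : 0 < δ := by 
    have : 0 < (2 * s - 1) * ε := mul_pos (by linarith) hε
    rw [hδ]; linarith
  have hδ2 : δ ≤ 2 := by
    have h1 : 3 * ε ≤ (2 * s - 3) * ε := mul_le_mul_of_nonneg_right (by linarith) hε.le
    have h2 : (2 * s - 1) * ε = (2 * s - 3) * ε + 2 * ε := by ring
    rw [hδ]; linarith
  -- parameters
  set k' : ℕ := ⌊A / (s * L)⌋₊ with hk'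
  have hz2 : 2 ≤ A / (s * L) := by rw [le_div_iff₀ (by positivity)]; linarith
  have k1 : (k' : ℝ) ≤ A / (s * L) := Nat.floor_le (by positivity)
  have k2 : A / (2 * s * L) ≤ k' := by
    have h1 := Nat.lt_floor_add_one (A / (s * L))
    have h2 : A / (2 * s * L) = A / (s * L) / 2 := by field_simp
    rw [h2]
    linarith
  have k3 : 1 ≤ k' := by
    rw [hk']; apply Nat.le_floor; push_cast; linarith
  have k30 : (0 : ℝ) < k' := by exact_mod_cast k3
  have k4 : (s : ℝ) * k' ≤ A / L := by
    calc (s : ℝ) * k' ≤ s * (A / (s * L)) := by gcongr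
      _ = A / L := by field_simp
  have k5 : (s : ℝ) * k' ≤ A := k4.trans (div_le_self hA0.le e1)
  have hX1 : 1 ≤ (n : ℝ) ^ δ := Real.one_le_rpow hn1 hδ0.le
  set m : ℕ := ⌊(n : ℝ) ^ δ⌋₊ with hm
  have m1 : (m : ℝ) ≤ (n : ℝ) ^ δ := Nat.floor_le (by positivity)
  have m2 : (n : ℝ) ^ δ / 2 ≤ m := by
    have h1 := Nat.lt_floor_add_one ((n : ℝ) ^ δ)
    have h2 : 1 ≤ m := by rw [hm]; apply Nat.le_floor; push_cast; exact hX1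
    have h3 : (1 : ℝ) ≤ m := by exact_mod_cast h2
    linarith
  have hALC : 1 ≤ A * L ^ C := by
    have h1 : 1 ≤ L ^ C := one_le_pow₀ e1
    have h2 : 1 ≤ (2 * s : ℝ) * L := one_le_mul_of_one_le_of_one_le (by linarith) e1
    exact one_le_mul_of_one_le_of_one_le (h2.trans e2) h1
  set a' : ℕ := ⌈A * L ^ C⌉₊ with ha'
  have a1 : A * L ^ C ≤ a' := Nat.le_ceil _
  have a2 : (a' : ℝ) ≤ 2 * (A * L ^ C) := by
    have := (Nat.ceil_lt_add_one (by positivity : 0 ≤ A * L ^ C))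
    linarith
  have a0 : (0 : ℝ) < a' := by linarith
  set p : ℕ := ⌈L⌉₊ with hp
  have p1 : L ≤ p := Nat.le_ceil _
  have p2 : (p : ℝ) ≤ 2 * L := by
    have := (Nat.ceil_lt_add_one hL0.le)
    linarith
  -- size of Δ
  have hΔ : ((1 : ℝ) + p * r) ^ r ≤ (1 + 2 * r) ^ r * L ^ r := by
    rw [← mul_pow]
    gcongr
    have h1 : (p : ℝ) * r ≤ 2 * L * r := by gcongr
    have h2 : (1 + 2 * (r : ℝ)) * L = L + 2 * L * r := by ring
    linarith
  have hLr : 1 ≤ L ^ r := one_le_pow₀ e1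
  set M : ℕ := s + s * s + s * s * ((1 + p * r) ^ r * r ^ 3) with hM
  have M1 : (M : ℝ) ≤ K1 * L ^ r := by
    rw [hM, hK1]; push_cast
    have h1 : (s : ℝ) + s * s ≤ (s + s * s) * L ^ r := le_mul_of_one_le_right (by positivity) hLr
    have h2 : (s : ℝ) * s * ((1 + p * r) ^ r * r ^ 3) ≤
        s * s * ((1 + 2 * r) ^ r * L ^ r * r ^ 3) := by gcongr
    linarith
  have M0 : (1 : ℝ) ≤ M := by
    have : 1 ≤ M := by rw [hM, add_assoc]; exact le_trans (by omega) (Nat.le_add_right _ _)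
    exact_mod_cast this
  have hK10 : 0 < K1 := by rw [hK1]; positivity
  have hK20 : 0 < K2 := by rw [hK2]; positivity
  have hK30 : 0 < K3 := by rw [hK3]; positivity
  have hθ0 : 0 < θ := by rw [hθ]; positivity
  set W : ℝ := (M : ℝ) * (1 + (1 + p * r) ^ r * r) + 1 with hW
  have W1 : W ≤ K2 * L ^ (2 * r) := by
    have h1 : (1 : ℝ) + (1 + p * r) ^ r * r ≤ (1 + (1 + 2 * r) ^ r * r) * L ^ r := by
      have : ((1 : ℝ) + p * r) ^ r * r ≤ (1 + 2 * r) ^ r * L ^ r * r := by gcongr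
      linarith
    have h2 : (M : ℝ) * (1 + (1 + p * r) ^ r * r) ≤
        (K1 * L ^ r) * ((1 + (1 + 2 * r) ^ r * r) * L ^ r) := by gcongr
    have h3 : 1 ≤ L ^ (2 * r) := one_le_pow₀ e1
    have h4 : L ^ (2 * r) = L ^ r * L ^ r := by rw [two_mul, pow_add]
    rw [hW, hK2]
    calc _ ≤ (K1 * L ^ r) * ((1 + (1 + 2 * r) ^ r * r) * L ^ r) + L ^ (2 * r) := by linarith
      _ = _ := by rw [h4]; ring
  have W0 : 0 < W := by rw [hW]; positivity
  -- q m
  set q : ℝ := 1 / 2 * ((k' : ℝ) * a' / n) ^ s with hq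
  have hA2 : A * A / n = (n : ℝ) ^ (-ε) := by
    rw [hA, ← Real.rpow_add hn0, div_eq_iff hn0.ne']
    nth_rewrite 3 [← Real.rpow_one (n : ℝ)]
    rw [← Real.rpow_add hn0]
    congr 1; ring
  have hC1 : L ^ C = L * L ^ (C - 1) := by
    rw [← pow_succ']; congr 1; omega
  have q1 : (n : ℝ) ^ (-ε) * L ^ (C - 1) / (2 * s) ≤ (k' : ℝ) * a' / n := by
    calc (n : ℝ) ^ (-ε) * L ^ (C - 1) / (2 * s) = (A / (2 * s * L)) * (A * L ^ C) / n := by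
          rw [← hA2, hC1]; field_simp
      _ ≤ _ := by gcongr
  have q2 : K3 * A * L ^ ((C - 1) * s) ≤ q * m := by
    have h1 : ((n : ℝ) ^ (-ε) * L ^ (C - 1) / (2 * s)) ^ s ≤ ((k' : ℝ) * a' / n) ^ s := by
      apply pow_le_pow_left₀ _ q1; positivity
    have h2 : ((n : ℝ) ^ (-ε)) ^ s * (n : ℝ) ^ δ = A := by
      rw [hA, ← Real.rpow_natCast, ← Real.rpow_mul hn0.le, ← Real.rpow_add hn0]
      congr 1; rw [hδ]; ring
    calc K3 * A * L ^ ((C - 1) * s)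
        = 1 / 2 * ((n : ℝ) ^ (-ε) * L ^ (C - 1) / (2 * s)) ^ s * ((n : ℝ) ^ δ / 2) := by
          rw [hK3, ← h2, pow_mul, div_pow, mul_pow, div_pow, one_pow]; ring
      _ ≤ _ := by rw [hq]; gcongr
  have hexp : D + C + 2 ≤ (C - 1) * s := by
    have h1 : (C - 1) * s + s = C * s := by
      obtain ⟨c, rfl⟩ : ∃ c, C = c + 1 := ⟨C - 1, by omega⟩
      simp; ring
    have h2 : C * 3 ≤ C * s := Nat.mul_le_mul_left _ (by omega)
    omega
  have q3 : K3 * A * L ^ (D + C + 2) ≤ q * m := by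
    refine le_trans ?_ q2
    gcongr
  have q4 : K3 * A * L ^ (C + 2) ≤ q * m := by
    refine le_trans ?_ q3
    gcongr
    omega
  have sa1 : (s : ℝ) * a' * L ≤ 2 * s * A * L ^ (C + 1) := by
    calc (s : ℝ) * a' * L ≤ s * (2 * (A * L ^ C)) * L := by gcongr
      _ = _ := by ring
  have hLsa : L ≤ s * a' * L := by
    have : (1 : ℝ) ≤ s * a' := one_le_mul_of_one_le_of_one_le (by linarith) (hALC.trans a1)
    exact le_mul_of_one_le_left hL0.le this
  have hnpow : (n : ℝ) ^ (s * a') = Real.exp (s * a' * L) := by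
    rw [hnL, ← Real.exp_nat_mul]; push_cast; rfl
  -- number of rounds
  set N' : ℕ := ⌊q * m / (8 * W)⌋₊ - 1 with hN'
  have hqW : K3 / (8 * K2) * A * L ^ (r * (s + s * s) + C + 2) ≤ q * m / (8 * W) := by
    rw [le_div_iff₀ (by positivity)]
    calc K3 / (8 * K2) * A * L ^ (r * (s + s * s) + C + 2) * (8 * W)
        ≤ K3 / (8 * K2) * A * L ^ (r * (s + s * s) + C + 2) * (8 * (K2 * L ^ (2 * r))) := by gcongr
      _ = K3 * A * L ^ (D + C + 2) := by
          rw [hD, show 2 * r + r * (s + s * s) + C + 2 = (r * (s + s * s) + C + 2) + 2 * r by ring,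
            pow_add _ (r * (s + s * s) + C + 2)]
          field_simp
      _ ≤ _ := q3
  have hbig : 2 ≤ K3 / (16 * K2) * A * L ^ (r * (s + s * s) + C + 2) :=
    e3.trans (le_mul_of_one_le_right (by positivity) (one_le_pow₀ e1))
  have hhalf : K3 / (8 * K2) * A * L ^ (r * (s + s * s) + C + 2) =
      2 * (K3 / (16 * K2) * A * L ^ (r * (s + s * s) + C + 2)) := by field_simp; ring
  have N1 : K3 / (16 * K2) * A * L ^ (r * (s + s * s) + C + 2) ≤ N' := by
    have h1 := Nat.lt_floor_add_one (q * m / (8 * W))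
    have h2 : ((⌊q * m / (8 * W)⌋₊ : ℕ) : ℝ) ≤ N' + 1 := by
      rw [hN']; norm_cast; omega
    linarith
  have N2 : ((N' + 1) * W : ℝ) ≤ q * m / 8 := by
    have h1 : 1 ≤ ⌊q * m / (8 * W)⌋₊ := by
      apply Nat.le_floor; push_cast; linarith
    have h2 : ((N' + 1 : ℕ) : ℝ) ≤ q * m / (8 * W) := by
      rw [hN', Nat.sub_add_cancel h1]
      exact Nat.floor_le (by positivity)
    push_cast at h2
    rw [le_div_iff₀ (by positivity)] at h2
    linarith
  -- T
  set T : ℝ := θ * (s * a') ^ 2 with hT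
  have key := phase_all s d n m k' a' r p (2 * M) M N' ε ((n : ℝ) ^ (-1 : ℝ)) ((n : ℝ) ^ (-δ))
    (1 / L) q T hd hds hε hE hR hr.le (by exact_mod_cast hn0) k3 (by positivity) (by positivity)
    (by positivity)
    (by
      have h1 : (n : ℝ) * (n : ℝ) ^ (-1 : ℝ) = 1 := by
        rw [Real.rpow_neg_one, mul_inv_cancel₀ hn0.ne']
      have h2 : (m : ℝ) * (n : ℝ) ^ (-δ) ≤ 1 := by
        calc (m : ℝ) * (n : ℝ) ^ (-δ) ≤ (n : ℝ) ^ δ * (n : ℝ) ^ (-δ) := by gcongr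
          _ = 1 := by rw [← Real.rpow_add hn0]; simp
      linarith)
    (fun v b j hvb h => asym_kappa n L A δ ((1 - ε) / 2) (s * k') hn1 e1 hA hδ0 (by positivity) k4
      v b j hvb h)
    hq
    (by
      have h1 : A * A * L ^ C * (14 * s) ≤ n := by
        have : A * A = n * (n : ℝ) ^ (-ε) := by rw [← hA2]; field_simp
        rw [this]
        calc (n : ℝ) * (n : ℝ) ^ (-ε) * L ^ C * (14 * s)
            = n * (n : ℝ) ^ (-ε) * (14 * s * L ^ C) := by ring
          _ ≤ n * (n : ℝ) ^ (-ε) * (n : ℝ) ^ ε := by gcongr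
          _ = n := by rw [mul_assoc, ← Real.rpow_add hn0]; simp
      calc (7 : ℝ) * ((s * k') * (s * a')) ≤ 7 * (A * (s * (2 * (A * L ^ C)))) := by gcongr
        _ = A * A * L ^ C * (14 * s) := by ring
        _ ≤ n := h1)
    (by
      have h1 : 98 * (m * (s * k') ^ 2 / n ^ 2) ≤ θ := by
        have h2 : (m : ℝ) * (s * k') ^ 2 / n ^ 2 ≤ ((n : ℝ) ^ ((1 - (2 * s - 3) * ε) / 2))⁻¹ := by
          calc (m : ℝ) * (s * k') ^ 2 / n ^ 2 ≤ (n : ℝ) ^ δ * A ^ 2 / n ^ 2 := by gcongr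
            _ = _ := by
              rw [hA, ← Real.rpow_natCast, ← Real.rpow_natCast, ← Real.rpow_mul hn0.le,
                ← Real.rpow_add hn0, ← Real.rpow_sub hn0, ← Real.rpow_neg hn0.le]
              congr 1; rw [hδ]; push_cast; ring
        calc 98 * (m * (s * k') ^ 2 / n ^ 2)
            ≤ (θ * (n : ℝ) ^ ((1 - (2 * s - 3) * ε) / 2)) *
              ((n : ℝ) ^ ((1 - (2 * s - 3) * ε) / 2))⁻¹ := by gcongr
          _ = θ := by
              rw [mul_assoc, mul_inv_cancel₀ (by positivity), mul_one]
      calc 2 * (m * (7 * ((s * k') * (s * a') / n : ℝ)) ^ 2)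
          = 98 * (m * (s * k') ^ 2 / n ^ 2) * (s * a') ^ 2 := by ring
        _ ≤ θ * (s * a') ^ 2 := by gcongr)
    (by
      apply le_of_eq
      have h1 : (s * a' : ℝ) ^ 2 * (s * a' : ℝ) ^ (s - 2) = (s * a') ^ s := by
        rw [← pow_add]; congr 1; omega
      calc Real.exp 2 * (θ * (s * a') ^ 2 * (s * a' : ℝ) ^ (s - 2) * ((s * k' : ℝ) / n) ^ s)
          = Real.exp 2 * (θ * ((s * a' : ℝ) ^ 2 * (s * a' : ℝ) ^ (s - 2)) * ((s * k' : ℝ) / n) ^ s)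
            := by ring
        _ = Real.exp 2 * θ * (s : ℝ) ^ (2 * s) * (k' * a' / n) ^ s := by
            rw [h1, two_mul s, pow_add, div_pow, div_pow, mul_pow, mul_pow, mul_pow]; ring
        _ = 1 / 32 * (k' * a' / n) ^ s := by
            rw [hθ]; field_simp
        _ = q / 16 := by rw [hq]; ring)
    (by
      have t1 : (((r : ℝ) + 1) * (n + m + 1) ^ r) * (2 ^ (r * r) * Real.exp 2 * (1 / L)) ^ p
          ≤ 1 / 4 := by
        have h1 : (n : ℝ) + m + 1 ≤ 3 * Real.exp (2 * L) := by
          have h2 : (m : ℝ) ≤ (n : ℝ) ^ (2 : ℝ) :=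
            m1.trans (Real.rpow_le_rpow_of_exponent_le hn1 hδ2)
          have h3 : Real.exp (2 * L) = (n : ℝ) ^ 2 := by
            rw [hnL, ← Real.exp_nat_mul]; norm_num
          rw [Real.rpow_two] at h2
          have h4 : (n : ℝ) ≤ (n : ℝ) ^ 2 := le_self_pow₀ hn1 (by norm_num)
          rw [h3]
          linarith
        have h4 : 2 ^ (r * r) * Real.exp 2 * (1 / L) ≤ Real.exp (-(2 * r + 1)) := by
          rw [Real.exp_neg, mul_one_div, div_le_iff₀ hL0, ← div_eq_inv_mul,
            le_div_iff₀ (Real.exp_pos _)]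
          exact e6
        calc (((r : ℝ) + 1) * (n + m + 1) ^ r) * (2 ^ (r * r) * Real.exp 2 * (1 / L)) ^ p
            ≤ (((r : ℝ) + 1) * (3 * Real.exp (2 * L)) ^ r) * (Real.exp (-(2 * r + 1))) ^ p := by
              gcongr
          _ = (r + 1) * 3 ^ r * Real.exp (r * (2 * L) + p * (-(2 * r + 1))) := by
              rw [mul_pow, Real.exp_add, Real.exp_nat_mul, Real.exp_nat_mul]; ring
          _ ≤ (r + 1) * 3 ^ r * Real.exp (-L) := by
              gcongr
              have h5 : L * (2 * r + 1) ≤ p * (2 * r + 1) := by gcongr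
              linarith
          _ ≤ 1 / 4 := by
              rw [Real.exp_neg, ← hnL, ← div_eq_mul_inv, div_le_iff₀ hn0]
              linarith
      have t2 : (n : ℝ) ^ (s * a') * Real.exp (-(q * m / 16)) ≤ Real.exp (-L) := by
        rw [hnpow, ← Real.exp_add]
        apply Real.exp_le_exp.2
        have : 4 * s * A * L ^ (C + 1) ≤ q * m / 16 := by
          rw [le_div_iff₀ (by norm_num)]
          refine le_trans ?_ q4
          calc 4 * s * A * L ^ (C + 1) * 16 = 64 * s * (A * L ^ (C + 1)) := by ring
            _ ≤ K3 * L * (A * L ^ (C + 1)) := by gcongr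
            _ = _ := by ring
        linarith
      have t3 : (n : ℝ) ^ (s * a') * Real.exp (-(T / (2 * (s * k')))) ≤ Real.exp (-L) := by
        rw [hnpow, ← Real.exp_add]
        apply Real.exp_le_exp.2
        have : 2 * (s * a' * L) ≤ T / (2 * (s * k')) := by
          rw [le_div_iff₀ (by positivity), hT]
          calc 2 * (s * a' * L) * (2 * (s * k')) ≤ 2 * (s * a' * L) * (2 * (A / L)) := by gcongr
            _ = 4 * (s * a') * A := by field_simp; ring
            _ ≤ θ * s * L * (s * a') * A := by gcongr
            _ = θ * (s * a') * (s * (A * L)) := by ring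
            _ ≤ θ * (s * a') * (s * (A * L ^ C)) := by
                gcongr
                exact le_self_pow₀ e1 (by omega)
            _ ≤ θ * (s * a') * (s * a') := by gcongr
            _ = _ := by ring
        linarith
      have t4 : Real.exp (-L) ≤ 1 / 12 := by
        rw [Real.exp_neg, ← hnL, inv_eq_one_div]
        gcongr
      have t5 : (n : ℝ) ^ (s * a') * (3 * Real.exp (-(q * m / 16)) +
          Real.exp (-(T / (2 * (s * k'))))) ≤ 4 * (1 / 12) := by
        rw [mul_add]; linarith
      linarith)
    le_rfl le_rfl
    N2
    (by
      set e := s + s * s with he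
      have hM2 : (1 : ℝ) ≤ 2 * M := by linarith
      set z : ℝ := (1 / ((2 * M : ℕ) : ℝ)) ^ e / 2 with hz
      have z0 : 0 < z := by rw [hz]; push_cast; positivity
      have z1 : z ≤ 1 := by
        have : (1 / ((2 * M : ℕ) : ℝ)) ^ e ≤ 1 :=
          pow_le_one₀ (by positivity) (by
            push_cast; rw [div_le_one (by linarith)]; exact hM2)
        rw [hz]; linarith
      have h1 : (1 - z) ^ N' ≤ Real.exp (-(N' * z)) := by
        calc (1 - z) ^ N' ≤ (Real.exp (-z)) ^ N' := by
              apply pow_le_pow_left₀ (by linarith)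
              exact Real.one_sub_le_exp_neg z
          _ = _ := by rw [← Real.exp_nat_mul]; congr 1; ring
      have h2 : 1 / ((2 * K1) ^ e * L ^ (r * e)) / 2 ≤ z := by
        rw [hz, one_div_pow, pow_mul, ← mul_pow]
        have hb : ((2 * M : ℕ) : ℝ) ≤ 2 * K1 * L ^ r := by push_cast; linarith
        have hb0 : (0 : ℝ) < ((2 * M : ℕ) : ℝ) := by push_cast; linarith
        gcongr
      have h3 : s * a' * L < N' * z := by
        have h4 : K3 / (16 * K2) * A * L ^ (r * e + C + 2) * (1 / ((2 * K1) ^ e * L ^ (r * e)) / 2) ≤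
            N' * z := by gcongr
        refine lt_of_lt_of_le ?_ h4
        have h5 : K3 / (16 * K2) * A * L ^ (r * e + C + 2) *
            (1 / ((2 * K1) ^ e * L ^ (r * e)) / 2) =
            (K3 * L) / (2 * (2 * K1) ^ e * (16 * K2)) * (A * L ^ (C + 1)) := by
          rw [show r * e + C + 2 = r * e + (C + 1) + 1 by ring, pow_succ, pow_add L (r * e)]
          field_simp
        rw [h5]
        have h6 : 4 * (s : ℝ) ≤ (K3 * L) / (2 * (2 * K1) ^ e * (16 * K2)) := by
          rw [le_div_iff₀ (by positivity)]
          linarith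
        have h7 : 0 < A * L ^ (C + 1) := by positivity
        have h8 := mul_le_mul_of_nonneg_right h6 h7.le
        have h9 := mul_pos hs0 h7
        refine lt_of_le_of_lt sa1 (lt_of_lt_of_le ?_ h8)
        clear * - h9
        linarith
      rw [hnpow]
      calc Real.exp (s * a' * L) * (1 - z) ^ N' ≤
          Real.exp (s * a' * L) * Real.exp (-(N' * z)) := by gcongr
        _ = Real.exp (s * a' * L - N' * z) := by rw [← Real.exp_add]; rfl
        _ < 1 := by rw [Real.exp_lt_one_iff]; linarith)
  have key' : (erdosRogers s (s + d) n : ℝ) ≤ s * a' := by exact_mod_cast key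
  rw [← hA]
  calc (erdosRogers s (s + d) n : ℝ) ≤ s * a' := key'
    _ ≤ s * (2 * (A * L ^ C)) := by gcongr
    _ = 2 * s * (A * L ^ C) := by ring
    _ ≤ L * (A * L ^ C) := by gcongr
    _ = _ := by ring

end

/-- **Theorem (Gowers–Janzer).** For all integers `s ≥ 3` and `s+2 ≤ t ≤ 2s-1` there is a
constant `c = c(s,t) > 0` such that for all sufficiently large `n`,
`f_{s,t}(n) ≤ n^α · (log n)^c`. -/
theorem erdosRogers_upper_bound (s t : ℕ) (hs : 3 ≤ s) (ht1 : s + 2 ≤ t) (ht2 : t ≤ 2 * s - 1) :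
    ∃ c : ℝ, 0 < c ∧ ∃ N : ℕ, ∀ n : ℕ, N ≤ n →
      (erdosRogers s t n : ℝ) ≤ (n : ℝ) ^ ERalpha s t * Real.log n ^ c := by
  obtain ⟨d, rfl⟩ : ∃ d, t = s + d := ⟨t - s, by omega⟩
  have hd : 2 ≤ d := by omega
  have hds : d + 1 ≤ s := by omega
  obtain ⟨ε, hε, hα, hE, hR⟩ := ER_eps s d hs hd hds
  have hs3 : (3 : ℝ) ≤ s := by exact_mod_cast hs
  have hd2 : (2 : ℝ) ≤ d := by exact_mod_cast hd
  have hsd : (d : ℝ) + 1 ≤ s := by exact_mod_cast hds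
  have hε1 : (2 * s - 3) * ε < 1 := by
    by_contra hc
    push Not at hc
    have h1 : (d : ℝ) * (s - 1) ≤ (2 * s - 3) * ε * (d * (s - 1)) :=
      le_mul_of_one_le_left (mul_nonneg (by linarith) (by linarith)) hc
    have h2 : 0 < ε * (s - d) := mul_pos hε (by linarith)
    nlinarith
  have hεlt : ε < 1 := by nlinarith
  obtain ⟨r, hr⟩ : ∃ r, (s + d) + (s + d) * (s + d) = r := ⟨_, rfl⟩
  obtain ⟨D, hD⟩ : ∃ D, D = 2 * r + r * (s + s * s) := ⟨_, rfl⟩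
  obtain ⟨C, hC⟩ : ∃ C, C = D + s + 2 := ⟨_, rfl⟩
  obtain ⟨K1, hK1⟩ : ∃ K1 : ℝ, K1 = s + s * s + s * s * ((1 + 2 * r) ^ r * r ^ 3) := ⟨_, rfl⟩
  obtain ⟨K2, hK2⟩ : ∃ K2 : ℝ, K2 = K1 * (1 + (1 + 2 * r) ^ r * r) + 1 := ⟨_, rfl⟩
  obtain ⟨K3, hK3⟩ : ∃ K3 : ℝ, K3 = 1 / 4 * (1 / (2 * s)) ^ s := ⟨_, rfl⟩
  obtain ⟨θ, hθ⟩ : ∃ θ : ℝ, θ = 1 / (32 * Real.exp 2 * (s : ℝ) ^ (2 * s)) := ⟨_, rfl⟩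
  have hs0 : (0 : ℝ) < s := by linarith
  have hK10 : 0 < K1 := by rw [hK1]; positivity
  have hK20 : 0 < K2 := by rw [hK2]; positivity
  have hK30 : 0 < K3 := by rw [hK3]; positivity
  have hθ0 : 0 < θ := by rw [hθ]; positivity
  have hnat : Filter.Tendsto (fun n : ℕ => (n : ℝ)) Filter.atTop Filter.atTop :=
    tendsto_natCast_atTop_atTop
  have hlog : Filter.Tendsto (fun n : ℕ => Real.log n) Filter.atTop Filter.atTop :=
    Real.tendsto_log_atTop.comp hnat
  have hpow : ∀ x : ℝ, 0 < x → Filter.Tendsto (fun n : ℕ => (n : ℝ) ^ x) Filter.atTop Filter.atTop :=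
    fun x hx => (tendsto_rpow_atTop hx).comp hnat
  have hlogpow : ∀ (k : ℕ) (x K : ℝ), 0 < x → 0 < K →
      ∀ᶠ n : ℕ in Filter.atTop, K * Real.log n ^ k ≤ (n : ℝ) ^ x := by
    intro k x K hx hK
    have h1 := (isLittleO_log_rpow_rpow_atTop (k : ℝ) hx).bound (c := 1 / K) (by positivity)
    have h2 := hnat.eventually h1
    filter_upwards [h2, hlog.eventually_ge_atTop 0] with n hn hl
    rw [Real.rpow_natCast, Real.norm_of_nonneg (by positivity),
      Real.norm_of_nonneg (by positivity), div_mul_eq_mul_div, one_mul, le_div_iff₀ hK] at hn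
    linarith
  have hα0 : 0 < (1 - ε) / 2 := by linarith
  have hη0 : 0 < (1 - (2 * s - 3) * ε) / 2 := by linarith
  have hev : ∀ᶠ n : ℕ in Filter.atTop,
      (erdosRogers s (s + d) n : ℝ) ≤ (n : ℝ) ^ ((1 - ε) / 2) * Real.log n ^ (C + 1) := by
    filter_upwards [hlog.eventually_ge_atTop 1, hlogpow 1 ((1 - ε) / 2) (2 * s) hα0 (by positivity),
      (hpow _ hα0).eventually_ge_atTop (2 / (K3 / (16 * K2))),
      hlog.eventually_ge_atTop (8 * s * (2 * K1) ^ (s + s * s) * (16 * K2) / K3),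
      hlog.eventually_ge_atTop (64 * s / K3),
      hlog.eventually_ge_atTop (2 ^ (r * r) * Real.exp 2 * Real.exp (2 * r + 1)),
      hnat.eventually_ge_atTop (4 * (r + 1) * (3 : ℝ) ^ r + 12),
      hlog.eventually_ge_atTop (4 / (θ * s)),
      hlogpow C ε (14 * s) hε (by positivity),
      (hpow _ hη0).eventually_ge_atTop (98 / θ),
      hlog.eventually_ge_atTop (2 * s)] with n e1 e2 e3 e4 e5 e6 e7 e8 e9 e10 e11
    rw [pow_one] at e2
    rw [div_le_iff₀' (by positivity)] at e3 e4 e5 e8 e10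
    exact asym_core s d C r D ε K1 K2 K3 θ hd hds hε hε1 hE hR hr hD hC hK1 hK2 hK3 hθ n _ _ rfl rfl
      e1 e2 e3 e4 e5 e6 e7 e8 e9 e10 e11
  obtain ⟨N, hN⟩ := Filter.eventually_atTop.1 hev
  refine ⟨((C + 1 : ℕ) : ℝ), by positivity, N, fun n hn => ?_⟩
  rw [hα, Real.rpow_natCast]
  exact hN n hn
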